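/- Let d ≥ 4 and 1 ≤ p < 2(d−1)/(d+1). Then for all measurable f : ℝ × ℝ^d → ℂ, ‖ ∫_ℝ (K_r ∗ f(r,·)) dr ‖_{L^p(ℝ^d)}^p ≤ C ∫_{ℝ^d} ∫_ℝ | f(r,y) / (1+|r|)^{(d−1)/2} |^p dν_d(r) dy, where K_r ∗ f(r,·)(x) = ∫ K_r(x−y) f(r,y) dy, with a constant C independent of f. -/

import Mathlib

open MeasureTheory Real Set
open scoped Classical FourierTransform RealInnerProductSpace NNReal ENNReal

noncomputable section

/-- Euclidean space `ℝ^d`. -/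
abbrev Rd (d : ℕ) := EuclideanSpace ℝ (Fin d)

/-- `a` is a "distance function": smooth away from the origin, positive away from the
origin, and homogeneous of degree one. -/
structure IsDistFn {d : ℕ} (a : Rd d → ℝ) : Prop where
  smooth : ContDiffOn ℝ (⊤ : ℕ∞) a {ξ : Rd d | ξ ≠ 0}
  pos : ∀ ξ : Rd d, ξ ≠ 0 → 0 < a ξ
  homog : ∀ t : ℝ, 0 < t → ∀ ξ : Rd d, a (t • ξ) = t * a ξ

/-- Nonvanishing Gaussian curvature of the cosphere `Σ = {a = 1}`: at every point `ξ` of `Σ`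
the second fundamental form, i.e. the Hessian of `a` restricted to the tangent space
`ker (da(ξ))`, is nondegenerate. -/
def CurvNondeg {d : ℕ} (a : Rd d → ℝ) : Prop :=
  ∀ ξ : Rd d, a ξ = 1 → ∀ v : Rd d, fderiv ℝ a ξ v = 0 → v ≠ 0 →
    ∃ w : Rd d, fderiv ℝ a ξ w = 0 ∧ iteratedFDeriv ℝ 2 a ξ ![v, w] ≠ 0

/-- The bump function `η`: smooth, supported in `[1/8,8]`, equal to `1` on `[1/4,4]`. -/
structure IsBump (η : ℝ → ℝ) : Prop where
  smooth : ContDiff ℝ (⊤ : ℕ∞) η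
  supp : ∀ x : ℝ, x ∉ Icc (1/8 : ℝ) 8 → η x = 0
  one : ∀ x ∈ Icc (1/4 : ℝ) 4, η x = 1

/-- The kernel `K_r`, given by the inverse Fourier transform of `ξ ↦ η(a(ξ)) e^{i r a(ξ)}`. -/
def Kker {d : ℕ} (a : Rd d → ℝ) (η : ℝ → ℝ) (r : ℝ) (x : Rd d) : ℂ :=
  ∫ ξ : Rd d, (η (a ξ) : ℂ) * Complex.exp (Complex.I * r * a ξ) *
    Complex.exp (2 * π * Complex.I * (inner ℝ x ξ : ℝ))

/-- Convolution `K ∗ b`. -/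
def conv {d : ℕ} (K b : Rd d → ℂ) (x : Rd d) : ℂ := ∫ y, K (x - y) * b y

/-- The measure `ν_d` on `ℝ`, `dν_d(r) = (1+|r|)^{d-1} dr`. -/
def nuMeas (d : ℕ) : Measure ℝ :=
  volume.withDensity fun r => ENNReal.ofReal ((1 + |r|) ^ (d - 1))

/-- The Lorentz quasinorm `‖f‖_{L^{p,q}(μ)}`. -/
def lorentzNorm {α : Type*} {E : Type*} [MeasurableSpace α] [NormedAddCommGroup E]
    (μ : Measure α) (p : ℝ) (q : ℝ≥0∞) (f : α → E) : ℝ≥0∞ :=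
  if q = ∞ then ⨆ t : ℝ, ENNReal.ofReal t * μ {x | t < ‖f x‖} ^ (1 / p)
  else (∫⁻ t in Ioi (0 : ℝ),
      (ENNReal.ofReal t * μ {x | t < ‖f x‖} ^ (1 / p)) ^ q.toReal / ENNReal.ofReal t) ^
      (1 / q.toReal)

/-- The unit cube `q_z = ∏ [z_i, z_i + 1)`. -/
def qcube (d : ℕ) (z : Fin d → ℤ) : Set (Rd d) :=
  {y : Rd d | ∀ i, (z i : ℝ) ≤ y i ∧ y i < z i + 1}

/-- A normalized function `b_{n,z}`: measurable, bounded by the characteristic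
function of `q_z`. -/
def IsNormalized {d : ℕ} (z : Fin d → ℤ) (b : Rd d → ℂ) : Prop :=
  Measurable b ∧ (∀ y, ‖b y‖ ≤ 1) ∧ ∀ y ∉ qcube d z, b y = 0

/-- A dyadic cube of side length `2^k`, `1 ≤ k ≤ j`, in the tiling of
`[2^j, 2^{j+1}) × ℝ^d`. -/
structure DyCube (d j : ℕ) where
  k : ℕ
  m : ℤ
  zv : Fin d → ℤ
  hk : 1 ≤ k ∧ k ≤ j
  hm : (2:ℤ) ^ (j - k) ≤ m ∧ m < 2 ^ (j + 1 - k)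

/-- side length of a dyadic cube -/
def DyCube.len {d j : ℕ} (Q : DyCube d j) : ℝ := 2 ^ Q.k

/-- a dyadic cube as a subset of `ℝ^{1+d}` -/
def DyCube.toSet {d j : ℕ} (Q : DyCube d j) : Set (ℝ × (Fin d → ℝ)) :=
  {p | ((Q.m : ℝ) * 2 ^ Q.k ≤ p.1 ∧ p.1 < (Q.m + 1) * 2 ^ Q.k) ∧
    ∀ i, (Q.zv i : ℝ) * 2 ^ Q.k ≤ p.2 i ∧ p.2 i < (Q.zv i + 1) * 2 ^ Q.k}

/-- center of a dyadic cube: the `r`-coordinate -/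
def DyCube.centerT {d j : ℕ} (Q : DyCube d j) : ℝ := ((Q.m : ℝ) + 1/2) * 2 ^ Q.k

/-- center of a dyadic cube: the `y`-coordinate -/
def DyCube.centerX {d j : ℕ} (Q : DyCube d j) : Rd d :=
  WithLp.toLp 2 fun i => ((Q.zv i : ℝ) + 1/2) * 2 ^ Q.k

/-- a point `(n,z) ∈ ℕ × ℤ^d` viewed as a point of `ℝ^{1+d}` -/
def embedPt (d : ℕ) (e : ℕ × (Fin d → ℤ)) : ℝ × (Fin d → ℝ) :=
  ((e.1 : ℝ), fun i => (e.2 i : ℝ))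

/-- the number of points of `E` lying in the cube `Q` -/
def cubeCount {d j : ℕ} (E : Finset (ℝ × (Fin d → ℝ))) (Q : DyCube d j) : ℕ :=
  (E.filter (· ∈ Q.toSet)).card

/-- `Q` is `λ`-dense: `#(E ∩ Q) > λ^p l(Q)` -/
def IsDense {d j : ℕ} (E : Finset (ℝ × (Fin d → ℝ))) (lam p : ℝ) (Q : DyCube d j) : Prop :=
  lam ^ p * Q.len < (cubeCount E Q : ℝ)

/-- `Q` is a maximal `λ`-dense dyadic cube -/
def IsMaxDense {d j : ℕ} (E : Finset (ℝ × (Fin d → ℝ))) (lam p : ℝ) (Q : DyCube d j) : Prop :=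
  IsDense E lam p Q ∧
    ∀ Q' : DyCube d j, IsDense E lam p Q' → Q.toSet ⊆ Q'.toSet → Q'.toSet = Q.toSet

/-- a lattice vector viewed as an element of `ℝ^d` -/
def latticeVec (d : ℕ) (z : Fin d → ℤ) : Rd d := WithLp.toLp 2 fun i => (z i : ℝ)

/-- The structural properties of the phase function `ψ = -ψ₋`: Lipschitz with constant `L`,
comparable to the norm, and homogeneous of degree one. -/
structure IsPsi {d : ℕ} (ψ : Rd d → ℝ) (L c₁ c₂ : ℝ) : Prop where
  lip : LipschitzWith (Real.toNNReal L) ψ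
  lower : ∀ x : Rd d, c₁ * ‖x‖ ≤ ψ x
  upper : ∀ x : Rd d, ψ x ≤ c₂ * ‖x‖
  homog : ∀ t : ℝ, 0 < t → ∀ x : Rd d, ψ (t • x) = t * ψ x

/-- The stationary phase kernel estimate for `K_r`, `r ≥ 2`:
`|K_r(x)| ≤ C_N (1+|x|+|r|)^{-(d-1)/2} (1+|ψ(x)-r|)^{-N}`. -/
def KernelEst {d : ℕ} (a : Rd d → ℝ) (η : ℝ → ℝ) (ψ : Rd d → ℝ) : Prop :=
  ∀ N : ℕ, ∃ C : ℝ, 0 < C ∧ ∀ r : ℝ, 2 ≤ r → ∀ x : Rd d,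
    ‖Kker a η r x‖ ≤ C * (1 + ‖x‖ + |r|) ^ (-(((d:ℝ) - 1) / 2)) * (1 + |ψ x - r|) ^ (-(N : ℝ))

/-- The two-sided stationary phase kernel estimate for `K_r`, `|r| ≥ 2`, with the
two phase functions `ψ₊`, `ψ₋`:
`|K_r(x)| ≤ C_N (1+|x|+|r|)^{-(d-1)/2} ∑_± (1+|ψ_±(x)+r|)^{-N}`. -/
def KernelEstPM {d : ℕ} (a : Rd d → ℝ) (η : ℝ → ℝ) (ψp ψm : Rd d → ℝ) : Prop :=
  ∀ N : ℕ, ∃ C : ℝ, 0 < C ∧ ∀ r : ℝ, 2 ≤ |r| → ∀ x : Rd d,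
    ‖Kker a η r x‖ ≤ C * (1 + ‖x‖ + |r|) ^ (-(((d:ℝ) - 1) / 2)) *
      ((1 + |ψp x + r|) ^ (-(N : ℝ)) + (1 + |ψm x + r|) ^ (-(N : ℝ)))

section

open Filter Topology

namespace IsDistFn

variable {d : ℕ} {a : Rd d → ℝ}

lemma contDiffAt (ha : IsDistFn a) {ξ : Rd d} (hξ : ξ ≠ 0) : ContDiffAt ℝ (⊤ : ℕ∞) a ξ :=
  ha.smooth.contDiffAt (isOpen_ne.mem_nhds hξ)

lemma differentiableAt (ha : IsDistFn a) {ξ : Rd d} (hξ : ξ ≠ 0) : DifferentiableAt ℝ a ξ :=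
  (ha.contDiffAt hξ).differentiableAt (by simp)

lemma contDiffAt_fderiv (ha : IsDistFn a) {ξ : Rd d} (hξ : ξ ≠ 0) :
    ContDiffAt ℝ (⊤ : ℕ∞) (fderiv ℝ a) ξ :=
  (ha.contDiffAt hξ).fderiv_right (by simp)

lemma differentiableAt_fderiv (ha : IsDistFn a) {ξ : Rd d} (hξ : ξ ≠ 0) :
    DifferentiableAt ℝ (fderiv ℝ a) ξ :=
  (ha.contDiffAt_fderiv hξ).differentiableAt (by simp)

lemma continuousAt_hess (ha : IsDistFn a) {ξ : Rd d} (hξ : ξ ≠ 0) :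
    ContinuousAt (fderiv ℝ (fderiv ℝ a)) ξ :=
  ((ha.contDiffAt_fderiv hξ).fderiv_right (m := 0) (by simp)).continuousAt

lemma map_zero (ha : IsDistFn a) : a 0 = 0 := by
  have := ha.homog 2 (by norm_num) 0
  simp at this
  linarith

lemma nonneg (ha : IsDistFn a) (ξ : Rd d) : 0 ≤ a ξ := by
  rcases eq_or_ne ξ 0 with rfl | h
  · simp [ha.map_zero]
  · exact (ha.pos ξ h).le

lemma fderiv_smul (ha : IsDistFn a) {t : ℝ} (ht : 0 < t) {ξ : Rd d} (hξ : ξ ≠ 0) :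
    fderiv ℝ a (t • ξ) = fderiv ℝ a ξ := by
  have h1 : HasFDerivAt (fun x => a (t • x)) ((fderiv ℝ a (t • ξ)).comp
      (t • ContinuousLinearMap.id ℝ (Rd d))) ξ :=
    (ha.differentiableAt (smul_ne_zero ht.ne' hξ)).hasFDerivAt.comp ξ
      ((hasFDerivAt_id ξ).const_smul t)
  have h2 : HasFDerivAt (fun x => a (t • x)) (t • fderiv ℝ a ξ) ξ := by
    have : (fun x => a (t • x)) = fun x => t • a x := by
      funext x; simp [ha.homog t ht]
    rw [this]
    exact (ha.differentiableAt hξ).hasFDerivAt.const_smul t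
  have h3 := h1.unique h2
  ext v
  have := congrArg (fun L => L v) h3
  simp at this
  rcases this with h | h
  · exact h
  · exact absurd h ht.ne'

lemma hess_smul (ha : IsDistFn a) {t : ℝ} (ht : 0 < t) {ξ : Rd d} (hξ : ξ ≠ 0) :
    t • fderiv ℝ (fderiv ℝ a) (t • ξ) = fderiv ℝ (fderiv ℝ a) ξ := by
  have h1 : HasFDerivAt (fun x => fderiv ℝ a (t • x)) ((fderiv ℝ (fderiv ℝ a) (t • ξ)).comp
      (t • ContinuousLinearMap.id ℝ (Rd d))) ξ :=
    (ha.differentiableAt_fderiv (smul_ne_zero ht.ne' hξ)).hasFDerivAt.comp ξ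
      ((hasFDerivAt_id ξ).const_smul t)
  have h2 : HasFDerivAt (fun x => fderiv ℝ a (t • x)) (fderiv ℝ (fderiv ℝ a) ξ) ξ := by
    refine (ha.differentiableAt_fderiv hξ).hasFDerivAt.congr_of_eventuallyEq ?_
    filter_upwards [isOpen_ne.mem_nhds hξ] with x hx using ha.fderiv_smul ht hx
  have h3 := h1.unique h2
  ext v w
  have := congrArg (fun L => L v w) h3
  simpa using this

lemma hasDerivAt_line (ha : IsDistFn a) {ξ v : Rd d} {t : ℝ} (h : ξ + t • v ≠ 0) :
    HasDerivAt (fun t : ℝ => a (ξ + t • v)) (fderiv ℝ a (ξ + t • v) v) t := by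
  have hl : HasDerivAt (fun t : ℝ => ξ + t • v) v t := by
    simpa using ((hasDerivAt_id t).smul_const v).const_add ξ
  exact (ha.differentiableAt h).hasFDerivAt.comp_hasDerivAt t hl

lemma hasDerivAt_fderiv_line (ha : IsDistFn a) {ξ v : Rd d} (w : Rd d) {t : ℝ}
    (h : ξ + t • v ≠ 0) :
    HasDerivAt (fun t : ℝ => fderiv ℝ a (ξ + t • v) w)
      (fderiv ℝ (fderiv ℝ a) (ξ + t • v) v w) t := by
  have hl : HasDerivAt (fun t : ℝ => ξ + t • v) v t := by
    simpa using ((hasDerivAt_id t).smul_const v).const_add ξ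
  have := (ha.differentiableAt_fderiv h).hasFDerivAt.comp_hasDerivAt t hl
  have h2 := this.clm_apply (hasDerivAt_const t w)
  simpa using h2

lemma euler (ha : IsDistFn a) {ξ : Rd d} (hξ : ξ ≠ 0) : fderiv ℝ a ξ ξ = a ξ := by
  have h1 := ha.hasDerivAt_line (ξ := ξ) (v := ξ) (t := 0) (by simpa using hξ)
  have h2 : HasDerivAt (fun t : ℝ => a (ξ + t • ξ)) (a ξ) 0 := by
    have h3 : HasDerivAt (fun t : ℝ => (1 + t) * a ξ) (a ξ) 0 := by
      simpa using ((hasDerivAt_id (0:ℝ)).const_add 1).mul_const (a ξ)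
    refine h3.congr_of_eventuallyEq ?_
    filter_upwards [isOpen_Ioi.mem_nhds (show (0:ℝ) ∈ Ioi (-1) by simp)] with t ht
    have : ξ + t • ξ = (1 + t) • ξ := by rw [add_smul, one_smul]
    rw [this, ha.homog _ (by simp at ht; linarith)]
  simpa using h1.unique h2

lemma hess_self (ha : IsDistFn a) {ξ : Rd d} (hξ : ξ ≠ 0) (w : Rd d) :
    fderiv ℝ (fderiv ℝ a) ξ ξ w = 0 := by
  have h1 := ha.hasDerivAt_fderiv_line (ξ := ξ) (v := ξ) w (t := 0) (by simpa using hξ)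
  have h2 : HasDerivAt (fun t : ℝ => fderiv ℝ a (ξ + t • ξ) w) 0 0 := by
    refine (hasDerivAt_const (0:ℝ) (fderiv ℝ a ξ w)).congr_of_eventuallyEq ?_
    filter_upwards [isOpen_Ioi.mem_nhds (show (0:ℝ) ∈ Ioi (-1) by simp)] with t ht
    have : ξ + t • ξ = (1 + t) • ξ := by rw [add_smul, one_smul]
    rw [this, ha.fderiv_smul (by simp at ht; linarith) hξ]
  simpa using h1.unique h2

lemma hess_symm (ha : IsDistFn a) {ξ : Rd d} (hξ : ξ ≠ 0) (v w : Rd d) :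
    fderiv ℝ (fderiv ℝ a) ξ v w = fderiv ℝ (fderiv ℝ a) ξ w v :=
  (ha.contDiffAt hξ).isSymmSndFDerivAt (by simpa using WithTop.coe_le_coe.2 (le_top (a := (2 : ℕ∞)))) v w

end IsDistFn

/-- The Hessian of `a² / 2`. -/
def sqHess {d : ℕ} (a : Rd d → ℝ) (ξ v w : Rd d) : ℝ :=
  a ξ * fderiv ℝ (fderiv ℝ a) ξ v w + fderiv ℝ a ξ v * fderiv ℝ a ξ w

namespace IsDistFn

variable {d : ℕ} {a : Rd d → ℝ}

lemma sqHess_smul (ha : IsDistFn a) {t : ℝ} (ht : 0 < t) {ξ : Rd d} (hξ : ξ ≠ 0) (v w : Rd d) :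
    sqHess a (t • ξ) v w = sqHess a ξ v w := by
  unfold sqHess
  rw [ha.fderiv_smul ht hξ, ← ha.hess_smul ht hξ, ha.homog t ht]
  simp
  ring

lemma sqHess_add_smul (ha : IsDistFn a) {ξ : Rd d} (hξ : ξ ≠ 0) (v w : Rd d) (t : ℝ) :
    sqHess a ξ (v + t • w) (v + t • w) =
      sqHess a ξ v v + 2 * t * sqHess a ξ v w + t ^ 2 * sqHess a ξ w w := by
  unfold sqHess
  simp only [map_add, map_smul, smul_eq_mul, add_apply,
    smul_apply]
  rw [ha.hess_symm hξ w v]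
  ring

lemma sqHess_nondeg (ha : IsDistFn a) (hc : CurvNondeg a) {ξ : Rd d} (hξ : ξ ≠ 0) {v : Rd d}
    (h : ∀ w, sqHess a ξ v w = 0) : v = 0 := by
  by_contra hv
  have hpos := ha.pos ξ hξ
  have h1 := h ξ
  unfold sqHess at h1
  rw [ha.hess_symm hξ, ha.hess_self hξ, ha.euler hξ] at h1
  simp [hpos.ne'] at h1
  have ht : 0 < (a ξ)⁻¹ := inv_pos.2 hpos
  obtain ⟨w, hw, hw2⟩ := hc ((a ξ)⁻¹ • ξ) (by rw [ha.homog _ ht]; field_simp) v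
    (by rw [ha.fderiv_smul ht hξ]; exact h1) hv
  apply hw2
  rw [iteratedFDeriv_two_apply]
  have h2 := h w
  rw [← ha.sqHess_smul ht hξ] at h2
  unfold sqHess at h2
  rw [hw] at h2
  have h3 : a ((a ξ)⁻¹ • ξ) = 1 := by rw [ha.homog _ ht]; field_simp
  rw [h3] at h2
  simpa using h2

lemma hasDerivAt_sq_line (ha : IsDistFn a) {ξ v : Rd d} {t : ℝ} (h : ξ + t • v ≠ 0) :
    HasDerivAt (fun t : ℝ => a (ξ + t • v) ^ 2 / 2)
      (a (ξ + t • v) * fderiv ℝ a (ξ + t • v) v) t := by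
  have := ((ha.hasDerivAt_line h).pow 2).div_const 2
  refine this.congr_deriv ?_
  simp; ring

lemma hasDerivAt_sq_line' (ha : IsDistFn a) {ξ v : Rd d} {t : ℝ} (h : ξ + t • v ≠ 0) :
    HasDerivAt (fun t : ℝ => a (ξ + t • v) * fderiv ℝ a (ξ + t • v) v)
      (sqHess a (ξ + t • v) v v) t := by
  have := (ha.hasDerivAt_line h).mul (ha.hasDerivAt_fderiv_line v h)
  refine this.congr_deriv ?_
  unfold sqHess; ring

lemma eventually_line_ne {ξ v : Rd d} (hξ : ξ ≠ 0) : ∀ᶠ t : ℝ in 𝓝 0, ξ + t • v ≠ 0 := by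
  have : ContinuousAt (fun t : ℝ => ξ + t • v) 0 := by fun_prop
  exact this.eventually_ne (by simpa using hξ)

lemma exists_le_norm (ha : IsDistFn a) (hd : 0 < d) :
    ∃ ξ₀ : Rd d, ‖ξ₀‖ = 1 ∧ ∀ ξ, a ξ₀ * ‖ξ‖ ≤ a ξ := by
  have : Nonempty (Fin d) := ⟨⟨0, hd⟩⟩
  have hne : (Metric.sphere (0 : Rd d) 1).Nonempty := NormedSpace.sphere_nonempty.2 zero_le_one
  obtain ⟨ξ₀, h0, hmin⟩ := (isCompact_sphere (0 : Rd d) 1).exists_isMinOn hne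
    (f := a) (fun x hx => (ha.differentiableAt
      (by intro h; simp [h] at hx)).continuousAt.continuousWithinAt)
  refine ⟨ξ₀, by simpa using h0, fun ξ => ?_⟩
  rcases eq_or_ne ξ 0 with rfl | h
  · simp [ha.map_zero]
  · have h1 : 0 < ‖ξ‖ := norm_pos_iff.2 h
    have := hmin (show ‖ξ‖⁻¹ • ξ ∈ Metric.sphere (0 : Rd d) 1 by
      simp [norm_smul, h1.ne'])
    simp only [Set.mem_ofPred_eq] at this
    rw [ha.homog _ (inv_pos.2 h1)] at this
    calc a ξ₀ * ‖ξ‖ ≤ (‖ξ‖⁻¹ * a ξ) * ‖ξ‖ := by gcongr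
      _ = a ξ := by field_simp

lemma exists_sqHess_nonneg (ha : IsDistFn a) (hd : 0 < d) :
    ∃ ξ₀ : Rd d, ξ₀ ≠ 0 ∧ ∀ v ≠ 0, 0 < sqHess a ξ₀ v v := by
  obtain ⟨ξ₀, h0, hmin⟩ := ha.exists_le_norm hd
  have hξ : ξ₀ ≠ 0 := by intro h; simp [h] at h0
  refine ⟨ξ₀, hξ, fun v hv => ?_⟩
  set m := a ξ₀ with hm
  have hmpos : 0 < m := ha.pos _ hξ
  by_contra hneg
  push Not at hneg
  let h : ℝ → ℝ := fun t => a (ξ₀ + t • v) ^ 2 / 2 - m ^ 2 / 2 * (1 + 2 * t * ⟪ξ₀, v⟫ + t ^ 2 * ‖v‖ ^ 2)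
  have hnorm : ∀ t : ℝ, ‖ξ₀ + t • v‖ ^ 2 = 1 + 2 * t * ⟪ξ₀, v⟫ + t ^ 2 * ‖v‖ ^ 2 := by
    intro t
    rw [norm_add_sq_real, h0, norm_smul, inner_smul_right, mul_pow]
    simp; ring
  have hd1 : ∀ᶠ t : ℝ in 𝓝 0, HasDerivAt h (a (ξ₀ + t • v) * fderiv ℝ a (ξ₀ + t • v) v
      - m ^ 2 / 2 * (2 * ⟪ξ₀, v⟫ + 2 * t * ‖v‖ ^ 2)) t := by
    filter_upwards [eventually_line_ne (v := v) hξ] with t ht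
    refine (ha.hasDerivAt_sq_line ht).sub (HasDerivAt.const_mul _ ?_)
    have h1 := ((((hasDerivAt_id t).const_mul 2).mul_const ⟪ξ₀, v⟫).const_add 1).add
      (((hasDerivAt_id t).pow 2).mul_const (‖v‖ ^ 2))
    refine h1.congr_deriv ?_
    simp
  have hd2 : HasDerivAt (deriv h) (sqHess a ξ₀ v v - m ^ 2 * ‖v‖ ^ 2) 0 := by
    have h1 := ha.hasDerivAt_sq_line' (ξ := ξ₀) (v := v) (t := 0) (by simpa using hξ)
    have h2 : HasDerivAt (fun t : ℝ => m ^ 2 / 2 * (2 * ⟪ξ₀, v⟫ + 2 * t * ‖v‖ ^ 2))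
        (m ^ 2 * ‖v‖ ^ 2) 0 := by
      have := ((((hasDerivAt_id (0:ℝ)).const_mul 2).mul_const (‖v‖ ^ 2)).const_add
        (2 * ⟪ξ₀, v⟫)).const_mul (m ^ 2 / 2)
      refine this.congr_deriv ?_
      ring
    have h3 := h1.sub h2
    simp only [zero_smul, add_zero] at h3
    refine h3.congr_of_eventuallyEq ?_
    filter_upwards [hd1] with t ht using ht.deriv
  have hlm : IsLocalMin h 0 := by
    refine Filter.Eventually.of_forall fun t => ?_
    have e0 : h 0 = 0 := by simp [h, ← hm]
    rw [e0]
    simp only [h]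
    rw [← hnorm]
    have := hmin (ξ₀ + t • v)
    have h5 : (m * ‖ξ₀ + t • v‖) ^ 2 ≤ a (ξ₀ + t • v) ^ 2 := by gcongr
    nlinarith
  have hvp : 0 < ‖v‖ := norm_pos_iff.2 hv
  have hlt : deriv (deriv h) 0 < 0 := by
    rw [hd2.deriv]
    have : 0 < m ^ 2 * ‖v‖ ^ 2 := by positivity
    linarith
  have hmax := isLocalMax_of_deriv_deriv_neg hlt hlm.deriv_eq_zero
    (hd1.self_of_nhds.continuousAt)
  have heq : h =ᶠ[𝓝 0] fun _ => h 0 := by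
    filter_upwards [hlm, hmax] with t h1 h2 using le_antisymm h2 h1
  have : deriv (deriv h) 0 = 0 := by
    have h1 : deriv h =ᶠ[𝓝 0] deriv fun _ => h 0 := heq.deriv
    rw [h1.deriv_eq]; simp
  linarith

lemma continuousAt_sqHess (ha : IsDistFn a) {ξ : Rd d} (hξ : ξ ≠ 0) (v : Rd d) :
    ContinuousAt (fun z : Rd d × Rd d => sqHess a z.1 z.2 z.2) (ξ, v) := by
  unfold sqHess
  have h1 : ContinuousAt (fun z : Rd d × Rd d => a z.1) (ξ, v) :=
    ContinuousAt.comp (f := Prod.fst) (g := a) (ha.contDiffAt hξ).continuousAt continuousAt_fst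
  have h2 : ContinuousAt (fun z : Rd d × Rd d => fderiv ℝ a z.1) (ξ, v) :=
    ContinuousAt.comp (f := Prod.fst) (g := fderiv ℝ a) (ha.contDiffAt_fderiv hξ).continuousAt continuousAt_fst
  have h3 : ContinuousAt (fun z : Rd d × Rd d => fderiv ℝ (fderiv ℝ a) z.1) (ξ, v) :=
    ContinuousAt.comp (f := Prod.fst) (g := fderiv ℝ (fderiv ℝ a)) (ha.continuousAt_hess hξ) continuousAt_fst
  have h4 : ContinuousAt (fun z : Rd d × Rd d => z.2) (ξ, v) := continuousAt_snd
  exact (h1.mul ((h3.clm_apply h4).clm_apply h4)).add ((h2.clm_apply h4).mul (h2.clm_apply h4))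

lemma sqHess_pos (ha : IsDistFn a) (hc : CurvNondeg a) (hd : 2 ≤ d) {ξ : Rd d} (hξ : ξ ≠ 0)
    {v : Rd d} (hv : v ≠ 0) : 0 < sqHess a ξ v v := by
  let P : Set (Rd d) := {ξ | ξ ≠ 0 ∧ ∀ v ∈ Metric.sphere (0 : Rd d) 1, 0 < sqHess a ξ v v}
  let N : Set (Rd d) := {ξ | ξ ≠ 0 ∧ ∃ v, sqHess a ξ v v < 0}
  have hscale : ∀ ξ v : Rd d, v ≠ 0 → sqHess a ξ v v = ‖v‖ ^ 2 * sqHess a ξ (‖v‖⁻¹ • v) (‖v‖⁻¹ • v) := by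
    intro ξ v hv
    have : 0 < ‖v‖ := norm_pos_iff.2 hv
    unfold sqHess
    simp
    field_simp
  have hP : IsOpen P := by
    rw [isOpen_iff_mem_nhds]
    rintro ξ ⟨h1, h2⟩
    have := (isCompact_sphere (0 : Rd d) 1).eventually_forall_of_forall_eventually (x₀ := ξ)
      (P := fun ξ v => 0 < sqHess a ξ v v) (fun v hv =>
        (ha.continuousAt_sqHess h1 v).eventually (isOpen_Ioi.mem_nhds (h2 v hv)))
    filter_upwards [this, isOpen_ne.mem_nhds h1] with x h3 h4 using ⟨h4, h3⟩
  have hN : IsOpen N := by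
    rw [isOpen_iff_mem_nhds]
    rintro ξ ⟨h1, v, h2⟩
    have h5 : ContinuousAt (fun x => sqHess a x v v) ξ :=
      ContinuousAt.comp (f := fun x => (x, v)) (g := fun z : Rd d × Rd d => sqHess a z.1 z.2 z.2)
        (ha.continuousAt_sqHess h1 v) (by fun_prop)
    filter_upwards [h5.eventually (isOpen_Iio.mem_nhds h2), isOpen_ne.mem_nhds h1] with x h3 h4
      using ⟨h4, v, h3⟩
  have hdisj : Disjoint P N := by
    rw [Set.disjoint_left]
    rintro ξ ⟨_, h2⟩ ⟨_, v, h4⟩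
    have hv : v ≠ 0 := by rintro rfl; simp [sqHess] at h4
    have : 0 < ‖v‖ := norm_pos_iff.2 hv
    rw [hscale ξ v hv] at h4
    have := h2 (‖v‖⁻¹ • v) (by simp [norm_smul, this.ne'])
    nlinarith [sq_nonneg ‖v‖]
  have hcov : {ξ : Rd d | ξ ≠ 0} ⊆ P ∪ N := by
    intro ξ hξ
    by_cases h : ∃ v, sqHess a ξ v v < 0
    · exact Or.inr ⟨hξ, h⟩
    · push Not at h
      refine Or.inl ⟨hξ, fun v hv => ?_⟩
      refine lt_of_le_of_ne (h v) fun h0 => ?_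
      have hv0 : v = 0 := by
        refine ha.sqHess_nondeg hc hξ fun w => ?_
        by_contra hne
        set b := sqHess a ξ v w
        set e := sqHess a ξ w w
        have he : 0 ≤ e := h w
        have := h (v + (-b / (e + 1)) • w)
        rw [ha.sqHess_add_smul hξ, ← h0] at this
        have hb : 0 < b ^ 2 := by positivity
        have h7 : 0 + 2 * (-b / (e + 1)) * b + (-b / (e + 1)) ^ 2 * e =
            - (b ^ 2 * (e + 2)) / (e + 1) ^ 2 := by field_simp; ring
        rw [h7] at this
        have : -(b ^ 2 * (e + 2)) / (e + 1) ^ 2 < 0 := by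
          apply div_neg_of_neg_of_pos
          · have : 0 < b ^ 2 * (e + 2) := by positivity
            linarith
          · positivity
        linarith
      simp [hv0] at hv
  have hconn : IsPreconnected {ξ : Rd d | ξ ≠ 0} := by
    have : IsConnected ({(0 : Rd d)}ᶜ) := isConnected_compl_singleton_of_one_lt_rank (by
      rw [← Module.finrank_eq_rank, finrank_euclideanSpace_fin]; exact_mod_cast hd) 0
    exact this.isPreconnected
  have hne : ({ξ : Rd d | ξ ≠ 0} ∩ P).Nonempty := by
    obtain ⟨ξ₀, h1, h2⟩ := ha.exists_sqHess_nonneg (by omega)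
    exact ⟨ξ₀, h1, h1, fun v hv => h2 v (by rintro rfl; simp at hv)⟩
  have := hconn.subset_left_of_subset_union hP hN hdisj hcov hne hξ
  have hvp : 0 < ‖v‖ := norm_pos_iff.2 hv
  rw [hscale ξ v hv]
  have h3 := this.2 (‖v‖⁻¹ • v) (by simp [norm_smul, hvp.ne'])
  positivity

lemma exists_sqHess_lower (ha : IsDistFn a) (hc : CurvNondeg a) (hd : 2 ≤ d) :
    ∃ c > 0, ∀ ξ : Rd d, ξ ≠ 0 → ∀ v, c * ‖v‖ ^ 2 ≤ sqHess a ξ v v := by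
  have : Nonempty (Fin d) := ⟨⟨0, by omega⟩⟩
  have hne : (Metric.sphere (0 : Rd d) 1).Nonempty := NormedSpace.sphere_nonempty.2 zero_le_one
  obtain ⟨z, hz, hmin⟩ := ((isCompact_sphere (0 : Rd d) 1).prod
    (isCompact_sphere (0 : Rd d) 1)).exists_isMinOn (hne.prod hne)
    (f := fun z : Rd d × Rd d => sqHess a z.1 z.2 z.2) (fun x hx =>
      (ha.continuousAt_sqHess (by intro h; simp [h] at hx) x.2).continuousWithinAt)
  have hz1 : z.1 ≠ 0 := by intro h; simp [h] at hz
  have hz2 : z.2 ≠ 0 := by intro h; simp [h] at hz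
  refine ⟨_, ha.sqHess_pos hc hd hz1 hz2, fun ξ hξ v => ?_⟩
  rcases eq_or_ne v 0 with rfl | hv
  · simp [sqHess]
  have h1 : 0 < ‖ξ‖ := norm_pos_iff.2 hξ
  have h2 : 0 < ‖v‖ := norm_pos_iff.2 hv
  have h3 := hmin (show (‖ξ‖⁻¹ • ξ, ‖v‖⁻¹ • v) ∈ _ by simp [norm_smul, h1.ne', h2.ne'])
  simp only [Set.mem_ofPred_eq] at h3
  rw [ha.sqHess_smul (inv_pos.2 h1) hξ] at h3
  have h4 : sqHess a ξ v v = ‖v‖ ^ 2 * sqHess a ξ (‖v‖⁻¹ • v) (‖v‖⁻¹ • v) := by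
    unfold sqHess
    simp
    field_simp
  rw [h4, mul_comm]
  gcongr

/-- Uniform strict convexity of the unit ball of `a`. -/
lemma exists_convex (ha : IsDistFn a) (hc : CurvNondeg a) (hd : 2 ≤ d) :
    ∃ c > 0, ∀ ξ ω : Rd d, a ξ = 1 → a ω = 1 → fderiv ℝ a ξ ω ≤ 1 - c * ‖ξ - ω‖ ^ 2 := by
  obtain ⟨c, hc0, hlow⟩ := ha.exists_sqHess_lower hc hd
  obtain ⟨ξ₀, h0, hmin⟩ := ha.exists_le_norm (by omega)
  have hξ0 : ξ₀ ≠ 0 := by intro h; simp [h] at h0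
  set m := a ξ₀ with hm
  have hmpos : 0 < m := ha.pos _ hξ0
  refine ⟨min (c / 2) (m ^ 2 / 4), by positivity, fun ξ ω h1 h2 => ?_⟩
  have hξ : ξ ≠ 0 := by rintro rfl; simp [ha.map_zero] at h1
  by_cases hseg : ∀ t ∈ Icc (0:ℝ) 1, ξ + t • (ω - ξ) ≠ 0
  · set v := ω - ξ with hv
    have hcv : ConvexOn ℝ (Icc (0:ℝ) 1) (fun t : ℝ => a (ξ + t • v) ^ 2 / 2 - c * ‖v‖ ^ 2 * t ^ 2 / 2) := by
      refine convexOn_of_hasDerivWithinAt2_nonneg (convex_Icc 0 1)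
        (f' := fun t => a (ξ + t • v) * fderiv ℝ a (ξ + t • v) v - c * ‖v‖ ^ 2 * t)
        (f'' := fun t => sqHess a (ξ + t • v) v v - c * ‖v‖ ^ 2) ?_ ?_ ?_ ?_
      · intro t ht
        exact ((ha.hasDerivAt_sq_line (hseg t ht)).continuousAt.sub (by fun_prop)).continuousWithinAt
      · intro t ht
        refine HasDerivAt.hasDerivWithinAt ?_
        refine ((ha.hasDerivAt_sq_line (hseg t (interior_subset ht))).sub
          ((((hasDerivAt_id t).pow 2).const_mul (c * ‖v‖ ^ 2)).div_const 2)).congr_deriv ?_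
        simp
        ring
      · intro t ht
        refine HasDerivAt.hasDerivWithinAt ?_
        refine ((ha.hasDerivAt_sq_line' (hseg t (interior_subset ht))).sub
          ((hasDerivAt_id t).const_mul (c * ‖v‖ ^ 2))).congr_deriv ?_
        simp
      · intro t ht
        have := hlow _ (hseg t (interior_subset ht)) v
        linarith
    have hder : HasDerivAt (fun t : ℝ => a (ξ + t • v) ^ 2 / 2 - c * ‖v‖ ^ 2 * t ^ 2 / 2)
        (fderiv ℝ a ξ v) 0 := by
      refine ((ha.hasDerivAt_sq_line (hseg 0 (by simp))).sub
          ((((hasDerivAt_id (0:ℝ)).pow 2).const_mul (c * ‖v‖ ^ 2)).div_const 2)).congr_deriv ?_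
      simp [h1]
    have := hcv.le_slope_of_hasDerivAt (by simp) (by simp) one_pos hder
    simp [slope_def_field] at this
    rw [h1, show ξ + v = ω by simp [hv], h2, show fderiv ℝ a ξ v = fderiv ℝ a ξ ω - 1 by
      rw [hv, map_sub, ha.euler hξ, h1]] at this
    have h6 : min (c / 2) (m ^ 2 / 4) * ‖ξ - ω‖ ^ 2 ≤ c / 2 * ‖v‖ ^ 2 := by
      rw [hv, norm_sub_rev]
      gcongr
      exact min_le_left _ _
    linarith
  · push Not at hseg
    obtain ⟨t, ht, h3⟩ := hseg
    have h4 : t • ω = -(1 - t) • ξ := by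
      have : ξ + t • (ω - ξ) = t • ω + (1 - t) • ξ := by module
      rw [this] at h3
      rw [eq_neg_of_add_eq_zero_left h3]; module
    have ht0 : 0 < t := by
      rcases ht.1.lt_or_eq with h | h
      · exact h
      · rw [← h] at h3; simp at h3; exact absurd h3 hξ
    have h5 : t * fderiv ℝ a ξ ω = -(1 - t) := by
      have := congrArg (fderiv ℝ a ξ) h4
      simpa [ha.euler hξ, h1] using this
    have h6 : fderiv ℝ a ξ ω ≤ 0 := by
      by_contra h; push Not at h
      have : 0 < t * fderiv ℝ a ξ ω := mul_pos ht0 h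
      linarith [ht.2]
    have h7 : ‖ξ - ω‖ ≤ 2 / m := by
      have e1 : ‖ξ‖ ≤ 1 / m := by rw [le_div_iff₀ hmpos]; linarith [hmin ξ]
      have e2 : ‖ω‖ ≤ 1 / m := by rw [le_div_iff₀ hmpos]; linarith [hmin ω]
      calc ‖ξ - ω‖ ≤ ‖ξ‖ + ‖ω‖ := norm_sub_le _ _
        _ ≤ 1 / m + 1 / m := by gcongr
        _ = 2 / m := by ring
    have h8 : min (c / 2) (m ^ 2 / 4) * ‖ξ - ω‖ ^ 2 ≤ m ^ 2 / 4 * (2 / m) ^ 2 := by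
      gcongr
      exact min_le_right _ _
    have h9 : m ^ 2 / 4 * (2 / m) ^ 2 = 1 := by field_simp; norm_num
    linarith

lemma exists_norm_le (ha : IsDistFn a) : ∃ C > 0, ∀ ξ, a ξ ≤ C * ‖ξ‖ := by
  obtain ⟨C, hC⟩ := (isCompact_sphere (0 : Rd d) 1).bddAbove_image
    (f := a) (fun x hx => (ha.differentiableAt
      (by intro h; simp [h] at hx)).continuousAt.continuousWithinAt)
  refine ⟨max C 1, by positivity, fun ξ => ?_⟩
  rcases eq_or_ne ξ 0 with rfl | h
  · simp [ha.map_zero]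
  · have h1 : 0 < ‖ξ‖ := norm_pos_iff.2 h
    have h2 : a (‖ξ‖⁻¹ • ξ) ≤ C := hC (mem_image_of_mem _ (by simp [norm_smul, h1.ne']))
    rw [ha.homog _ (inv_pos.2 h1)] at h2
    calc a ξ = (‖ξ‖⁻¹ * a ξ) * ‖ξ‖ := by field_simp
      _ ≤ max C 1 * ‖ξ‖ := by gcongr; exact h2.trans (le_max_left _ _)

lemma continuous (ha : IsDistFn a) : Continuous a := by
  rw [continuous_iff_continuousAt]
  intro ξ
  rcases eq_or_ne ξ 0 with rfl | h
  · obtain ⟨C, -, hC⟩ := ha.exists_norm_le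
    rw [ContinuousAt, ha.map_zero]
    refine squeeze_zero (g := fun ξ => C * ‖ξ‖) ha.nonneg hC ?_
    have : Continuous fun ξ : Rd d => C * ‖ξ‖ := by fun_prop
    simpa using this.tendsto 0
  · exact (ha.differentiableAt h).continuousAt

lemma isCompact_Icc (ha : IsDistFn a) (hd : 0 < d) (s t : ℝ) : IsCompact (a ⁻¹' Icc s t) := by
  obtain ⟨ξ₀, h0, hmin⟩ := ha.exists_le_norm hd
  have hm : 0 < a ξ₀ := ha.pos _ (by rintro rfl; simp at h0)
  refine (isCompact_closedBall (0 : Rd d) (t / a ξ₀)).of_isClosed_subset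
    (isClosed_Icc.preimage ha.continuous) fun ξ hξ => ?_
  rw [mem_closedBall_zero_iff, le_div_iff₀ hm, mul_comm]
  exact (hmin ξ).trans hξ.2

lemma ne_zero_of_pos (ha : IsDistFn a) {ξ : Rd d} (h : 0 < a ξ) : ξ ≠ 0 := by
  rintro rfl
  simp [ha.map_zero] at h

end IsDistFn

end

section

open Filter Topology

/-- Derivative along the affine vector field `ξ ↦ v + κ ξ`. -/
def fieldDeriv {d : ℕ} (v : Rd d) (κ : ℝ) (b : Rd d → ℂ) (ξ : Rd d) : ℂ :=
  fderiv ℝ b ξ (v + κ • ξ)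

/-- `b` is smooth on `K` and its first `k` derivatives along the field `ξ ↦ v + κ ξ` are bounded
by `C * W` on `K`. -/
def IsSym {d : ℕ} (K : Set (Rd d)) (v : Rd d) (κ : ℝ) (k : ℕ) (C : ℝ) (W : Rd d → ℝ)
    (b : Rd d → ℂ) : Prop :=
  ContDiffOn ℝ (⊤ : ℕ∞) b K ∧ ∀ j ≤ k, ∀ ξ ∈ K, ‖(fieldDeriv v κ)^[j] b ξ‖ ≤ C * W ξ

variable {d : ℕ} {K : Set (Rd d)} {v : Rd d} {κ : ℝ}

lemma fieldDeriv_congr (hK : IsOpen K) {b c : Rd d → ℂ} (h : EqOn b c K) :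
    EqOn (fieldDeriv v κ b) (fieldDeriv v κ c) K := by
  intro ξ hξ
  unfold fieldDeriv
  rw [(h.eventuallyEq_of_mem (hK.mem_nhds hξ)).fderiv_eq]

lemma fieldDeriv_iterate_congr (hK : IsOpen K) {b c : Rd d → ℂ} (h : EqOn b c K) (j : ℕ) :
    EqOn ((fieldDeriv v κ)^[j] b) ((fieldDeriv v κ)^[j] c) K := by
  induction j generalizing b c with
  | zero => simpa using h
  | succ n ih =>
    rw [Function.iterate_succ_apply, Function.iterate_succ_apply]
    exact ih (fieldDeriv_congr hK h)

lemma contDiffOn_fieldDeriv (hK : IsOpen K) {b : Rd d → ℂ} (hb : ContDiffOn ℝ (⊤ : ℕ∞) b K) :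
    ContDiffOn ℝ (⊤ : ℕ∞) (fieldDeriv v κ b) K := by
  have h1 : ContDiffOn ℝ (⊤ : ℕ∞) (fderiv ℝ b) K := hb.fderiv_of_isOpen hK (by simp)
  exact h1.clm_apply (by fun_prop)

namespace IsSym

variable {k : ℕ} {C C' : ℝ} {W W' : Rd d → ℝ} {b c : Rd d → ℂ}

lemma differentiableAt (hK : IsOpen K) (hb : IsSym K v κ k C W b) {ξ : Rd d} (hξ : ξ ∈ K) :
    DifferentiableAt ℝ b ξ :=
  (hb.1.contDiffAt (hK.mem_nhds hξ)).differentiableAt (by simp)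

lemma bound (hb : IsSym K v κ k C W b) {ξ : Rd d} (hξ : ξ ∈ K) : ‖b ξ‖ ≤ C * W ξ :=
  hb.2 0 (Nat.zero_le _) ξ hξ

lemma zero_iff : IsSym K v κ 0 C W b ↔
    ContDiffOn ℝ (⊤ : ℕ∞) b K ∧ ∀ ξ ∈ K, ‖b ξ‖ ≤ C * W ξ := by
  unfold IsSym
  simp

lemma succ_iff (hK : IsOpen K) : IsSym K v κ (k + 1) C W b ↔
    ContDiffOn ℝ (⊤ : ℕ∞) b K ∧ (∀ ξ ∈ K, ‖b ξ‖ ≤ C * W ξ) ∧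
      IsSym K v κ k C W (fieldDeriv v κ b) := by
  constructor
  · rintro ⟨h1, h2⟩
    refine ⟨h1, h2 0 (Nat.zero_le _), contDiffOn_fieldDeriv hK h1, fun j hj ξ hξ => ?_⟩
    rw [← Function.iterate_succ_apply]
    exact h2 (j + 1) (by omega) ξ hξ
  · rintro ⟨h1, h2, h3⟩
    refine ⟨h1, fun j hj ξ hξ => ?_⟩
    cases j with
    | zero => exact h2 ξ hξ
    | succ n =>
      rw [Function.iterate_succ_apply]
      exact h3.2 n (by omega) ξ hξ

lemma congr (hK : IsOpen K) (hb : IsSym K v κ k C W b) (h : EqOn c b K) :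
    IsSym K v κ k C W c :=
  ⟨hb.1.congr h, fun j hj ξ hξ => by
    rw [fieldDeriv_iterate_congr hK h j hξ]; exact hb.2 j hj ξ hξ⟩

lemma mono_order {k' : ℕ} (hb : IsSym K v κ k C W b) (h : k' ≤ k) : IsSym K v κ k' C W b :=
  ⟨hb.1, fun j hj => hb.2 j (hj.trans h)⟩

lemma mono (hb : IsSym K v κ k C W b) (h : ∀ ξ ∈ K, C * W ξ ≤ C' * W' ξ) :
    IsSym K v κ k C' W' b :=
  ⟨hb.1, fun j hj ξ hξ => (hb.2 j hj ξ hξ).trans (h ξ hξ)⟩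

lemma mono_const (hb : IsSym K v κ k C W b) (h : C ≤ C') (hW : ∀ ξ ∈ K, 0 ≤ W ξ) :
    IsSym K v κ k C' W b :=
  hb.mono fun ξ hξ => mul_le_mul_of_nonneg_right h (hW ξ hξ)

lemma add (hK : IsOpen K) (hb : IsSym K v κ k C W b) (hc : IsSym K v κ k C' W c) :
    IsSym K v κ k (C + C') W (fun ξ => b ξ + c ξ) := by
  induction k generalizing b c with
  | zero =>
    rw [zero_iff] at *
    refine ⟨hb.1.add hc.1, fun ξ hξ => ?_⟩
    rw [add_mul]
    exact norm_add_le_of_le (hb.2 ξ hξ) (hc.2 ξ hξ)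
  | succ n ih =>
    have hb' := (succ_iff hK).1 hb
    have hc' := (succ_iff hK).1 hc
    refine (succ_iff hK).2 ⟨hb.1.add hc.1, fun ξ hξ => ?_, ?_⟩
    · rw [add_mul]
      exact norm_add_le_of_le (hb.bound hξ) (hc.bound hξ)
    · refine (ih hb'.2.2 hc'.2.2).congr hK fun ξ hξ => ?_
      unfold fieldDeriv
      rw [fderiv_fun_add (hb.differentiableAt hK hξ) (hc.differentiableAt hK hξ)]
      rfl

lemma sum (hK : IsOpen K) {ι : Type*} (s : Finset ι) {b : ι → Rd d → ℂ}
    {C : ι → ℝ} (hb : ∀ i ∈ s, IsSym K v κ k (C i) W (b i)) :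
    IsSym K v κ k (∑ i ∈ s, C i) W (fun ξ => ∑ i ∈ s, b i ξ) := by
  induction s using Finset.induction_on with
  | empty =>
    simp only [Finset.sum_empty]
    have : ∀ j, (fieldDeriv v κ)^[j] (fun _ => (0:ℂ)) = fun _ => 0 := by
      intro j
      induction j with
      | zero => rfl
      | succ n ih =>
        rw [Function.iterate_succ_apply]
        convert ih using 2
        funext ξ
        simp [fieldDeriv]
    refine ⟨contDiffOn_const, fun j _ ξ _ => ?_⟩
    simp [this]
  | insert i s hi ih =>
    simp only [Finset.sum_insert hi]
    exact (hb i (Finset.mem_insert_self _ _)).add hK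
      (ih fun j hj => hb j (Finset.mem_insert_of_mem hj))

lemma mul (hK : IsOpen K) (hb : IsSym K v κ k C W b) (hc : IsSym K v κ k C' W' c) :
    IsSym K v κ k (2 ^ k * (C * C')) (fun ξ => W ξ * W' ξ) (fun ξ => b ξ * c ξ) := by
  have key : ∀ {k} {b c : Rd d → ℂ}, IsSym K v κ k C W b → IsSym K v κ k C' W' c →
      ∀ ξ ∈ K, ‖b ξ * c ξ‖ ≤ C * C' * (W ξ * W' ξ) := by
    intro k b c hb hc ξ hξ
    rw [norm_mul]
    calc ‖b ξ‖ * ‖c ξ‖ ≤ (C * W ξ) * (C' * W' ξ) :=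
          mul_le_mul (hb.bound hξ) (hc.bound hξ) (norm_nonneg _) ((norm_nonneg _).trans (hb.bound hξ))
      _ = _ := by ring
  induction k generalizing b c with
  | zero =>
    rw [zero_iff]
    refine ⟨hb.1.mul hc.1, fun ξ hξ => ?_⟩
    simpa using key hb hc ξ hξ
  | succ n ih =>
    have hb' := (succ_iff hK).1 hb
    have hc' := (succ_iff hK).1 hc
    refine (succ_iff hK).2 ⟨hb.1.mul hc.1, fun ξ hξ => ?_, ?_⟩
    · refine (key hb hc ξ hξ).trans ?_
      have h0 := (norm_nonneg _).trans (key hb hc ξ hξ)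
      have : (1:ℝ) ≤ 2 ^ (n + 1) := one_le_pow₀ (by norm_num)
      nlinarith
    · have h1 := (ih hb'.2.2 (hc.mono_order n.le_succ)).add hK
        (ih (hb.mono_order n.le_succ) hc'.2.2)
      have e : (2:ℝ) ^ (n + 1) * (C * C') = 2 ^ n * (C * C') + 2 ^ n * (C * C') := by ring
      rw [e]
      refine h1.congr hK fun ξ hξ => ?_
      unfold fieldDeriv
      rw [fderiv_fun_mul (hb.differentiableAt hK hξ) (hc.differentiableAt hK hξ)]
      simp
      ring

lemma const (z : ℂ) : IsSym K v κ k ‖z‖ (fun _ => 1) (fun _ => z) := by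
  refine ⟨contDiffOn_const, fun j _ ξ _ => ?_⟩
  cases j with
  | zero => simp
  | succ n =>
    have : ∀ j, (fieldDeriv v κ)^[j] (fun _ => (0:ℂ)) = fun _ => 0 := by
      intro j
      induction j with
      | zero => rfl
      | succ n ih =>
        rw [Function.iterate_succ_apply]
        convert ih using 2
        funext ξ
        simp [fieldDeriv]
    rw [Function.iterate_succ_apply, show fieldDeriv v κ (fun _ => z) = fun _ => 0 by
      funext ξ; simp [fieldDeriv], this]
    simp

lemma const_mul (hK : IsOpen K) (z : ℂ) (hb : IsSym K v κ k C W b) :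
    IsSym K v κ k (2 ^ k * (‖z‖ * C)) W (fun ξ => z * b ξ) := by
  simpa using (const (K := K) (v := v) (κ := κ) (k := k) z).mul hK hb

/-- Functions that are eigenvectors for the field derivative. -/
lemma of_eigen (hK : IsOpen K) {z : ℂ} (hz : ‖z‖ ≤ 1) (hs : ContDiffOn ℝ (⊤ : ℕ∞) b K)
    (hb : ∀ ξ ∈ K, ‖b ξ‖ ≤ C * W ξ) (he : ∀ ξ ∈ K, fieldDeriv v κ b ξ = z * b ξ) :
    IsSym K v κ k C W b := by
  have : ∀ j, EqOn ((fieldDeriv v κ)^[j] b) (fun ξ => z ^ j * b ξ) K := by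
    intro j
    induction j with
    | zero => intro ξ _; simp
    | succ n ih =>
      intro ξ hξ
      rw [Function.iterate_succ_apply']
      rw [fieldDeriv_congr hK ih hξ]
      have hd : DifferentiableAt ℝ b ξ :=
        (hs.contDiffAt (hK.mem_nhds hξ)).differentiableAt (by simp)
      have := he ξ hξ
      unfold fieldDeriv at this ⊢
      rw [fderiv_const_mul hd]
      simp only [smul_apply, smul_eq_mul, this]
      ring
  refine ⟨hs, fun j _ ξ hξ => ?_⟩
  rw [this j hξ, norm_mul, norm_pow]
  calc ‖z‖ ^ j * ‖b ξ‖ ≤ 1 * ‖b ξ‖ := by gcongr; exact pow_le_one₀ (norm_nonneg _) hz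
    _ ≤ _ := by simpa using hb ξ hξ

end IsSym

lemma fieldDeriv_eq_sum (b : Rd d → ℂ) (ξ : Rd d) :
    fieldDeriv v κ b ξ = ∑ i, (((v + κ • ξ) i : ℝ) : ℂ) *
      fderiv ℝ b ξ (EuclideanSpace.basisFun (Fin d) ℝ i) := by
  unfold fieldDeriv
  conv_lhs => rw [← (EuclideanSpace.basisFun (Fin d) ℝ).sum_repr (v + κ • ξ)]
  simp

lemma isSym_coord (hK : IsOpen K) {R B : ℝ} (hv : ‖v‖ ≤ R) (hκ : |κ| ≤ 1)
    (hB : ∀ ξ ∈ K, ‖ξ‖ ≤ B) (k : ℕ) (i : Fin d) :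
    IsSym K v κ k (R + B) (fun _ => 1) (fun ξ => (((v + κ • ξ) i : ℝ) : ℂ)) := by
  let L : Rd d →L[ℝ] ℂ := Complex.ofRealCLM.comp (EuclideanSpace.proj i : Rd d →L[ℝ] ℝ)
  have hd : ∀ ξ : Rd d, HasFDerivAt (fun ξ : Rd d => L (v + κ • ξ))
      (L.comp (κ • ContinuousLinearMap.id ℝ (Rd d))) ξ := fun ξ =>
    L.hasFDerivAt.comp ξ (((hasFDerivAt_id ξ).const_smul κ).const_add v)
  refine IsSym.of_eigen hK (z := (κ : ℂ)) (by simpa using hκ) ?_ ?_ ?_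
  · have : ContDiff ℝ (⊤ : ℕ∞) (fun ξ : Rd d => L (v + κ • ξ)) := by fun_prop
    exact this.contDiffOn
  · intro ξ hξ
    have h1 : ‖(v + κ • ξ) i‖ ≤ ‖v + κ • ξ‖ := PiLp.norm_apply_le _ i
    have h2 : ‖v + κ • ξ‖ ≤ R + B := by
      refine norm_add_le_of_le hv ?_
      rw [norm_smul]
      calc ‖κ‖ * ‖ξ‖ ≤ 1 * ‖ξ‖ := by gcongr; exact hκ
        _ ≤ B := by simpa using hB ξ hξ
    rw [Complex.norm_real, mul_one]
    exact h1.trans h2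
  · intro ξ _
    have h1 : fieldDeriv v κ (fun ξ : Rd d => L (v + κ • ξ)) ξ = κ * L (v + κ • ξ) := by
      unfold fieldDeriv
      rw [(hd ξ).fderiv]
      simp [L]
      ring
    exact h1

/-- Smooth functions are symbols, uniformly in the field. -/
lemma exists_isSym_of_contDiffOn (hK : IsOpen K) {Kc U : Set (Rd d)} (hU : IsOpen U)
    (hKc : IsCompact Kc) (hsub : K ⊆ Kc) (hKU : Kc ⊆ U) (R : ℝ) (hR : 0 ≤ R) (k : ℕ) (g : Rd d → ℂ)
    (hg : ContDiffOn ℝ (⊤ : ℕ∞) g U) : ∃ C, 0 ≤ C ∧ ∀ (v : Rd d) (κ : ℝ), ‖v‖ ≤ R → |κ| ≤ 1 →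
      IsSym K v κ k C (fun _ => 1) g := by
  have hbase : ∀ g : Rd d → ℂ, ContDiffOn ℝ (⊤ : ℕ∞) g U → ∃ C, 0 ≤ C ∧ ∀ ξ ∈ K, ‖g ξ‖ ≤ C := by
    intro g hg
    obtain ⟨C, hC⟩ := hKc.exists_bound_of_continuousOn (hg.continuousOn.mono hKU)
    exact ⟨max C 0, le_max_right _ _, fun ξ hξ => (hC ξ (hsub hξ)).trans (le_max_left _ _)⟩
  induction k generalizing g with
  | zero =>
    obtain ⟨C, h0, hC⟩ := hbase g hg
    refine ⟨C, h0, fun v κ _ _ => IsSym.zero_iff.2 ⟨hg.mono (hsub.trans hKU), ?_⟩⟩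
    simpa using hC
  | succ n ih =>
    obtain ⟨C, h0, hC⟩ := hbase g hg
    obtain ⟨B, hB⟩ := hKc.isBounded.exists_norm_le
    set B' := max B 0
    have hg' : ∀ i, ContDiffOn ℝ (⊤ : ℕ∞)
        (fun ξ => fderiv ℝ g ξ (EuclideanSpace.basisFun (Fin d) ℝ i)) U := fun i =>
      (hg.fderiv_of_isOpen hU (by simp)).clm_apply contDiffOn_const
    choose D hD0 hD using fun i => ih _ (hg' i)
    refine ⟨C + ∑ i, 2 ^ n * ((R + B') * D i), ?_, fun v κ hv hκ => ?_⟩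
    · have : ∀ i, 0 ≤ 2 ^ n * ((R + B') * D i) := fun i => by
        have := hD0 i
        positivity
      exact add_nonneg h0 (Finset.sum_nonneg fun i _ => this i)
    · have hs : 0 ≤ ∑ i, 2 ^ n * ((R + B') * D i) := Finset.sum_nonneg fun i _ => by
        have := hD0 i
        positivity
      refine (IsSym.succ_iff hK).2 ⟨hg.mono (hsub.trans hKU), fun ξ hξ => ?_, ?_⟩
      · rw [mul_one]; linarith [hC ξ hξ]
      · have h1 := IsSym.sum hK Finset.univ (fun i _ => (isSym_coord hK hv hκ
          (fun ξ hξ => (hB ξ (hsub hξ)).trans (le_max_left B 0)) n i).mul hK (hD i v κ hv hκ))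
        refine (h1.congr hK (fun ξ _ => fieldDeriv_eq_sum g ξ)).mono fun ξ _ => ?_
        simp
        linarith

end

section

open Filter Topology

variable {d : ℕ} {K : Set (Rd d)} {v : Rd d} {κ : ℝ}

lemma contDiff_of_tsupport_subset (hK : IsOpen K) {b : Rd d → ℂ}
    (hb : ContDiffOn ℝ (⊤ : ℕ∞) b K) (hs : tsupport b ⊆ K) : ContDiff ℝ (⊤ : ℕ∞) b := by
  rw [contDiff_iff_contDiffAt]
  intro ξ
  by_cases h : ξ ∈ tsupport b
  · exact hb.contDiffAt (hK.mem_nhds (hs h))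
  · exact contDiffAt_const.congr_of_eventuallyEq (notMem_tsupport_iff_eventuallyEq.1 h)

lemma tsupport_fieldDeriv_subset (b : Rd d → ℂ) :
    tsupport (fieldDeriv v κ b) ⊆ tsupport b := by
  refine (closure_mono ?_).trans (tsupport_fderiv_subset (𝕜 := ℝ))
  intro ξ hξ h
  exact hξ (by simp [fieldDeriv, h])

/-- Divergence theorem for the field `ξ ↦ v + κ ξ`. -/
lemma integral_fieldDeriv {F : Rd d → ℂ} (hF : ContDiff ℝ 1 F) (hs : HasCompactSupport F) :
    ∫ ξ, fieldDeriv v κ F ξ = -(κ * d) * ∫ ξ, F ξ := by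
  have hF' : Continuous (fderiv ℝ F) := hF.continuous_fderiv (by simp)
  have hsF' : HasCompactSupport (fderiv ℝ F) := hs.fderiv ℝ
  let L : Fin d → Rd d →L[ℝ] ℂ := fun i =>
    Complex.ofRealCLM.comp (EuclideanSpace.proj i : Rd d →L[ℝ] ℝ)
  have hd : ∀ i (ξ : Rd d), HasFDerivAt (fun ξ : Rd d => L i (v + κ • ξ))
      ((L i).comp (κ • ContinuousLinearMap.id ℝ (Rd d))) ξ := fun i ξ =>
    (L i).hasFDerivAt.comp ξ (((hasFDerivAt_id ξ).const_smul κ).const_add v)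
  have hc : ∀ i, Continuous (fun ξ : Rd d => L i (v + κ • ξ)) := fun i => by fun_prop
  have hi1 : ∀ i (w : Rd d), Integrable fun ξ => L i (v + κ • ξ) * fderiv ℝ F ξ w := by
    intro i w
    refine ((hc i).mul (by fun_prop)).integrable_of_hasCompactSupport ?_
    refine HasCompactSupport.mul_left (hsF'.comp_left (g := fun T : Rd d →L[ℝ] ℂ => T w) rfl)
  have hterm : ∀ i, ∫ ξ, L i (v + κ • ξ) * fderiv ℝ F ξ (EuclideanSpace.basisFun (Fin d) ℝ i) =
      -(κ * ∫ ξ, F ξ) := by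
    intro i
    have hi2 : ∀ ξ, fderiv ℝ (fun ξ : Rd d => L i (v + κ • ξ)) ξ
        (EuclideanSpace.basisFun (Fin d) ℝ i) = κ := fun ξ => by
      rw [(hd i ξ).fderiv]
      simp [L]
    rw [integral_mul_fderiv_eq_neg_fderiv_mul_of_integrable ?_ (hi1 i _) ?_
      (fun ξ _ => (hd i ξ).differentiableAt) (fun ξ _ => (hF.differentiable (by simp)) ξ)]
    · simp_rw [hi2, integral_const_mul]
    · simp_rw [hi2]
      exact (hF.continuous.integrable_of_hasCompactSupport hs).const_mul _
    · exact ((hc i).mul hF.continuous).integrable_of_hasCompactSupport hs.mul_left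
  have e : ∀ ξ, fieldDeriv v κ F ξ = ∑ i, L i (v + κ • ξ) *
      fderiv ℝ F ξ (EuclideanSpace.basisFun (Fin d) ℝ i) := fun ξ => by
    rw [fieldDeriv_eq_sum]; rfl
  simp_rw [e]
  rw [integral_finsetSum _ (fun i _ => hi1 i _)]
  simp_rw [hterm]
  simp
  ring

lemma exists_isSym_inv (k : ℕ) (CM : ℝ) (hCM : 0 ≤ CM) : ∃ C, 0 ≤ C ∧
    ∀ (d : ℕ) (K : Set (Rd d)) (v : Rd d) (κ : ℝ) (M : Rd d → ℝ), IsOpen K → (∀ ξ ∈ K, 0 ≤ M ξ) →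
      IsSym K v κ k CM M (fun ξ => (M ξ : ℂ)) →
      IsSym K v κ k C (fun ξ => (1 + M ξ)⁻¹) (fun ξ => ((1 + M ξ)⁻¹ : ℂ)) := by
  have hne : ∀ x : ℝ, 0 ≤ x → (1 + x : ℂ) ≠ 0 := by
    intro x hx
    have : (1 + x) ≠ 0 := by positivity
    exact_mod_cast this
  have hsm : ∀ {d k} {K : Set (Rd d)} {v : Rd d} {κ : ℝ} {M : Rd d → ℝ}, (∀ ξ ∈ K, 0 ≤ M ξ) →
      IsSym K v κ k CM M (fun ξ => (M ξ : ℂ)) →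
      ContDiffOn ℝ (⊤ : ℕ∞) (fun ξ => ((1 + M ξ)⁻¹ : ℂ)) K := by
    intro d k K v κ M h0 hM
    exact (contDiffOn_const.add hM.1).inv fun ξ hξ => hne _ (h0 ξ hξ)
  have hb : ∀ x : ℝ, 0 ≤ x → ‖((1 + x)⁻¹ : ℂ)‖ = (1 + x)⁻¹ := by
    intro x hx
    have : ((1 + x)⁻¹ : ℂ) = (((1 + x)⁻¹ : ℝ) : ℂ) := by push_cast; rfl
    rw [this, Complex.norm_real, Real.norm_of_nonneg (by positivity)]
  induction k with
  | zero =>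
    refine ⟨1, zero_le_one, fun d K v κ M hK h0 hM => IsSym.zero_iff.2 ⟨hsm h0 hM, fun ξ hξ => ?_⟩⟩
    rw [hb _ (h0 ξ hξ), one_mul]
  | succ n ih =>
    obtain ⟨C, hC0, hC⟩ := ih
    refine ⟨1 + 2 ^ n * (CM * (2 ^ n * (C * C))) * (2 ^ n * 1), by positivity, fun d K v κ M hK h0 hM => ?_⟩
    refine (IsSym.succ_iff hK).2 ⟨hsm h0 hM, fun ξ hξ => ?_, ?_⟩
    · rw [hb _ (h0 ξ hξ)]
      have := h0 ξ hξ
      refine le_mul_of_one_le_left (by positivity) ?_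
      have : 0 ≤ 2 ^ n * (CM * (2 ^ n * (C * C))) * (2 ^ n * 1) := by positivity
      linarith
    · have hu := hC d K v κ M hK h0 (hM.mono_order n.le_succ)
      have h1 := (((IsSym.succ_iff hK).1 hM).2.2.mul hK (hu.mul hK hu)).const_mul hK (-1)
      refine (h1.congr hK fun ξ hξ => ?_).mono fun ξ hξ => ?_
      · have hd := hM.differentiableAt hK hξ
        have h3 := ((hasFDerivAt_inv' (𝕜 := ℝ) (hne _ (h0 ξ hξ))).comp ξ
          (hd.hasFDerivAt.const_add 1)).fderiv
        unfold fieldDeriv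
        change fderiv ℝ ((fun x : ℂ => x⁻¹) ∘ fun ξ => 1 + (M ξ : ℂ)) ξ _ = _
        erw [h3]
        simp
        ring
      · have := h0 ξ hξ
        have h2 : M ξ * ((1 + M ξ)⁻¹ * (1 + M ξ)⁻¹) ≤ (1 + M ξ)⁻¹ := by
          have : M ξ * (1 + M ξ)⁻¹ ≤ 1 := by
            rw [← div_eq_mul_inv, div_le_one (by positivity)]; linarith
          calc M ξ * ((1 + M ξ)⁻¹ * (1 + M ξ)⁻¹) = (M ξ * (1 + M ξ)⁻¹) * (1 + M ξ)⁻¹ := by ring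
            _ ≤ 1 * (1 + M ξ)⁻¹ := by gcongr
            _ = _ := one_mul _
        rw [norm_neg, norm_one]
        calc 2 ^ n * (1 * (2 ^ n * (CM * (2 ^ n * (C * C))))) * (M ξ * ((1 + M ξ)⁻¹ * (1 + M ξ)⁻¹))
            ≤ 2 ^ n * (1 * (2 ^ n * (CM * (2 ^ n * (C * C))))) * (1 + M ξ)⁻¹ := by gcongr
          _ ≤ _ := by
            have : 0 ≤ (1 + M ξ)⁻¹ := by positivity
            nlinarith

/-- Iterated integration by parts along the field `ξ ↦ v + κ ξ`. -/
lemma exists_ibp (d : ℕ) (CM : ℝ) (hCM : 0 ≤ CM) (n : ℕ) (Ch : ℝ) (hCh : 0 ≤ Ch) : ∃ C, 0 ≤ C ∧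
    ∀ (K K₀ : Set (Rd d)) (v : Rd d) (κ σ : ℝ) (Φ M W : Rd d → ℝ) (h : Rd d → ℂ),
      IsOpen K → IsCompact K₀ → K₀ ⊆ K → |κ| ≤ 1 → σ ^ 2 = 1 →
      ContDiffOn ℝ (⊤ : ℕ∞) Φ K → (∀ ξ ∈ K, fderiv ℝ Φ ξ (v + κ • ξ) = σ * M ξ) →
      (∀ ξ ∈ K, 0 ≤ M ξ) → (∀ ξ ∈ K, 0 ≤ W ξ) → IsSym K v κ n CM M (fun ξ => (M ξ : ℂ)) →
      IsSym K v κ n Ch W h → tsupport h ⊆ K₀ →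
      ∃ g : Rd d → ℂ, tsupport g ⊆ K₀ ∧ (∀ ξ ∈ K, ‖g ξ‖ ≤ C * W ξ * (1 + M ξ)⁻¹ ^ n) ∧
        ∫ ξ, Complex.exp (Complex.I * Φ ξ) * h ξ = ∫ ξ, Complex.exp (Complex.I * Φ ξ) * g ξ := by
  induction n generalizing Ch with
  | zero =>
    refine ⟨Ch, hCh, fun K K₀ v κ σ Φ M W h _ _ _ _ _ _ _ _ _ _ hh hs => ⟨h, hs, ?_, rfl⟩⟩
    intro ξ hξ
    simpa using hh.bound hξ
  | succ n ih =>
    obtain ⟨Cu, hCu0, hCu⟩ := exists_isSym_inv (n + 1) CM hCM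
    set C1 := 2 ^ (n + 1) * (Cu * Ch) with hC1
    have hC10 : 0 ≤ C1 := by positivity
    obtain ⟨C, hC0, hC⟩ := ih (2 ^ n * ((1 + d) * C1) + 2 ^ n * (1 * C1)) (by positivity)
    refine ⟨C, hC0, fun K K₀ v κ σ Φ M W h hK hK₀ hsub hκ hσ hΦ hΦM hM0 hW hM hh hs => ?_⟩
    have hσ1 : |σ| = 1 := by
      have : |σ| ^ 2 = 1 := by rwa [sq_abs]
      nlinarith [abs_nonneg σ]
    set u : Rd d → ℂ := fun ξ => ((1 + M ξ)⁻¹ : ℂ) with hu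
    have huh := (hCu d K v κ M hK hM0 hM).mul hK hh
    rw [← hC1] at huh
    have hsuh : tsupport (fun ξ => u ξ * h ξ) ⊆ K₀ := (tsupport_mul_subset_right (f := u)).trans hs
    let g₁ : Rd d → ℂ := fun ξ => (1 + Complex.I * σ * κ * d) * (u ξ * h ξ) +
      Complex.I * σ * fieldDeriv v κ (fun ξ => u ξ * h ξ) ξ
    have hg₁ : IsSym K v κ n (2 ^ n * ((1 + d) * C1) + 2 ^ n * (1 * C1))
        (fun ξ => (1 + M ξ)⁻¹ * W ξ) g₁ := by
      have hW' : ∀ ξ ∈ K, 0 ≤ (1 + M ξ)⁻¹ * W ξ := fun ξ hξ => by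
        have := hM0 ξ hξ
        have := hW ξ hξ
        positivity
      have ha := (huh.mono_order n.le_succ).const_mul hK (1 + Complex.I * σ * κ * d)
      have hb := ((IsSym.succ_iff hK).1 huh).2.2.const_mul hK (Complex.I * σ)
      refine (ha.add hK hb).mono_const ?_ hW'
      have e1 : ‖(1 + Complex.I * σ * κ * d : ℂ)‖ ≤ 1 + d := by
        refine norm_add_le_of_le (by simp) ?_
        simp only [norm_mul, Complex.norm_I, Complex.norm_real, Real.norm_eq_abs, hσ1]
        simp
        exact mul_le_of_le_one_left (by positivity) hκ
      have e2 : ‖(Complex.I * σ : ℂ)‖ ≤ 1 := by simp [hσ1]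
      gcongr
    have hsg₁ : tsupport g₁ ⊆ K₀ := by
      refine closure_minimal ?_ hK₀.isClosed
      intro ξ hξ
      by_contra hn
      apply hξ
      have h1 : u ξ * h ξ = 0 := image_eq_zero_of_notMem_tsupport (f := fun ξ => u ξ * h ξ)
        (fun h => hn (hsuh h))
      have h2 : fieldDeriv v κ (fun ξ => u ξ * h ξ) ξ = 0 := image_eq_zero_of_notMem_tsupport
        (fun h => hn (hsuh (tsupport_fieldDeriv_subset _ h)))
      simp [g₁, h1, h2]
    obtain ⟨g, hgs, hgb, hgi⟩ := hC K K₀ v κ σ Φ M _ g₁ hK hK₀ hsub hκ hσ hΦ hΦM hM0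
      (fun ξ hξ => by have := hM0 ξ hξ; have := hW ξ hξ; positivity)
      (hM.mono_order n.le_succ) hg₁ hsg₁
    refine ⟨g, hgs, fun ξ hξ => (hgb ξ hξ).trans (le_of_eq (by ring)), ?_⟩
    rw [← hgi]
    set E : Rd d → ℂ := fun ξ => Complex.exp (Complex.I * Φ ξ) with hE
    have hEs : ContDiffOn ℝ (⊤ : ℕ∞) E K := by
      have : ContDiffOn ℝ (⊤ : ℕ∞) (fun ξ => (Φ ξ : ℂ)) K :=
        Complex.ofRealCLM.contDiff.comp_contDiffOn hΦ
      exact (contDiffOn_const.mul this).cexp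
    have hsE : ∀ b : Rd d → ℂ, tsupport b ⊆ K₀ → tsupport (fun ξ => E ξ * b ξ) ⊆ K₀ :=
      fun b hb => (tsupport_mul_subset_right (f := E)).trans hb
    have hsmooth : ∀ b : Rd d → ℂ, ContDiffOn ℝ (⊤ : ℕ∞) b K → tsupport b ⊆ K₀ →
        ContDiff ℝ (⊤ : ℕ∞) (fun ξ => E ξ * b ξ) := fun b hb hbs =>
      contDiff_of_tsupport_subset hK (hEs.mul hb) ((hsE b hbs).trans hsub)
    have hcs : ∀ b : Rd d → ℂ, tsupport b ⊆ K₀ → HasCompactSupport (fun ξ => E ξ * b ξ) :=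
      fun b hbs => hK₀.of_isClosed_subset (isClosed_tsupport _) (hsE b hbs)
    have hintegral : ∀ b : Rd d → ℂ, ContDiffOn ℝ (⊤ : ℕ∞) b K → tsupport b ⊆ K₀ →
        Integrable (fun ξ => E ξ * b ξ) := fun b hb hbs =>
      (hsmooth b hb hbs).continuous.integrable_of_hasCompactSupport (hcs b hbs)
    set F : Rd d → ℂ := fun ξ => E ξ * (u ξ * h ξ) with hF
    have hFsm : ContDiff ℝ (⊤ : ℕ∞) F := hsmooth _ huh.1 hsuh
    have hFcs : HasCompactSupport F := hcs _ hsuh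
    have hpt : ∀ ξ, E ξ * h ξ - E ξ * g₁ ξ = -(Complex.I * σ) * (fieldDeriv v κ F ξ + κ * d * F ξ) := by
      intro ξ
      by_cases hξ : ξ ∈ K
      · have hM1 : (1 + M ξ : ℂ) ≠ 0 := by
          have := hM0 ξ hξ
          have : (1 + M ξ) ≠ 0 := by positivity
          exact_mod_cast this
        have hdE : fieldDeriv v κ E ξ = Complex.I * (σ * M ξ) * E ξ := by
          have h1 : HasFDerivAt Φ (fderiv ℝ Φ ξ) ξ :=
            ((hΦ.contDiffAt (hK.mem_nhds hξ)).differentiableAt (by simp)).hasFDerivAt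
          have h2 : HasFDerivAt (fun ξ => (Φ ξ : ℂ)) (Complex.ofRealCLM.comp (fderiv ℝ Φ ξ)) ξ :=
            Complex.ofRealCLM.hasFDerivAt.comp ξ h1
          have h3 := (h2.const_mul Complex.I).cexp
          unfold fieldDeriv
          rw [h3.fderiv]
          simp [hΦM ξ hξ, hE]
          ring
        have hdF : fieldDeriv v κ F ξ = E ξ * fieldDeriv v κ (fun ξ => u ξ * h ξ) ξ +
            fieldDeriv v κ E ξ * (u ξ * h ξ) := by
          unfold fieldDeriv
          rw [hF, fderiv_fun_mul ((hEs.contDiffAt (hK.mem_nhds hξ)).differentiableAt (by simp))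
            (huh.differentiableAt hK hξ)]
          simp
          ring
        have hσ2 : (σ : ℂ) ^ 2 = 1 := by exact_mod_cast hσ
        have hhu : h ξ = (1 + M ξ) * (u ξ * h ξ) := by
          simp only [hu]; field_simp
        rw [hdF, hdE]
        simp only [g₁, hF]
        set q := u ξ * h ξ
        rw [hhu]
        linear_combination (M ξ * E ξ * q) * (-hσ2 + σ ^ 2 * Complex.I_sq)
      · have hn : ξ ∉ K₀ := fun h => hξ (hsub h)
        have h1 : h ξ = 0 := image_eq_zero_of_notMem_tsupport (fun h => hn (hs h))
        have h2 : g₁ ξ = 0 := image_eq_zero_of_notMem_tsupport (fun h => hn (hsg₁ h))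
        have h3 : fieldDeriv v κ F ξ = 0 := image_eq_zero_of_notMem_tsupport
          (fun h => hn (hsE _ hsuh (tsupport_fieldDeriv_subset _ h)))
        rw [h1, h2, h3]; simp [hF, h1]
    have hdiff : ∫ ξ, (E ξ * h ξ - E ξ * g₁ ξ) = 0 := by
      simp_rw [hpt]
      rw [integral_const_mul, integral_add, integral_fieldDeriv (hFsm.of_le (by simp)) hFcs,
        integral_const_mul]
      · ring
      · have : ContDiff ℝ (⊤ : ℕ∞) (fieldDeriv v κ F) :=
          contDiffOn_univ.1 (contDiffOn_fieldDeriv isOpen_univ hFsm.contDiffOn)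
        refine this.continuous.integrable_of_hasCompactSupport ?_
        exact hFcs.of_isClosed_subset (isClosed_tsupport _) (tsupport_fieldDeriv_subset _)
      · exact (hFsm.continuous.integrable_of_hasCompactSupport hFcs).const_mul _
    rw [integral_sub (hintegral h hh.1 hs) (hintegral g₁ hg₁.1 hsg₁)] at hdiff
    exact sub_eq_zero.1 hdiff

end

section

open Filter Topology

namespace IsDistFn

variable {d : ℕ} {a : Rd d → ℝ}

lemma map_inv_smul_self (ha : IsDistFn a) {ξ : Rd d} (hξ : 0 < a ξ) : a ((a ξ)⁻¹ • ξ) = 1 := by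
  rw [ha.homog _ (inv_pos.2 hξ), inv_mul_cancel₀ hξ.ne']

lemma contDiffOn_ofReal (ha : IsDistFn a) :
    ContDiffOn ℝ (⊤ : ℕ∞) (fun ξ => (a ξ : ℂ)) {ξ : Rd d | ξ ≠ 0} :=
  Complex.ofRealCLM.contDiff.comp_contDiffOn ha.smooth

lemma contDiffOn_fderiv (ha : IsDistFn a) :
    ContDiffOn ℝ (⊤ : ℕ∞) (fderiv ℝ a) {ξ : Rd d | ξ ≠ 0} :=
  fun _ hξ => (ha.contDiffAt_fderiv hξ).contDiffWithinAt

lemma contDiffOn_hess (ha : IsDistFn a) :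
    ContDiffOn ℝ (⊤ : ℕ∞) (fderiv ℝ (fderiv ℝ a)) {ξ : Rd d | ξ ≠ 0} :=
  fun ξ hξ => ((ha.contDiffAt_fderiv hξ).fderiv_right (by simp)).contDiffWithinAt

lemma hess_apply_sub (ha : IsDistFn a) {ξ : Rd d} (hξ : ξ ≠ 0) (v : Rd d) :
    fderiv ℝ (fderiv ℝ a) ξ v v = ∑ i, ∑ j, fderiv ℝ (fderiv ℝ a) ξ
      (EuclideanSpace.basisFun (Fin d) ℝ i) (EuclideanSpace.basisFun (Fin d) ℝ j) *
        ((v i - ξ i / a ξ) * (v j - ξ j / a ξ)) := by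
  set u : Rd d := v - (a ξ)⁻¹ • ξ with hu
  have h1 : fderiv ℝ (fderiv ℝ a) ξ v v = fderiv ℝ (fderiv ℝ a) ξ u u := by
    simp only [hu, map_sub, map_smul, sub_apply, smul_apply, ha.hess_self hξ, ha.hess_symm hξ v ξ]
    simp
  have h2 : ∀ i, v i - ξ i / a ξ = u i := fun i => by simp [hu]; ring
  simp_rw [h2]
  rw [h1]
  conv_lhs => rw [← (EuclideanSpace.basisFun (Fin d) ℝ).sum_repr u]
  simp [map_sum, Finset.mul_sum]
  refine Finset.sum_congr rfl fun i _ => Finset.sum_congr rfl fun j _ => ?_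
  rw [ha.hess_symm hξ]
  ring

lemma exists_convex' (ha : IsDistFn a) (hc : CurvNondeg a) (hd : 2 ≤ d) :
    ∃ c > 0, ∀ ξ v : Rd d, 0 < a ξ → a v = 1 →
      c * ‖(a ξ)⁻¹ • ξ - v‖ ^ 2 ≤ 1 - fderiv ℝ a ξ v := by
  obtain ⟨c, hc0, h⟩ := ha.exists_convex hc hd
  refine ⟨c, hc0, fun ξ v hξ hv => ?_⟩
  have := h _ v (ha.map_inv_smul_self hξ) hv
  rw [ha.fderiv_smul (inv_pos.2 hξ) (ha.ne_zero_of_pos hξ)] at this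
  linarith

lemma isOpen_Ioo (ha : IsDistFn a) (s t : ℝ) : IsOpen (a ⁻¹' Ioo s t) :=
  _root_.isOpen_Ioo.preimage ha.continuous

/-- On the shell `1/16 < a < 16`, the function `ξ ↦ 1 - a'(ξ) v` is a symbol of its own size with
respect to the constant field `v`, uniformly in `v` with `a v = 1`. -/
lemma exists_isSym_defect (ha : IsDistFn a) (hc : CurvNondeg a) (hd : 2 ≤ d) (k : ℕ) :
    ∃ C, 0 ≤ C ∧ ∀ v : Rd d, a v = 1 →
      IsSym (a ⁻¹' Ioo (1 / 16) 16) v 0 k C (fun ξ => 1 - fderiv ℝ a ξ v)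
        (fun ξ => ((1 - fderiv ℝ a ξ v : ℝ) : ℂ)) ∧
      ∀ i, IsSym (a ⁻¹' Ioo (1 / 16) 16) v 0 k C (fun ξ => √(1 - fderiv ℝ a ξ v))
        (fun ξ => ((v i - ξ i / a ξ : ℝ) : ℂ)) := by
  set K := a ⁻¹' Ioo (1 / 16) 16 with hKdef
  have hK : IsOpen K := ha.isOpen_Ioo _ _
  have hKc := ha.isCompact_Icc (by omega) (1 / 16) 16
  have hsub : K ⊆ a ⁻¹' Icc (1 / 16) 16 := fun ξ hξ => ⟨hξ.1.le, hξ.2.le⟩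
  have hU : IsOpen {ξ : Rd d | ξ ≠ 0} := isOpen_ne
  have hKU : a ⁻¹' Icc (1 / 16) 16 ⊆ {ξ : Rd d | ξ ≠ 0} := fun ξ hξ =>
    ha.ne_zero_of_pos (lt_of_lt_of_le (by norm_num) hξ.1)
  have hpos : ∀ ξ ∈ K, 0 < a ξ := fun ξ hξ => lt_trans (by norm_num) hξ.1
  have hne : ∀ ξ ∈ K, ξ ≠ 0 := fun ξ hξ => ha.ne_zero_of_pos (hpos ξ hξ)
  obtain ⟨c, hc0, hconv⟩ := ha.exists_convex' hc hd
  obtain ⟨R₀, hR₀⟩ := (ha.isCompact_Icc (by omega) 1 1).isBounded.exists_norm_le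
  set R := max R₀ 0
  have hR : ∀ v, a v = 1 → ‖v‖ ≤ R := fun v hv => (hR₀ v (by simp [hv])).trans (le_max_left _ _)
  have hR0 : 0 ≤ R := le_max_right _ _
  have hm0 : ∀ ξ ∈ K, ∀ v, a v = 1 → 0 ≤ 1 - fderiv ℝ a ξ v := fun ξ hξ v hv =>
    le_trans (by positivity) (hconv ξ v (hpos ξ hξ) hv)
  obtain ⟨B, hB⟩ := hKc.exists_bound_of_continuousOn (ha.contDiffOn_fderiv.continuousOn.mono hKU)
  have hmB : ∀ ξ ∈ K, ∀ v, a v = 1 → √(1 - fderiv ℝ a ξ v) ≤ √(1 + |B| * R) := by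
    intro ξ hξ v hv
    apply Real.sqrt_le_sqrt
    have h1 := (fderiv ℝ a ξ).le_opNorm v
    have h2 : ‖fderiv ℝ a ξ‖ * ‖v‖ ≤ |B| * R :=
      mul_le_mul ((hB ξ (hsub hξ)).trans (le_abs_self B)) (hR v hv) (norm_nonneg _) (abs_nonneg _)
    have := neg_abs_le (fderiv ℝ a ξ v)
    rw [Real.norm_eq_abs] at h1
    linarith
  have hderivE : ∀ v, ContDiffOn ℝ (⊤ : ℕ∞) (fun ξ => ((1 - fderiv ℝ a ξ v : ℝ) : ℂ)) K := fun v =>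
    Complex.ofRealCLM.contDiff.comp_contDiffOn (contDiffOn_const.sub
      ((ha.contDiffOn_fderiv.clm_apply contDiffOn_const).mono (hsub.trans hKU)))
  have hproj : ∀ i, ContDiff ℝ (⊤ : ℕ∞) (fun ξ : Rd d => ξ i) := fun i =>
    (EuclideanSpace.proj i : Rd d →L[ℝ] ℝ).contDiff
  have huE : ∀ (v : Rd d) i, ContDiffOn ℝ (⊤ : ℕ∞) (fun ξ : Rd d => ((v i - ξ i / a ξ : ℝ) : ℂ)) K :=
    fun v i => Complex.ofRealCLM.contDiff.comp_contDiffOn (contDiffOn_const.sub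
      ((hproj i).contDiffOn.div (ha.smooth.mono (hsub.trans hKU)) fun ξ hξ => (hpos ξ hξ).ne'))
  have hmb : ∀ v, a v = 1 → ∀ ξ ∈ K, ‖((1 - fderiv ℝ a ξ v : ℝ) : ℂ)‖ ≤ 1 * (1 - fderiv ℝ a ξ v) := by
    intro v hv ξ hξ
    rw [Complex.norm_real, Real.norm_of_nonneg (hm0 ξ hξ v hv), one_mul]
  have hub : ∀ v, a v = 1 → ∀ i, ∀ ξ ∈ K, ‖((v i - ξ i / a ξ : ℝ) : ℂ)‖ ≤
      (√c)⁻¹ * √(1 - fderiv ℝ a ξ v) := by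
    intro v hv i ξ hξ
    rw [Complex.norm_real]
    have h1 : ‖((a ξ)⁻¹ • ξ - v) i‖ ≤ ‖(a ξ)⁻¹ • ξ - v‖ := PiLp.norm_apply_le _ i
    have h2 : ‖v i - ξ i / a ξ‖ = ‖((a ξ)⁻¹ • ξ - v) i‖ := by
      rw [← norm_neg]; congr 1; simp; ring
    rw [h2, le_inv_mul_iff₀ (by positivity)]
    apply Real.le_sqrt_of_sq_le
    rw [mul_pow, Real.sq_sqrt hc0.le]
    refine le_trans ?_ (hconv ξ v (hpos ξ hξ) hv)
    gcongr
  induction k with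
  | zero =>
    refine ⟨1 + (√c)⁻¹, by positivity, fun v hv => ⟨?_, fun i => ?_⟩⟩
    · refine (IsSym.zero_iff.2 ⟨hderivE v, hmb v hv⟩).mono_const ?_ fun ξ hξ => hm0 ξ hξ v hv
      simp
    · refine (IsSym.zero_iff.2 ⟨huE v i, hub v hv i⟩).mono_const ?_ fun ξ hξ => by positivity
      simp
  | succ k ih =>
    obtain ⟨C, hC0, hC⟩ := ih
    have hinv : ContDiffOn ℝ (⊤ : ℕ∞) (fun ξ : Rd d => -(a ξ : ℂ)⁻¹) {ξ : Rd d | ξ ≠ 0} :=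
      (ha.contDiffOn_ofReal.inv fun ξ hξ => by exact_mod_cast (ha.pos ξ hξ).ne').neg
    obtain ⟨A, hA0, hA⟩ := exists_isSym_of_contDiffOn hK hU hKc hsub hKU R hR0 k _ hinv
    have hcoef : ∀ i, ContDiffOn ℝ (⊤ : ℕ∞) (fun ξ : Rd d => -((ξ i : ℝ) : ℂ) * (-(a ξ : ℂ)⁻¹) ^ 2)
        {ξ : Rd d | ξ ≠ 0} := fun i =>
      ((Complex.ofRealCLM.contDiff.comp_contDiffOn (hproj i).contDiffOn).neg).mul (hinv.pow 2)
    choose A' hA'0 hA' using fun i => exists_isSym_of_contDiffOn hK hU hKc hsub hKU R hR0 k _ (hcoef i)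
    have hhess : ∀ i j, ContDiffOn ℝ (⊤ : ℕ∞) (fun ξ : Rd d => ((-fderiv ℝ (fderiv ℝ a) ξ
      (EuclideanSpace.basisFun (Fin d) ℝ i) (EuclideanSpace.basisFun (Fin d) ℝ j) : ℝ) : ℂ))
        {ξ : Rd d | ξ ≠ 0} := fun i j =>
      Complex.ofRealCLM.contDiff.comp_contDiffOn (((ha.contDiffOn_hess.clm_apply
        contDiffOn_const).clm_apply contDiffOn_const).neg)
    choose H hH0 hH using fun i j =>
      exists_isSym_of_contDiffOn hK hU hKc hsub hKU R hR0 k _ (hhess i j)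
    set Q := √(1 + |B| * R)
    set C1 : ℝ := ∑ i, ∑ j, 2 ^ k * (H i j * (2 ^ k * (C * C))) with hC1
    have hC10 : 0 ≤ C1 := Finset.sum_nonneg fun i _ => Finset.sum_nonneg fun j _ => by
      have := hH0 i j; positivity
    set C2 : ℝ := 2 ^ k * (A * C) + ∑ i, 2 ^ k * (A' i * C) * Q with hC2
    have hA'n : ∀ i, 0 ≤ 2 ^ k * (A' i * C) * Q := fun i => by have := hA'0 i; positivity
    have hC20 : 0 ≤ C2 := add_nonneg (by positivity) (Finset.sum_nonneg fun i _ => hA'n i)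
    refine ⟨1 + (√c)⁻¹ + C1 + C2, by positivity, fun v hv => ?_⟩
    obtain ⟨hm, hu⟩ := hC v hv
    refine ⟨(IsSym.succ_iff hK).2 ⟨hderivE v, fun ξ hξ => ?_, ?_⟩,
      fun i => (IsSym.succ_iff hK).2 ⟨huE v i, fun ξ hξ => ?_, ?_⟩⟩
    · refine (hmb v hv ξ hξ).trans (mul_le_mul_of_nonneg_right ?_ (hm0 ξ hξ v hv))
      have : 0 ≤ (√c)⁻¹ := by positivity
      linarith
    · have h1 := IsSym.sum hK Finset.univ (fun i _ => IsSym.sum hK Finset.univ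
        (fun j _ => (hH i j v 0 (hR v hv) (by simp)).mul hK ((hu i).mul hK (hu j))))
      rw [← hC1] at h1
      refine (h1.congr hK fun ξ hξ => ?_).mono fun ξ hξ => ?_
      · have h2 : HasFDerivAt (fun ξ => ((1 - fderiv ℝ a ξ v : ℝ) : ℂ)) _ ξ :=
          Complex.ofRealCLM.hasFDerivAt.comp ξ
            (((ha.differentiableAt_fderiv (hne ξ hξ)).hasFDerivAt.clm_apply
              (hasFDerivAt_const v ξ)).const_sub 1)
        unfold fieldDeriv
        rw [h2.fderiv]
        have h3 := ha.hess_apply_sub (hne ξ hξ) v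
        simp only [zero_smul, add_zero, ContinuousLinearMap.comp_apply, neg_apply,
          Complex.ofRealCLM_apply, add_apply, ContinuousLinearMap.flip_apply, zero_apply,
          _root_.map_zero, zero_add]
        rw [h3]
        push_cast
        rw [← Finset.sum_neg_distrib]
        refine Finset.sum_congr rfl fun i _ => ?_
        rw [← Finset.sum_neg_distrib]
        refine Finset.sum_congr rfl fun j _ => ?_
        ring
      · simp only [one_mul, Real.mul_self_sqrt (hm0 ξ hξ v hv)]
        refine mul_le_mul_of_nonneg_right ?_ (hm0 ξ hξ v hv)
        have : 0 ≤ (√c)⁻¹ := by positivity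
        linarith
    · refine (hub v hv i ξ hξ).trans (mul_le_mul_of_nonneg_right ?_ (Real.sqrt_nonneg _))
      linarith
    · have h1 := (hA v 0 (hR v hv) (by simp)).mul hK (hu i)
      have h2 := (hA' i v 0 (hR v hv) (by simp)).mul hK hm
      have h2' : IsSym K v 0 k (2 ^ k * (A' i * C) * Q) (fun ξ => 1 * √(1 - fderiv ℝ a ξ v)) _ :=
        h2.mono fun ξ hξ => by
          have := hA'0 i
          have e := Real.mul_self_sqrt (hm0 ξ hξ v hv)
          have e2 := hmB ξ hξ v hv
          have h0 : 0 ≤ 2 ^ k * (A' i * C) := by positivity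
          have hmQ : 1 - fderiv ℝ a ξ v ≤ Q * √(1 - fderiv ℝ a ξ v) := by
            nlinarith [Real.sqrt_nonneg (1 - fderiv ℝ a ξ v)]
          have := mul_le_mul_of_nonneg_left hmQ h0
          linarith
      refine ((h1.add hK h2').congr hK fun ξ hξ => ?_).mono fun ξ hξ => ?_
      · have ha0 : a ξ ≠ 0 := (hpos ξ hξ).ne'
        have h2 : HasFDerivAt (fun ξ : Rd d => ((v i - (EuclideanSpace.proj i : Rd d →L[ℝ] ℝ) ξ * (a ξ)⁻¹ : ℝ) : ℂ)) _ ξ :=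
          Complex.ofRealCLM.hasFDerivAt.comp ξ
            (((EuclideanSpace.proj i : Rd d →L[ℝ] ℝ).hasFDerivAt.mul
              ((hasDerivAt_inv (𝕜 := ℝ) ha0).comp_hasFDerivAt ξ (ha.differentiableAt (hne ξ hξ)).hasFDerivAt)).const_sub (v i))
        have h3 : fieldDeriv v 0 (fun ξ : Rd d => ((v i - ξ i / a ξ : ℝ) : ℂ)) ξ =
          fieldDeriv v 0 (fun ξ : Rd d => ((v i - (EuclideanSpace.proj i : Rd d →L[ℝ] ℝ) ξ * (a ξ)⁻¹ : ℝ) : ℂ)) ξ := rfl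
        rw [h3]
        unfold fieldDeriv
        rw [h2.fderiv]
        have hac : (a ξ : ℂ) ≠ 0 := by exact_mod_cast ha0
        simp
        field_simp
        ring
      · rw [one_mul]
        refine mul_le_mul_of_nonneg_right ?_ (Real.sqrt_nonneg _)
        have e1 : 2 ^ k * (A' i * C) * Q ≤ ∑ i, 2 ^ k * (A' i * C) * Q :=
          Finset.single_le_sum (f := fun i => 2 ^ k * (A' i * C) * Q) (fun i _ => hA'n i) (Finset.mem_univ i)
        have : 0 ≤ (√c)⁻¹ := by positivity
        linarith

end IsDistFn

end

section

open Filter Topology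

lemma exists_orthonormalBasis_direction {d : ℕ} (hd : 0 < d) {v : Rd d} (hv : v ≠ 0) :
    ∃ (b : OrthonormalBasis (Fin d) ℝ (Rd d)) (i₀ : Fin d), v = ‖v‖ • b i₀ := by
  obtain ⟨b, hb⟩ := Orthonormal.exists_orthonormalBasis_extension_of_card_eq (𝕜 := ℝ) (E := Rd d)
    (ι := Fin d) (by simp) (v := fun _ => ‖v‖⁻¹ • v) (s := {⟨0, hd⟩}) (by
      rw [orthonormal_iff_ite]
      rintro ⟨i, rfl⟩ ⟨j, rfl⟩
      simp [norm_smul, hv])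
  refine ⟨b, ⟨0, hd⟩, ?_⟩
  rw [hb _ rfl, smul_smul, mul_inv_cancel₀ (norm_ne_zero_iff.2 hv), one_smul]

lemma integral_inv_one_add_mul_sq {c : ℝ} (hc : 0 < c) :
    Integrable (fun x : ℝ => (1 + c * x ^ 2)⁻¹) ∧ ∫ x : ℝ, (1 + c * x ^ 2)⁻¹ = π * (√c)⁻¹ := by
  have hs : 0 < √c := Real.sqrt_pos.2 hc
  have h : (fun x : ℝ => (1 + c * x ^ 2)⁻¹) = fun x => (fun y : ℝ => (1 + y ^ 2)⁻¹) (√c * x) := by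
    ext x
    simp only [mul_pow, Real.sq_sqrt hc.le]
  constructor
  · rw [h]
    exact integrable_inv_one_add_sq.comp_mul_left' hs.ne'
  · rw [h, Measure.integral_comp_mul_left (fun y : ℝ => (1 + y ^ 2)⁻¹) (√c),
      integral_univ_inv_one_add_sq, abs_of_pos (inv_pos.2 hs), smul_eq_mul, mul_comm]

namespace IsDistFn

variable {d : ℕ} {a : Rd d → ℝ}

lemma exists_lintegral_cone_le (ha : IsDistFn a) (hd : 0 < d) :
    ∃ C, 0 ≤ C ∧ ∀ v : Rd d, a v = 1 → ∀ T : ℝ, 0 ≤ T →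
      ∫⁻ ξ in a ⁻¹' Icc (1 / 8) 8,
        ENNReal.ofReal ((1 + T * ‖(a ξ)⁻¹ • ξ - v‖ ^ 2)⁻¹ ^ d) ≤
      ENNReal.ofReal (C * (√(1 + T))⁻¹ ^ (d - 1)) := by
  obtain ⟨R, hR⟩ := (ha.isCompact_Icc hd (1 / 8) 8).isBounded.exists_norm_le
  set C₀ : ℝ := 65 + R ^ 2 with hC₀
  have hC₀' : 0 < C₀ := by positivity
  refine ⟨2 * |R| * (C₀ * π) ^ (d - 1), by positivity, fun v hv T hT => ?_⟩
  obtain ⟨b, i₀, hb⟩ := exists_orthonormalBasis_direction hd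
    (ha.ne_zero_of_pos (by rw [hv]; norm_num) : v ≠ 0)
  set F : Fin d → ℝ → ℝ := fun i => if i = i₀ then (Icc (-R) R).indicator 1 else
    fun y => C₀ * (1 + (1 + T) * y ^ 2)⁻¹ with hF
  have hF0 : ∀ i y, 0 ≤ F i y := by
    intro i y
    by_cases hi : i = i₀
    · simp only [hF, hi, if_true]; exact indicator_nonneg (fun _ _ => zero_le_one) _
    · simp only [hF, hi, if_false]; positivity
  have hFi : ∀ i, Integrable (F i) := by
    intro i
    by_cases hi : i = i₀
    · simp only [hF, hi, if_true]
      rw [integrable_indicator_iff measurableSet_Icc]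
      exact (continuous_const (y := (1 : ℝ))).integrableOn_Icc
    · simp only [hF, hi, if_false]
      exact (integral_inv_one_add_mul_sq (by positivity)).1.const_mul _
  have hFI : ∀ i, ∫ y, F i y ≤ if i = i₀ then 2 * |R| else C₀ * π * (√(1 + T))⁻¹ := by
    intro i
    by_cases hi : i = i₀
    · simp only [hF, hi, if_true]
      rw [integral_indicator_one measurableSet_Icc]
      simp [Measure.real]
      refine max_le ?_ (by positivity)
      linarith [le_abs_self R]
    · simp only [hF, hi, if_false]
      rw [integral_const_mul, (integral_inv_one_add_mul_sq (by positivity)).2, mul_assoc]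
  set G : Rd d → ℝ := fun ξ => ∏ i, F i (⟪b i, ξ⟫) with hG
  have hmp := (PiLp.volume_preserving_ofLp (Fin d)).comp b.measurePreserving_repr
  have hcomp : G = (fun y : Fin d → ℝ => ∏ i, F i (y i)) ∘ (WithLp.ofLp ∘ b.repr) := by
    ext ξ
    simp [hG, b.repr_apply_apply]
  have hemb : MeasurableEmbedding (WithLp.ofLp ∘ b.repr : Rd d → Fin d → ℝ) :=
    (MeasurableEquiv.toLp 2 (Fin d → ℝ)).symm.measurableEmbedding.comp
      b.repr.toHomeomorph.measurableEmbedding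
  have hintegral : Integrable G := by
    rw [hcomp]
    exact (hmp.integrable_comp_emb hemb).2 (Integrable.fintype_prod hFi)
  have hGI : ∫ ξ, G ξ = ∏ i, ∫ y, F i y := by
    rw [← integral_fintype_prod_volume_eq_prod, ← hmp.integral_comp hemb, hcomp]
    rfl
  have hle : ∀ ξ ∈ a ⁻¹' Icc (1 / 8) 8, (1 + T * ‖(a ξ)⁻¹ • ξ - v‖ ^ 2)⁻¹ ^ d ≤ G ξ := by
    intro ξ hξ
    have hξ0 : 0 < a ξ := lt_of_lt_of_le (by norm_num) hξ.1
    have hξ8 : a ξ ≤ 8 := hξ.2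
    set θ := ‖(a ξ)⁻¹ • ξ - v‖ with hθ
    have hq : 0 < (1 + T * θ ^ 2)⁻¹ := by positivity
    have hq1 : (1 + T * θ ^ 2)⁻¹ ≤ 1 := inv_le_one_of_one_le₀ (by nlinarith [sq_nonneg θ])
    have hb1 : ∀ i, |⟪b i, ξ⟫| ≤ R := fun i =>
      (abs_real_inner_le_norm _ _).trans (by simpa using hR ξ hξ)
    rw [hG]
    have h1 : (1 + T * θ ^ 2)⁻¹ ^ d = ∏ _i : Fin d, (1 + T * θ ^ 2)⁻¹ := by simp
    rw [h1]
    refine Finset.prod_le_prod (fun i _ => hq.le) fun i _ => ?_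
    by_cases hi : i = i₀
    · simp only [hF, hi, if_true]
      rw [indicator_of_mem (show ⟪b i₀, ξ⟫ ∈ Icc (-R) R from abs_le.1 (hb1 i₀))]
      exact hq1
    · simp only [hF, hi, if_false]
      set y := ⟪b i, ξ⟫
      have hy8 : |y| ≤ 8 * θ := by
        have h2 : y = a ξ * ⟪b i, (a ξ)⁻¹ • ξ - v⟫ := by
          have h3 : ⟪b i, v⟫ = 0 := by
            rw [hb, inner_smul_right, b.inner_eq_zero hi, mul_zero]
          rw [inner_sub_right, h3, inner_smul_right, sub_zero, mul_inv_cancel_left₀ hξ0.ne']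
        rw [h2, abs_mul, abs_of_pos hξ0]
        have h4 := abs_real_inner_le_norm (b i) ((a ξ)⁻¹ • ξ - v)
        rw [b.norm_eq_one, one_mul] at h4
        exact mul_le_mul hξ8 h4 (abs_nonneg _) (by norm_num)
      have hy1 : y ^ 2 ≤ R ^ 2 := sq_le_sq.2 ((hb1 i).trans (le_abs_self R))
      have hy2 : y ^ 2 ≤ 64 * θ ^ 2 := by
        rw [← sq_abs]; nlinarith [abs_nonneg y]
      rw [← div_eq_mul_inv, inv_eq_one_div, div_le_div_iff₀ (by positivity) (by positivity)]
      have h5 : T * y ^ 2 ≤ T * (64 * θ ^ 2) := mul_le_mul_of_nonneg_left hy2 hT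
      have h6 : 0 ≤ T * θ ^ 2 := by positivity
      have h7 : 0 ≤ R ^ 2 * (T * θ ^ 2) := by positivity
      rw [hC₀]
      nlinarith
  calc _ ≤ ∫⁻ ξ in a ⁻¹' Icc (1 / 8) 8, ENNReal.ofReal (G ξ) :=
        setLIntegral_mono' ((ha.continuous.measurable) measurableSet_Icc)
          fun ξ hξ => ENNReal.ofReal_le_ofReal (hle ξ hξ)
    _ ≤ ∫⁻ ξ, ENNReal.ofReal (G ξ) := setLIntegral_le_lintegral _ _
    _ = ENNReal.ofReal (∫ ξ, G ξ) :=
        (ofReal_integral_eq_lintegral_ofReal hintegral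
          (Eventually.of_forall fun ξ => Finset.prod_nonneg fun i _ => hF0 _ _)).symm
    _ ≤ _ := by
        apply ENNReal.ofReal_le_ofReal
        rw [hGI]
        refine (Finset.prod_le_prod (fun i _ => integral_nonneg (hF0 i)) fun i _ => hFI i).trans ?_
        rw [← Finset.mul_prod_erase _ _ (Finset.mem_univ i₀), if_pos rfl, Finset.prod_congr rfl
          (fun i hi => if_neg (Finset.ne_of_mem_erase hi))]
        simp [Finset.card_erase_of_mem, mul_pow, mul_assoc]

end IsDistFn

end

section

open Filter Topology

/-- The support function `ρ(x) = max_{a(ω) = 1} (-2π x·ω)`: the kernel `K_r` with `r ≥ 0`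
concentrates near `ρ(x) = r`. -/
def supportFn {d : ℕ} (a : Rd d → ℝ) (x : Rd d) : ℝ :=
  sSup ((fun ω => -2 * π * ⟪x, ω⟫) '' {ω | a ω = 1})

namespace IsDistFn

variable {d : ℕ} {a : Rd d → ℝ}

lemma isCompact_unit (ha : IsDistFn a) (hd : 0 < d) : IsCompact {ω | a ω = 1} := by
  convert ha.isCompact_Icc hd 1 1
  ext; simp

lemma exists_unit (ha : IsDistFn a) (hd : 0 < d) : ∃ ω, a ω = 1 := by
  obtain ⟨ξ₀, h0, -⟩ := ha.exists_le_norm hd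
  have : 0 < a ξ₀ := ha.pos _ (by rintro rfl; simp at h0)
  exact ⟨_, ha.map_inv_smul_self this⟩

lemma isCompact_supportFn_image (ha : IsDistFn a) (hd : 0 < d) (x : Rd d) :
    IsCompact ((fun ω => -2 * π * ⟪x, ω⟫) '' {ω | a ω = 1}) :=
  (ha.isCompact_unit hd).image (by fun_prop)

lemma le_supportFn (ha : IsDistFn a) (hd : 0 < d) (x : Rd d) {ω : Rd d} (hω : a ω = 1) :
    -2 * π * ⟪x, ω⟫ ≤ supportFn a x :=
  le_csSup (ha.isCompact_supportFn_image hd x).bddAbove ⟨ω, hω, rfl⟩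

lemma exists_supportFn_eq (ha : IsDistFn a) (hd : 0 < d) (x : Rd d) :
    ∃ ω, a ω = 1 ∧ supportFn a x = -2 * π * ⟪x, ω⟫ := by
  obtain ⟨ω₁, hω₁⟩ := ha.exists_unit hd
  obtain ⟨ω, hω, h⟩ := (ha.isCompact_supportFn_image hd x).sSup_mem ⟨_, ω₁, hω₁, rfl⟩
  exact ⟨ω, hω, h.symm⟩

lemma exists_norm_le_of_unit (ha : IsDistFn a) (hd : 0 < d) :
    ∃ B > 0, ∀ ω, a ω = 1 → ‖ω‖ ≤ B := by
  obtain ⟨B, hB⟩ := (ha.isCompact_unit hd).isBounded.exists_norm_le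
  exact ⟨max B 1, by positivity, fun ω hω => (hB ω hω).trans (le_max_left _ _)⟩

lemma exists_supportFn_sub_le (ha : IsDistFn a) (hd : 0 < d) :
    ∃ C > 0, ∀ x y, |supportFn a x - supportFn a y| ≤ C * ‖x - y‖ := by
  obtain ⟨B, hB0, hB⟩ := ha.exists_norm_le_of_unit hd
  have key : ∀ x y, supportFn a x - supportFn a y ≤ 2 * π * B * ‖x - y‖ := by
    intro x y
    obtain ⟨ω, hω, h⟩ := ha.exists_supportFn_eq hd x
    have h1 := ha.le_supportFn hd y hω
    have h2 : -⟪x - y, ω⟫ ≤ ‖x - y‖ * B :=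
      (neg_le_abs _).trans ((abs_real_inner_le_norm _ _).trans (by gcongr; exact hB ω hω))
    rw [inner_sub_left] at h2
    have h3 := mul_le_mul_of_nonneg_left h2 Real.two_pi_pos.le
    linarith
  refine ⟨2 * π * B, by positivity, fun x y => abs_le.2 ⟨?_, key x y⟩⟩
  have := key y x
  rw [norm_sub_rev] at this
  linarith

lemma continuous_supportFn (ha : IsDistFn a) (hd : 0 < d) : Continuous (supportFn a) := by
  obtain ⟨C, hC0, hC⟩ := ha.exists_supportFn_sub_le hd
  exact (LipschitzWith.of_dist_le_mul (K := ⟨C, hC0.le⟩) fun x y => by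
    rw [dist_eq_norm, dist_eq_norm]; exact hC x y).continuous

lemma supportFn_zero (ha : IsDistFn a) (hd : 0 < d) : supportFn a 0 = 0 := by
  obtain ⟨ω, -, h⟩ := ha.exists_supportFn_eq hd 0
  simpa using h

lemma supportFn_smul (ha : IsDistFn a) (hd : 0 < d) {t : ℝ} (ht : 0 ≤ t) (x : Rd d) :
    supportFn a (t • x) = t * supportFn a x := by
  apply le_antisymm
  · obtain ⟨ω, hω, h⟩ := ha.exists_supportFn_eq hd (t • x)
    have h1 := mul_le_mul_of_nonneg_left (ha.le_supportFn hd x hω) ht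
    rw [h, real_inner_smul_left]
    linarith
  · obtain ⟨ω, hω, h⟩ := ha.exists_supportFn_eq hd x
    have h1 := ha.le_supportFn hd (t • x) hω
    rw [real_inner_smul_left] at h1
    rw [h]
    linarith

lemma exists_supportFn_ge (ha : IsDistFn a) (hd : 0 < d) :
    ∃ c > 0, ∀ x, c * ‖x‖ ≤ supportFn a x := by
  obtain ⟨C, hC0, hC⟩ := ha.exists_norm_le
  refine ⟨2 * π / C, by positivity, fun x => ?_⟩
  rcases eq_or_ne x 0 with rfl | hx
  · simp [ha.supportFn_zero hd]
  have hx' : 0 < a (-x) := ha.pos _ (neg_ne_zero.2 hx)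
  have h1 := ha.le_supportFn hd x (ha.map_inv_smul_self hx')
  rw [real_inner_smul_right, inner_neg_right, real_inner_self_eq_norm_sq] at h1
  refine le_trans ?_ h1
  have h2 := hC (-x)
  rw [norm_neg] at h2
  have hn : 0 < ‖x‖ := norm_pos_iff.2 hx
  rw [show -2 * π * ((a (-x))⁻¹ * -‖x‖ ^ 2) = 2 * π * ‖x‖ ^ 2 / a (-x) by field_simp,
    div_mul_eq_mul_div, div_le_div_iff₀ hC0 hx']
  calc _ ≤ 2 * π * ‖x‖ * (C * ‖x‖) := by gcongr
    _ = _ := by ring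

lemma supportFn_nonneg (ha : IsDistFn a) (hd : 0 < d) (x : Rd d) : 0 ≤ supportFn a x := by
  obtain ⟨c, hc, h⟩ := ha.exists_supportFn_ge hd
  exact le_trans (by positivity) (h x)

lemma two_pi_inner_eq (ha : IsDistFn a) (hd : 0 < d) {x ω : Rd d} (hω : a ω = 1)
    (h : supportFn a x = -2 * π * ⟪x, ω⟫) (ξ : Rd d) :
    2 * π * ⟪x, ξ⟫ = -(supportFn a x * fderiv ℝ a ω ξ) := by
  have hω0 : ω ≠ 0 := ha.ne_zero_of_pos (by rw [hω]; norm_num)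
  have hmin : IsLocalMin (fun ξ => supportFn a x * a ξ + 2 * π * ⟪x, ξ⟫) ω := by
    filter_upwards [isOpen_ne.mem_nhds hω0] with ξ hξ
    have hp : 0 < a ξ := ha.pos ξ hξ
    have h1 := ha.le_supportFn hd x (ha.map_inv_smul_self hp)
    rw [real_inner_smul_right] at h1
    have h2 := mul_le_mul_of_nonneg_left h1 hp.le
    have h3 : a ξ * (-2 * π * ((a ξ)⁻¹ * ⟪x, ξ⟫)) = -2 * π * ⟪x, ξ⟫ := by field_simp
    rw [h3] at h2
    rw [hω, h] at *
    linarith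
  have hder : HasFDerivAt (fun ξ => supportFn a x * a ξ + 2 * π * ⟪x, ξ⟫)
      (supportFn a x • fderiv ℝ a ω + (2 * π) • innerSL ℝ x) ω :=
    ((ha.differentiableAt hω0).hasFDerivAt.const_mul _).add
      ((innerSL ℝ x).hasFDerivAt.const_mul (2 * π))
  have h0 := DFunLike.congr_fun (hmin.hasFDerivAt_eq_zero hder) ξ
  simp at h0
  linarith

end IsDistFn

end

section

open Filter Topology

/-- A smooth cutoff supported in `[1/8, 8]`. -/
structure IsCutoff (χ : ℝ → ℝ) : Prop where
  smooth : ContDiff ℝ (⊤ : ℕ∞) χ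
  supp : ∀ x : ℝ, x ∉ Icc (1/8 : ℝ) 8 → χ x = 0

lemma IsBump.isCutoff {η : ℝ → ℝ} (h : IsBump η) : IsCutoff η := ⟨h.smooth, h.supp⟩

lemma IsCutoff.sq {χ : ℝ → ℝ} (h : IsCutoff χ) : IsCutoff (fun t => χ t ^ 2) :=
  ⟨h.smooth.pow 2, fun x hx => by simp [h.supp x hx]⟩

lemma norm_integral_exp_le {d : ℕ} {K₀ : Set (Rd d)} {g : Rd d → ℂ} {Φ P : Rd d → ℝ}
    (hK₀ : MeasurableSet K₀) (hg : tsupport g ⊆ K₀) {A I : ℝ} (hA : 0 ≤ A) (hI : 0 ≤ I)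
    (hle : ∀ ξ ∈ K₀, ‖g ξ‖ ≤ A * P ξ) (hP : ∫⁻ ξ in K₀, ENNReal.ofReal (P ξ) ≤ ENNReal.ofReal I) :
    ‖∫ ξ, Complex.exp (Complex.I * Φ ξ) * g ξ‖ ≤ A * I := by
  rw [← ENNReal.ofReal_le_ofReal_iff (by positivity), ofReal_norm]
  calc _ ≤ ∫⁻ ξ, ‖Complex.exp (Complex.I * Φ ξ) * g ξ‖ₑ := enorm_integral_le_lintegral_enorm _
    _ = ∫⁻ ξ, ‖g ξ‖ₑ := by
        refine lintegral_congr fun ξ => ?_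
        rw [enorm_mul, ← ofReal_norm (Complex.exp _), mul_comm Complex.I,
          Complex.norm_exp_ofReal_mul_I, ENNReal.ofReal_one, one_mul]
    _ = ∫⁻ ξ in K₀, ‖g ξ‖ₑ := by
        rw [← lintegral_indicator hK₀]
        congr 1
        ext ξ
        by_cases hξ : ξ ∈ K₀
        · rw [indicator_of_mem hξ]
        · rw [indicator_of_notMem hξ, image_eq_zero_of_notMem_tsupport fun h => hξ (hg h)]
          simp
    _ ≤ ∫⁻ ξ in K₀, ENNReal.ofReal A * ENNReal.ofReal (P ξ) := by
        refine setLIntegral_mono' hK₀ fun ξ hξ => ?_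
        rw [← ENNReal.ofReal_mul hA, ← ofReal_norm]
        exact ENNReal.ofReal_le_ofReal (hle ξ hξ)
    _ ≤ _ := by
        rw [lintegral_const_mul' _ _ ENNReal.ofReal_ne_top, ENNReal.ofReal_mul hA]
        gcongr

lemma inv_one_add_pow_le {M w y c : ℝ} (hc : 0 < c) (hc1 : c ≤ 1) (hw : 0 ≤ w) (hy : 0 ≤ y)
    (h : c * (w + y) ≤ M) (N d : ℕ) :
    (1 + M)⁻¹ ^ (N + d) ≤ c⁻¹ ^ (N + d) * (1 + w)⁻¹ ^ N * (1 + y)⁻¹ ^ d := by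
  have h0 : 0 ≤ c * w := by positivity
  have h0' : 0 ≤ c * y := by positivity
  have hM : 0 < 1 + M := by linarith
  have h1 : (1 + M)⁻¹ ≤ c⁻¹ * (1 + w)⁻¹ := by
    rw [← mul_inv]
    exact inv_anti₀ (by positivity) (by linarith)
  have h2 : (1 + M)⁻¹ ≤ c⁻¹ * (1 + y)⁻¹ := by
    rw [← mul_inv]
    exact inv_anti₀ (by positivity) (by linarith)
  have hM' : 0 ≤ (1 + M)⁻¹ := by positivity
  calc (1 + M)⁻¹ ^ (N + d) = (1 + M)⁻¹ ^ N * (1 + M)⁻¹ ^ d := pow_add _ _ _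
    _ ≤ (c⁻¹ * (1 + w)⁻¹) ^ N * (c⁻¹ * (1 + y)⁻¹) ^ d := by gcongr
    _ = _ := by rw [mul_pow, mul_pow, pow_add]; ring

namespace IsDistFn

variable {d : ℕ} {a : Rd d → ℝ}

theorem exists_norm_Kker_le (ha : IsDistFn a) (hc : CurvNondeg a) (hd : 2 ≤ d) {χ : ℝ → ℝ}
    (hχ : IsCutoff χ) (N : ℕ) : ∃ C, 0 ≤ C ∧ ∀ s : ℝ, 0 ≤ s → ∀ x : Rd d,
      ‖Kker a χ s x‖ ≤ C * (√(1 + (s + supportFn a x)))⁻¹ ^ (d - 1) *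
        (1 + |supportFn a x - s|)⁻¹ ^ N := by
  have hd0 : 0 < d := by omega
  set K := a ⁻¹' Ioo (1 / 16) 16 with hKdef
  set K₀ := a ⁻¹' Icc (1 / 8) 8 with hK₀def
  have hK : IsOpen K := ha.isOpen_Ioo _ _
  have hKc := ha.isCompact_Icc hd0 (1 / 16) 16
  have hsub : K ⊆ a ⁻¹' Icc (1 / 16) 16 := fun ξ hξ => ⟨hξ.1.le, hξ.2.le⟩
  have hU : IsOpen {ξ : Rd d | ξ ≠ 0} := isOpen_ne
  have hKU : a ⁻¹' Icc (1 / 16) 16 ⊆ {ξ : Rd d | ξ ≠ 0} := fun ξ hξ =>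
    ha.ne_zero_of_pos (lt_of_lt_of_le (by norm_num) hξ.1)
  have hK₀K : K₀ ⊆ K := fun ξ hξ =>
    ⟨lt_of_lt_of_le (by norm_num) hξ.1, lt_of_le_of_lt hξ.2 (by norm_num)⟩
  have hK₀c : IsCompact K₀ := ha.isCompact_Icc hd0 _ _
  have hpos : ∀ ξ ∈ K, 0 < a ξ := fun ξ hξ => lt_trans (by norm_num) hξ.1
  have hne : ∀ ξ ∈ K, ξ ≠ 0 := fun ξ hξ => ha.ne_zero_of_pos (hpos ξ hξ)
  obtain ⟨c, hc0, hconv⟩ := ha.exists_convex hc hd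
  obtain ⟨c', hc'0, hconv'⟩ := ha.exists_convex' hc hd
  obtain ⟨B, hB0, hB⟩ := ha.exists_norm_le_of_unit hd0
  obtain ⟨Cm, hCm0, hCm⟩ := ha.exists_isSym_defect hc hd (N + d)
  set h : Rd d → ℂ := fun ξ => (χ (a ξ) : ℂ) with hh
  have hhs : ContDiffOn ℝ (⊤ : ℕ∞) h {ξ : Rd d | ξ ≠ 0} :=
    (Complex.ofRealCLM.contDiff.comp hχ.smooth).comp_contDiffOn ha.smooth
  have hht : tsupport h ⊆ K₀ := by
    refine closure_minimal (fun ξ hξ => ?_) hK₀c.isClosed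
    by_contra hn
    exact hξ (by simp [hh, hχ.supp _ hn])
  obtain ⟨Ch, hCh0, hCh⟩ := exists_isSym_of_contDiffOn hK hU hKc hsub hKU B hB0.le (N + d) h hhs
  set CM : ℝ := 2 + 2 ^ (N + d) * Cm with hCM
  obtain ⟨C, hC0, hC⟩ := exists_ibp d CM (by positivity) (N + d) Ch hCh0
  obtain ⟨CI, hCI0, hCI⟩ := ha.exists_lintegral_cone_le hd0
  -- a common lower bound for both choices of field
  set D : ℝ := 1 + (2 * B) ^ 2 with hD
  have hD0 : 0 < D := by positivity
  set q : ℝ := min 1 (min (1 / 16) (min (c / 16) c') / (2 + D)) with hq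
  have hq0 : 0 < q := by positivity
  have hqM : ∀ (w m θ : ℝ) (M : ℝ), 0 ≤ w → 0 ≤ m → 0 ≤ θ → θ ≤ 2 * B →
      min (1 / 16) (min (c / 16) c') * (w + m * θ ^ 2) ≤ M → q * (w + (2 * m + w) * θ ^ 2) ≤ M := by
    intro w m θ M hw hm hθ hθB hM
    refine le_trans ?_ hM
    have h1 : q ≤ min (1 / 16) (min (c / 16) c') / (2 + D) := min_le_right _ _
    set q' := min (1 / 16) (min (c / 16) c')
    have hq' : 0 < q' := by positivity
    have h2 : w + (2 * m + w) * θ ^ 2 ≤ (2 + D) * (w + m * θ ^ 2) := by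
      have h3 : θ ^ 2 ≤ (2 * B) ^ 2 := by gcongr
      have h4 : w * θ ^ 2 ≤ w * (2 * B) ^ 2 := by gcongr
      have h5 : 0 ≤ m * θ ^ 2 := by positivity
      have h6 : 0 ≤ D * (m * θ ^ 2) := by positivity
      rw [hD] at h6 ⊢
      nlinarith
    calc q * (w + (2 * m + w) * θ ^ 2) ≤ q' / (2 + D) * ((2 + D) * (w + m * θ ^ 2)) :=
          mul_le_mul h1 h2 (by positivity) (by positivity)
      _ = _ := by field_simp
  refine ⟨C * q⁻¹ ^ (N + d) * CI, by positivity, fun s hs x => ?_⟩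
  obtain ⟨ω, hω, hρ⟩ := ha.exists_supportFn_eq hd0 x
  have hψ := ha.supportFn_nonneg hd0 x
  have hin := ha.two_pi_inner_eq hd0 hω hρ
  set ψ := supportFn a x with hψdef
  have hω0 : ω ≠ 0 := ha.ne_zero_of_pos (by rw [hω]; norm_num)
  set Φ : Rd d → ℝ := fun ξ => s * a ξ - ψ * fderiv ℝ a ω ξ with hΦ
  have hΦs : ContDiffOn ℝ (⊤ : ℕ∞) Φ K :=
    (contDiffOn_const.mul (ha.smooth.mono (hsub.trans hKU))).sub
      (contDiff_const.mul (fderiv ℝ a ω).contDiff).contDiffOn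
  have hΦd : ∀ ξ ∈ K, ∀ u, fderiv ℝ Φ ξ u = s * fderiv ℝ a ξ u - ψ * fderiv ℝ a ω u := by
    intro ξ hξ u
    have h1 : HasFDerivAt Φ (s • fderiv ℝ a ξ - ψ • fderiv ℝ a ω) ξ :=
      ((ha.differentiableAt (hne ξ hξ)).hasFDerivAt.const_mul s).sub
        ((fderiv ℝ a ω).hasFDerivAt.const_mul ψ)
    rw [h1.fderiv]
    simp
  have hker : Kker a χ s x = ∫ ξ, Complex.exp (Complex.I * Φ ξ) * h ξ := by
    unfold Kker
    refine integral_congr_ae (Eventually.of_forall fun ξ => ?_)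
    simp only [hh]
    rw [mul_assoc, mul_comm, ← Complex.exp_add]
    congr 2
    have h1 : ((2 * π * ⟪x, ξ⟫ : ℝ) : ℂ) = ((-(ψ * fderiv ℝ a ω ξ) : ℝ) : ℂ) := by rw [hin]
    push_cast [hΦ] at h1 ⊢
    linear_combination Complex.I * h1
  have hθB : ∀ ξ ∈ K, ‖(a ξ)⁻¹ • ξ - ω‖ ≤ 2 * B := fun ξ hξ => by
    have := norm_sub_le_of_le (hB _ (ha.map_inv_smul_self (hpos ξ hξ))) (hB ω hω)
    linarith
  -- it suffices to find an admissible field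
  suffices H : ∃ (v : Rd d) (κ σ : ℝ) (M : Rd d → ℝ), ‖v‖ ≤ B ∧ |κ| ≤ 1 ∧ σ ^ 2 = 1 ∧
      (∀ ξ ∈ K, fderiv ℝ Φ ξ (v + κ • ξ) = σ * M ξ) ∧
      (∀ ξ ∈ K, min (1 / 16) (min (c / 16) c') *
        (|ψ - s| + min s ψ * ‖(a ξ)⁻¹ • ξ - ω‖ ^ 2) ≤ M ξ) ∧
      IsSym K v κ (N + d) CM M (fun ξ => (M ξ : ℂ)) by
    obtain ⟨v, κ, σ, M, hv, hκ, hσ, hM1, hM2, hM3⟩ := H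
    have hm0 : 0 ≤ min s ψ := le_min hs hψ
    have hMq : ∀ ξ ∈ K, q * (|ψ - s| + (s + ψ) * ‖(a ξ)⁻¹ • ξ - ω‖ ^ 2) ≤ M ξ := by
      intro ξ hξ
      have h1 := hqM _ _ _ _ (abs_nonneg (ψ - s)) hm0 (norm_nonneg _) (hθB ξ hξ) (hM2 ξ hξ)
      have h2 : 2 * min s ψ + |ψ - s| = s + ψ := by
        rcases le_total s ψ with h | h
        · rw [min_eq_left h, abs_of_nonneg (by linarith)]; ring
        · rw [min_eq_right h, abs_of_nonpos (by linarith)]; ring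
      rwa [h2] at h1
    have hM0 : ∀ ξ ∈ K, 0 ≤ M ξ := fun ξ hξ => le_trans (by positivity) (hMq ξ hξ)
    obtain ⟨g, hg1, hg2, hg3⟩ := hC K K₀ v κ σ Φ M (fun _ => 1) h hK hK₀c hK₀K hκ hσ hΦs hM1 hM0
      (fun _ _ => zero_le_one) hM3 (hCh v κ hv hκ) hht
    rw [hker, hg3]
    refine (norm_integral_exp_le (A := C * q⁻¹ ^ (N + d) * (1 + |ψ - s|)⁻¹ ^ N)
      (I := CI * (√(1 + (s + ψ)))⁻¹ ^ (d - 1)) hK₀c.measurableSet hg1 (by positivity)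
      (by positivity) (fun ξ hξ => ?_) (hCI ω hω (s + ψ) (by positivity))).trans (le_of_eq (by ring))
    refine (hg2 ξ (hK₀K hξ)).trans ?_
    have h1 := inv_one_add_pow_le hq0 (min_le_left _ _) (abs_nonneg (ψ - s)) (by positivity)
      (hMq ξ (hK₀K hξ)) N d
    calc C * 1 * (1 + M ξ)⁻¹ ^ (N + d) ≤ C * 1 * _ := mul_le_mul_of_nonneg_left h1 (by positivity)
      _ = _ := by ring
  set q' := min (1 / 16) (min (c / 16) c') with hq'
  have hq'0 : 0 < q' := by positivity
  have hq'1 : q' ≤ 1 / 16 := min_le_left _ _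
  have hq'2 : q' ≤ c / 16 := (min_le_right _ _).trans (min_le_left _ _)
  have hq'3 : q' ≤ c' := (min_le_right _ _).trans (min_le_right _ _)
  have hCM1 : 2 ≤ CM := by rw [hCM]; linarith [show 0 ≤ 2 ^ (N + d) * Cm by positivity]
  rcases le_total ψ s with hcase | hcase
  · have hlow : ∀ ξ ∈ K, q' * (|ψ - s| + min s ψ * ‖(a ξ)⁻¹ • ξ - ω‖ ^ 2) ≤ Φ ξ := by
      intro ξ hξ
      have h1 := hconv ω ((a ξ)⁻¹ • ξ) hω (ha.map_inv_smul_self (hpos ξ hξ))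
      rw [min_eq_right hcase, abs_of_nonpos (by linarith)]
      rw [map_smul, smul_eq_mul, norm_sub_rev, inv_mul_le_iff₀ (hpos ξ hξ)] at h1
      set θ := ‖(a ξ)⁻¹ • ξ - ω‖
      have h2 := mul_le_mul_of_nonneg_left h1 hψ
      have h3 : 1 / 16 ≤ a ξ := hξ.1.le
      have h4 : q' * (s - ψ) ≤ a ξ * (s - ψ) :=
        mul_le_mul_of_nonneg_right (hq'1.trans h3) (by linarith)
      have h5 : q' * (ψ * θ ^ 2) ≤ (c * a ξ) * (ψ * θ ^ 2) :=
        mul_le_mul_of_nonneg_right (by nlinarith) (by positivity)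
      simp only [hΦ]
      linarith
    refine ⟨0, 1, 1, Φ, by simpa using hB0.le, by simp, by simp, fun ξ hξ => ?_, hlow, ?_⟩
    · rw [zero_add, one_smul, one_mul, hΦd ξ hξ, ha.euler (hne ξ hξ)]
    · refine IsSym.of_eigen hK (z := 1) (by simp)
        (Complex.ofRealCLM.contDiff.comp_contDiffOn hΦs) (fun ξ hξ => ?_) fun ξ hξ => ?_
      · have h1 : 0 ≤ Φ ξ := le_trans
          (mul_nonneg hq'0.le (add_nonneg (abs_nonneg _) (by positivity))) (hlow ξ hξ)
        rw [Complex.norm_real, Real.norm_of_nonneg h1]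
        nlinarith
      · have h2 : HasFDerivAt (fun ξ => (Φ ξ : ℂ)) (Complex.ofRealCLM.comp (fderiv ℝ Φ ξ)) ξ :=
          Complex.ofRealCLM.hasFDerivAt.comp ξ
            ((hΦs.contDiffAt (hK.mem_nhds hξ)).differentiableAt (by simp)).hasFDerivAt
        rw [fieldDeriv, h2.fderiv]
        simp only [zero_add, one_smul, one_mul, ContinuousLinearMap.comp_apply,
          Complex.ofRealCLM_apply]
        rw [hΦd ξ hξ, ha.euler (hne ξ hξ)]
  · refine ⟨ω, 0, -1, fun ξ => (ψ - s) + s * (1 - fderiv ℝ a ξ ω), hB ω hω, by simp, by simp,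
      fun ξ hξ => ?_, fun ξ hξ => ?_, ?_⟩
    · rw [zero_smul, add_zero, hΦd ξ hξ, ha.euler hω0, hω]
      ring
    · have h1 := hconv' ξ ω (hpos ξ hξ) hω
      rw [min_eq_left hcase, abs_of_nonneg (by linarith)]
      set θ := ‖(a ξ)⁻¹ • ξ - ω‖
      have h2 := mul_le_mul_of_nonneg_left h1 hs
      have h4 : q' * (ψ - s) ≤ 1 * (ψ - s) :=
        mul_le_mul_of_nonneg_right (hq'1.trans (by norm_num)) (by linarith)
      have h5 : q' * (s * θ ^ 2) ≤ c' * (s * θ ^ 2) :=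
        mul_le_mul_of_nonneg_right hq'3 (by positivity)
      linarith
    · have hm : ∀ ξ ∈ K, 0 ≤ 1 - fderiv ℝ a ξ ω := fun ξ hξ =>
        le_trans (by positivity) (hconv' ξ ω (hpos ξ hξ) hω)
      have h1 : IsSym K ω 0 (N + d) 2 (fun ξ => (ψ - s) + s * (1 - fderiv ℝ a ξ ω))
          (fun _ => ((ψ - s : ℝ) : ℂ)) :=
        (IsSym.const _).mono fun ξ hξ => by
          rw [Complex.norm_real, Real.norm_of_nonneg (by linarith)]
          nlinarith [mul_nonneg hs (hm ξ hξ)]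
      have h2 : IsSym K ω 0 (N + d) (2 ^ (N + d) * Cm)
          (fun ξ => (ψ - s) + s * (1 - fderiv ℝ a ξ ω))
          (fun ξ => (s : ℂ) * ((1 - fderiv ℝ a ξ ω : ℝ) : ℂ)) :=
        ((hCm ω hω).1.const_mul hK (s : ℂ)).mono fun ξ hξ => by
          rw [Complex.norm_real, Real.norm_of_nonneg hs]
          have : 0 ≤ 2 ^ (N + d) * Cm * (ψ - s) := mul_nonneg (by positivity) (by linarith)
          nlinarith
      refine (h1.add hK h2).congr hK fun ξ hξ => ?_
      push_cast
      ring

end IsDistFn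

end

section

open Filter Topology

lemma IsCutoff.continuous {χ : ℝ → ℝ} (h : IsCutoff χ) : Continuous χ := h.smooth.continuous

namespace IsDistFn

variable {d : ℕ} {a : Rd d → ℝ} {χ : ℝ → ℝ}

lemma tsupport_cutoff_subset (ha : IsDistFn a) (hd : 0 < d) (hχ : IsCutoff χ) :
    tsupport (fun ξ => (χ (a ξ) : ℂ)) ⊆ a ⁻¹' Icc (1 / 8) 8 := by
  refine closure_minimal (fun ξ hξ => ?_) (ha.isCompact_Icc hd _ _).isClosed
  by_contra hn
  exact hξ (by simp [hχ.supp _ hn])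

lemma continuous_cutoff (ha : IsDistFn a) (hχ : IsCutoff χ) :
    Continuous fun ξ => (χ (a ξ) : ℂ) :=
  Complex.continuous_ofReal.comp (hχ.continuous.comp ha.continuous)

lemma integrable_cutoff (ha : IsDistFn a) (hd : 0 < d) (hχ : IsCutoff χ) :
    Integrable fun ξ => (χ (a ξ) : ℂ) :=
  (ha.continuous_cutoff hχ).integrable_of_hasCompactSupport
    ((ha.isCompact_Icc hd _ _).of_isClosed_subset (isClosed_tsupport _)
      (ha.tsupport_cutoff_subset hd hχ))

lemma norm_Kker_integrand (r : ℝ) (x ξ : Rd d) :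
    ‖(χ (a ξ) : ℂ) * Complex.exp (Complex.I * r * a ξ) *
      Complex.exp (2 * π * Complex.I * (⟪x, ξ⟫ : ℝ))‖ = ‖(χ (a ξ) : ℂ)‖ := by
  rw [norm_mul, norm_mul,
    show Complex.I * r * a ξ = ((r * a ξ : ℝ) : ℂ) * Complex.I by push_cast; ring,
    show 2 * π * Complex.I * (⟪x, ξ⟫ : ℝ) = ((2 * π * ⟪x, ξ⟫ : ℝ) : ℂ) * Complex.I by
      push_cast; ring, Complex.norm_exp_ofReal_mul_I, Complex.norm_exp_ofReal_mul_I, mul_one, mul_one]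

lemma continuous_Kker (ha : IsDistFn a) (hd : 0 < d) (hχ : IsCutoff χ) :
    Continuous fun q : ℝ × Rd d => Kker a χ q.1 q.2 := by
  have h1 := ha.continuous_cutoff hχ
  have h2 := ha.continuous
  refine continuous_of_dominated (bound := fun ξ => ‖(χ (a ξ) : ℂ)‖) (fun q => ?_) (fun q => ?_)
    (ha.integrable_cutoff hd hχ).norm (Eventually.of_forall fun ξ => ?_)
  · exact Continuous.aestronglyMeasurable (by fun_prop)
  · exact Eventually.of_forall fun ξ => (norm_Kker_integrand _ _ _).le
  · fun_prop

lemma Kker_neg (r : ℝ) (x : Rd d) :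
    Kker a χ (-r) x = (starRingEnd ℂ) (Kker a χ r (-x)) := by
  unfold Kker
  rw [← integral_conj]
  refine integral_congr_ae (Eventually.of_forall fun ξ => ?_)
  simp only [map_mul, ← Complex.exp_conj, Complex.conj_ofReal, Complex.conj_I, inner_neg_left,
    Complex.ofReal_neg]
  simp only [map_neg, Complex.conj_ofReal, map_ofNat]
  congr 2
  · congr 2; ring
  · ring

/-- The Fourier multiplier of the translated kernel `K_r(· - y)`. -/
def multiplier (a : Rd d → ℝ) (χ : ℝ → ℝ) (r : ℝ) (y ξ : Rd d) : ℂ :=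
  (χ (a ξ) : ℂ) * Complex.exp (((r * a ξ - 2 * π * ⟪y, ξ⟫ : ℝ) : ℂ) * Complex.I)

lemma tsupport_multiplier_subset (ha : IsDistFn a) (hd : 0 < d) (hχ : IsCutoff χ) (r : ℝ)
    (y : Rd d) : tsupport (multiplier a χ r y) ⊆ a ⁻¹' Icc (1 / 8) 8 :=
  (tsupport_mul_subset_left (f := fun ξ => (χ (a ξ) : ℂ))).trans (ha.tsupport_cutoff_subset hd hχ)

lemma contDiff_multiplier (ha : IsDistFn a) (hd : 0 < d) (hχ : IsCutoff χ) (r : ℝ) (y : Rd d) :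
    ContDiff ℝ (⊤ : ℕ∞) (multiplier a χ r y) := by
  refine contDiff_of_tsupport_subset (K := {ξ : Rd d | ξ ≠ 0}) isOpen_ne ?_ ?_
  · have h1 : ContDiffOn ℝ (⊤ : ℕ∞) (fun ξ => (χ (a ξ) : ℂ)) {ξ : Rd d | ξ ≠ 0} :=
      (Complex.ofRealCLM.contDiff.comp hχ.smooth).comp_contDiffOn ha.smooth
    have h2 : ContDiffOn ℝ (⊤ : ℕ∞) (fun ξ => r * a ξ - 2 * π * ⟪y, ξ⟫) {ξ : Rd d | ξ ≠ 0} :=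
      (contDiffOn_const.mul ha.smooth).sub
        (contDiff_const.mul (contDiff_const.inner ℝ contDiff_id)).contDiffOn
    exact h1.mul (((Complex.ofRealCLM.contDiff.comp_contDiffOn h2).mul contDiffOn_const).cexp)
  · exact (ha.tsupport_multiplier_subset hd hχ r y).trans fun ξ hξ =>
      ha.ne_zero_of_pos (lt_of_lt_of_le (by norm_num) hξ.1)

lemma fourier_multiplier (r : ℝ) (y x : Rd d) :
    𝓕 (multiplier a χ r y) x = Kker a χ r (-x - y) := by
  rw [Real.fourier_eq']
  unfold Kker
  refine integral_congr_ae (Eventually.of_forall fun ξ => ?_)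
  simp only [multiplier, smul_eq_mul]
  rw [mul_left_comm, ← Complex.exp_add, mul_assoc (χ (a ξ) : ℂ), ← Complex.exp_add]
  congr 2
  rw [inner_sub_left, inner_neg_left, real_inner_comm ξ x]
  push_cast
  ring

/-- Gram identity for translates of the kernels. -/
lemma integral_Kker_mul_conj (ha : IsDistFn a) (hd : 0 < d) (hχ : IsCutoff χ) (r r' : ℝ)
    (y y' : Rd d) :
    ∫ x, Kker a χ r (x - y) * (starRingEnd ℂ) (Kker a χ r' (x - y')) =
      Kker a (fun t => χ t ^ 2) (r - r') (y' - y) := by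
  have hcs : ∀ r y, HasCompactSupport (multiplier a χ r y) := fun r y =>
    (ha.isCompact_Icc hd _ _).of_isClosed_subset (isClosed_tsupport _)
      (ha.tsupport_multiplier_subset hd hχ r y)
  set f := (hcs r y).toSchwartzMap (ha.contDiff_multiplier hd hχ r y)
  set g := (hcs r' y').toSchwartzMap (ha.contDiff_multiplier hd hχ r' y')
  have h := SchwartzMap.integral_inner_fourier_fourier g f
  have h1 : ∀ x, (𝓕 f) x = Kker a χ r (-x - y) := fun x => by
    rw [SchwartzMap.fourier_coe]
    exact fourier_multiplier r y x
  have h2 : ∀ x, (𝓕 g) x = Kker a χ r' (-x - y') := fun x => by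
    rw [SchwartzMap.fourier_coe]
    exact fourier_multiplier r' y' x
  simp only [h1, h2] at h
  rw [← integral_neg_eq_self]
  simp only [RCLike.inner_apply] at h
  rw [h]
  unfold Kker
  refine integral_congr_ae (Eventually.of_forall fun ξ => ?_)
  change multiplier a χ r y ξ * (starRingEnd ℂ) (multiplier a χ r' y' ξ) = _
  simp only [multiplier, map_mul, ← Complex.exp_conj, Complex.conj_ofReal, Complex.conj_I]
  rw [mul_mul_mul_comm, ← Complex.exp_add, mul_assoc ((χ (a ξ) ^ 2 : ℝ) : ℂ), ← Complex.exp_add,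
    inner_sub_left]
  push_cast
  rw [← sq]
  congr 2
  ring

end IsDistFn

end

section

open Filter Topology
open scoped Pointwise

namespace IsDistFn

variable {d : ℕ} {a : Rd d → ℝ} {χ : ℝ → ℝ}

lemma volume_supportFn_lt (ha : IsDistFn a) (hd : 0 < d) {s : ℝ} (hs : 0 ≤ s) :
    volume {x | supportFn a x < s} = ENNReal.ofReal (s ^ d) * volume {x | supportFn a x < 1} := by
  rcases hs.eq_or_lt with rfl | hs
  · have : {x : Rd d | supportFn a x < 0} = ∅ :=
      eq_empty_of_forall_notMem fun x hx => (ha.supportFn_nonneg hd x).not_gt hx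
    rw [this, measure_empty, zero_pow hd.ne']
    simp
  · have : {x : Rd d | supportFn a x < s} = s • {x | supportFn a x < 1} := by
      ext x
      rw [mem_smul_set_iff_inv_smul_mem₀ hs.ne', mem_ofPred_eq, mem_ofPred_eq,
        ha.supportFn_smul hd (inv_nonneg.2 hs.le), inv_mul_lt_iff₀ hs, mul_one]
    rw [this, Measure.addHaar_smul, finrank_euclideanSpace_fin, abs_of_nonneg (by positivity)]

lemma volume_supportFn_lt_one_lt_top (ha : IsDistFn a) (hd : 0 < d) :
    volume {x | supportFn a x < 1} < ∞ := by
  obtain ⟨c, hc, h⟩ := ha.exists_supportFn_ge hd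
  refine (measure_mono (t := Metric.closedBall 0 (1 / c)) fun x hx => ?_).trans_lt
    measure_closedBall_lt_top
  rw [mem_closedBall_zero_iff, le_div_iff₀ hc, mul_comm]
  exact (h x).trans (le_of_lt hx)

/-- The volume of a shell around a level set of the support function. -/
lemma exists_volume_shell_le (ha : IsDistFn a) (hd : 0 < d) :
    ∃ C, 0 ≤ C ∧ ∀ s W : ℝ, 0 < W →
      volume {x | |supportFn a x - s| ≤ W} ≤ ENNReal.ofReal (C * (W * (|s| + W) ^ (d - 1))) := by
  set V := volume {x | supportFn a x < 1} with hV
  have hVt : V ≠ ∞ := (ha.volume_supportFn_lt_one_lt_top hd).ne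
  refine ⟨3 * d * 2 ^ (d - 1) * V.toReal, by positivity, fun s W hW => ?_⟩
  set u := max (s - W) 0
  set v := max (s + 2 * W) 0
  have hu : 0 ≤ u := le_max_right _ _
  have huv : u ≤ v := max_le_max (by linarith) le_rfl
  have hv : 0 ≤ v := hu.trans huv
  have hvu : |v - u| ≤ 3 * W :=
    (abs_max_sub_max_le_abs _ _ _).trans (by rw [abs_of_nonneg] <;> linarith)
  have hvs : v ≤ 2 * (|s| + W) := max_le (by linarith [le_abs_self s, abs_nonneg s]) (by positivity)
  have hmeas : MeasurableSet {x : Rd d | supportFn a x < u} :=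
    measurableSet_lt (ha.continuous_supportFn hd).measurable measurable_const
  have hpow : v ^ d - u ^ d ≤ 3 * d * 2 ^ (d - 1) * (W * (|s| + W) ^ (d - 1)) := by
    calc v ^ d - u ^ d ≤ |v - u| * d * max |v| |u| ^ (d - 1) :=
          (le_abs_self _).trans (abs_pow_sub_pow_le v u d)
      _ ≤ 3 * W * d * (2 * (|s| + W)) ^ (d - 1) := by
          rw [abs_of_nonneg hv, abs_of_nonneg hu, max_eq_left huv]
          gcongr
      _ = _ := by rw [mul_pow]; ring
  calc volume {x | |supportFn a x - s| ≤ W}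
      ≤ volume ({x | supportFn a x < v} \ {x | supportFn a x < u}) := by
        refine measure_mono fun x hx => ?_
        rw [mem_ofPred_eq, abs_le] at hx
        rw [Set.mem_sdiff, mem_ofPred_eq, mem_ofPred_eq, not_lt]
        refine ⟨lt_max_of_lt_left (by linarith), ?_⟩
        exact max_le (by linarith) (ha.supportFn_nonneg hd x)
    _ = ENNReal.ofReal (v ^ d) * V - ENNReal.ofReal (u ^ d) * V := by
        rw [measure_sdiff (show {x | supportFn a x < u} ⊆ {x | supportFn a x < v} from
            fun x hx => lt_of_lt_of_le (b := u) hx huv) hmeas.nullMeasurableSet,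
          ha.volume_supportFn_lt hd hu, ha.volume_supportFn_lt hd hv]
        rw [ha.volume_supportFn_lt hd hu]
        exact ENNReal.mul_ne_top ENNReal.ofReal_ne_top hVt
    _ = ENNReal.ofReal ((v ^ d - u ^ d) * V.toReal) := by
        rw [← ENNReal.sub_mul fun _ _ => hVt, ← ENNReal.ofReal_sub _ (by positivity),
          ENNReal.ofReal_mul' ENNReal.toReal_nonneg, ENNReal.ofReal_toReal hVt]
    _ ≤ _ := by
        refine ENNReal.ofReal_le_ofReal ?_
        calc _ ≤ (3 * d * 2 ^ (d - 1) * (W * (|s| + W) ^ (d - 1))) * V.toReal := by gcongr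
          _ = _ := by ring

end IsDistFn

/-- The properties of the kernels `K_r` and of their Gram kernels used in the sequel. -/
structure IsKernelPair {d : ℕ} (ρ : Rd d → ℝ) (K G : ℝ → Rd d → ℂ) : Prop where
  contK : Continuous fun q : ℝ × Rd d => K q.1 q.2
  contG : Continuous fun q : ℝ × Rd d => G q.1 q.2
  cont : Continuous ρ
  lip : ∃ C, 0 < C ∧ ∀ x y, |ρ x - ρ y| ≤ C * ‖x - y‖
  coercive : ∃ c, 0 < c ∧ ∀ x, c * ‖x‖ ≤ ρ x
  shell : ∃ C, 0 ≤ C ∧ ∀ s W : ℝ, 0 < W →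
      volume {x | |ρ x - s| ≤ W} ≤ ENNReal.ofReal (C * (W * (|s| + W) ^ (d - 1)))
  boundK : ∀ N : ℕ, ∃ C, 0 ≤ C ∧ ∀ s, 0 ≤ s → ∀ x,
    ‖K s x‖ ≤ C * (1 + s + ρ x) ^ (-(((d : ℝ) - 1) / 2)) * (1 + |ρ x - s|)⁻¹ ^ N
  boundG : ∀ N : ℕ, ∃ C, 0 ≤ C ∧ ∀ s, 0 ≤ s → ∀ x,
    ‖G s x‖ ≤ C * (1 + s + ρ x) ^ (-(((d : ℝ) - 1) / 2)) * (1 + |ρ x - s|)⁻¹ ^ N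
  gram : ∀ r r' y y', ∫ x, K r (x - y) * (starRingEnd ℂ) (K r' (x - y')) = G (r - r') (y' - y)

lemma sqrt_inv_pow_eq {d : ℕ} (hd : 1 ≤ d) {T : ℝ} (hT : 0 ≤ T) :
    (√T)⁻¹ ^ (d - 1) = T ^ (-(((d : ℝ) - 1) / 2)) := by
  rw [Real.sqrt_eq_rpow, ← Real.rpow_neg hT, ← Real.rpow_natCast, ← Real.rpow_mul hT,
    Nat.cast_sub hd]
  congr 1
  push_cast
  ring

lemma IsDistFn.isKernelPair {d : ℕ} {a : Rd d → ℝ} {χ : ℝ → ℝ} (ha : IsDistFn a)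
    (hc : CurvNondeg a) (hd : 2 ≤ d) (hχ : IsCutoff χ) :
    IsKernelPair (supportFn a) (Kker a χ) (Kker a fun t => χ t ^ 2) := by
  have hd0 : 0 < d := by omega
  have key : ∀ {χ : ℝ → ℝ}, IsCutoff χ → ∀ N : ℕ, ∃ C, 0 ≤ C ∧ ∀ s, 0 ≤ s → ∀ x,
      ‖Kker a χ s x‖ ≤ C * (1 + s + supportFn a x) ^ (-(((d : ℝ) - 1) / 2)) *
        (1 + |supportFn a x - s|)⁻¹ ^ N := by
    intro χ hχ N
    obtain ⟨C, hC, h⟩ := ha.exists_norm_Kker_le hc hd hχ N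
    refine ⟨C, hC, fun s hs x => ?_⟩
    have h0 := ha.supportFn_nonneg hd0 x
    have := h s hs x
    rwa [sqrt_inv_pow_eq (by omega) (by positivity), ← add_assoc] at this
  exact {
    contK := ha.continuous_Kker hd0 hχ
    contG := ha.continuous_Kker hd0 hχ.sq
    cont := ha.continuous_supportFn hd0
    lip := ha.exists_supportFn_sub_le hd0
    coercive := ha.exists_supportFn_ge hd0
    shell := ha.exists_volume_shell_le hd0
    boundK := key hχ
    boundG := key hχ.sq
    gram := ha.integral_Kker_mul_conj hd0 hχ }

namespace IsKernelPair

variable {d : ℕ} {ρ : Rd d → ℝ} {K G : ℝ → Rd d → ℂ}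

lemma nonneg (h : IsKernelPair ρ K G) (x : Rd d) : 0 ≤ ρ x := by
  obtain ⟨c, hc, H⟩ := h.coercive
  exact le_trans (by positivity) (H x)

lemma exists_lintegral_decay_le (h : IsKernelPair ρ K G) (hd : 1 ≤ d) :
    ∃ C, 0 ≤ C ∧ ∀ s, ∫⁻ x, ENNReal.ofReal ((1 + |ρ x - s|)⁻¹ ^ (d + 1)) ≤
      ENNReal.ofReal (C * (1 + |s|) ^ (d - 1)) := by
  obtain ⟨C, hC, hs⟩ := h.shell
  have hm := h.cont.measurable
  refine ⟨C * 2 ^ (d + 1), by positivity, fun s => ?_⟩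
  set S : ℕ → Set (Rd d) := fun j => {x | |ρ x - s| ≤ 2 ^ (j + 1)}
  have hS : ∀ j, MeasurableSet (S j) := fun j =>
    measurableSet_le (by fun_prop) measurable_const
  have hpt : ∀ x, ENNReal.ofReal ((1 + |ρ x - s|)⁻¹ ^ (d + 1)) ≤
      ∑' j : ℕ, (S j).indicator (fun _ => ENNReal.ofReal ((2 ^ j)⁻¹ ^ (d + 1))) x := by
    intro x
    obtain ⟨j, hj1, hj2⟩ := exists_nat_pow_near (x := 1 + |ρ x - s|) (y := 2)
      (by linarith [abs_nonneg (ρ x - s)]) (by norm_num)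
    refine le_trans ?_ (ENNReal.le_tsum j)
    rw [indicator_of_mem (show x ∈ S j from (by linarith : |ρ x - s| ≤ 2 ^ (j + 1)))]
    gcongr
  calc _ ≤ ∫⁻ x, ∑' j : ℕ, (S j).indicator (fun _ => ENNReal.ofReal ((2 ^ j)⁻¹ ^ (d + 1))) x :=
        lintegral_mono hpt
    _ = ∑' j : ℕ, ENNReal.ofReal ((2 ^ j)⁻¹ ^ (d + 1)) * volume (S j) := by
        rw [lintegral_tsum fun j => (measurable_const.indicator (hS j)).aemeasurable]
        simp_rw [lintegral_indicator_const (hS _)]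
    _ ≤ ∑' j : ℕ, ENNReal.ofReal (C * 2 ^ d * (1 + |s|) ^ (d - 1) * (1 / 2) ^ j) := by
        refine ENNReal.tsum_le_tsum fun j => ?_
        refine (mul_le_mul_right (hs s (2 ^ (j + 1)) (by positivity)) _).trans ?_
        rw [← ENNReal.ofReal_mul (by positivity)]
        refine ENNReal.ofReal_le_ofReal ?_
        have h1 : |s| + 2 ^ (j + 1) ≤ 2 ^ (j + 1) * (1 + |s|) := by
          have : (1 : ℝ) ≤ 2 ^ (j + 1) := one_le_pow₀ (by norm_num)
          nlinarith [abs_nonneg s]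
        calc _ ≤ ((2 : ℝ) ^ j)⁻¹ ^ (d + 1) *
              (C * (2 ^ (j + 1) * (2 ^ (j + 1) * (1 + |s|)) ^ (d - 1))) := by gcongr
          _ = _ := by
            obtain ⟨k, rfl⟩ : ∃ k, d = k + 1 := ⟨d - 1, by omega⟩
            rw [Nat.add_sub_cancel, one_div, inv_pow _ j, pow_succ 2 j]
            have : (2 : ℝ) ^ j ≠ 0 := by positivity
            generalize (2 : ℝ) ^ j = w at *
            simp only [mul_pow, inv_pow]
            field_simp
            ring
    _ = ENNReal.ofReal (C * 2 ^ (d + 1) * (1 + |s|) ^ (d - 1)) := by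
        rw [← ENNReal.ofReal_tsum_of_nonneg (fun j => by positivity)
          (summable_geometric_two.mul_left _), tsum_mul_left, tsum_geometric_two]
        congr 1
        ring

lemma exists_lintegral_tail_le (h : IsKernelPair ρ K G) (hd : 1 ≤ d) {k : ℝ → Rd d → ℂ}
    (hk : ∀ N : ℕ, ∃ C, 0 ≤ C ∧ ∀ s, 0 ≤ s → ∀ x,
      ‖k s x‖ ≤ C * (1 + s + ρ x) ^ (-(((d : ℝ) - 1) / 2)) * (1 + |ρ x - s|)⁻¹ ^ N) (M : ℕ) :
    ∃ C, 0 ≤ C ∧ ∀ s, 0 ≤ s → ∀ W, 0 ≤ W → ∫⁻ x in {x | W ≤ |ρ x - s|}, ‖k s x‖ₑ ≤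
      ENNReal.ofReal (C * (1 + s) ^ (((d : ℝ) - 1) / 2) * (1 + W)⁻¹ ^ M) := by
  obtain ⟨C₁, hC₁, h1⟩ := hk (d + 1 + M)
  obtain ⟨C₂, hC₂, h2⟩ := h.exists_lintegral_decay_le hd
  have hm := h.cont.measurable
  have hα : 0 ≤ ((d : ℝ) - 1) / 2 := by
    have : (1 : ℝ) ≤ d := by exact_mod_cast hd
    linarith
  refine ⟨C₁ * C₂, by positivity, fun s hs W hW => ?_⟩
  set α := ((d : ℝ) - 1) / 2 with hαd
  have hS : MeasurableSet {x : Rd d | W ≤ |ρ x - s|} :=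
    measurableSet_le measurable_const (by fun_prop)
  calc _ ≤ ∫⁻ x in {x | W ≤ |ρ x - s|}, ENNReal.ofReal (C₁ * (1 + s) ^ (-α) * (1 + W)⁻¹ ^ M) *
        ENNReal.ofReal ((1 + |ρ x - s|)⁻¹ ^ (d + 1)) := by
        refine setLIntegral_mono' hS fun x hx => ?_
        rw [← ofReal_norm, ← ENNReal.ofReal_mul (by positivity)]
        refine ENNReal.ofReal_le_ofReal ((h1 s hs x).trans ?_)
        have hρ := h.nonneg x
        have e1 : (1 + s + ρ x) ^ (-α) ≤ (1 + s) ^ (-α) :=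
          Real.rpow_le_rpow_of_nonpos (by positivity) (by linarith) (by linarith)
        have e2 : (1 + |ρ x - s|)⁻¹ ≤ (1 + W)⁻¹ := by
          gcongr
          exact hx
        calc _ = C₁ * (1 + s + ρ x) ^ (-α) * (1 + |ρ x - s|)⁻¹ ^ M * (1 + |ρ x - s|)⁻¹ ^ (d + 1) := by
              rw [pow_add]; ring
          _ ≤ _ := by gcongr
    _ ≤ ∫⁻ x, ENNReal.ofReal (C₁ * (1 + s) ^ (-α) * (1 + W)⁻¹ ^ M) *
        ENNReal.ofReal ((1 + |ρ x - s|)⁻¹ ^ (d + 1)) := setLIntegral_le_lintegral _ _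
    _ ≤ ENNReal.ofReal (C₁ * (1 + s) ^ (-α) * (1 + W)⁻¹ ^ M) *
        ENNReal.ofReal (C₂ * (1 + |s|) ^ (d - 1)) := by
        rw [lintegral_const_mul _ (by fun_prop)]
        gcongr
        exact h2 s
    _ = _ := by
        rw [← ENNReal.ofReal_mul (by positivity), abs_of_nonneg hs]
        congr 1
        have : (1 + s) ^ (-α) * (1 + s) ^ (d - 1) = (1 + s) ^ α := by
          rw [← Real.rpow_natCast, ← Real.rpow_add (by positivity), Nat.cast_sub hd]
          congr 1
          push_cast
          linarith
        rw [← this]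
        ring

lemma exists_lintegral_enorm_le (h : IsKernelPair ρ K G) (hd : 1 ≤ d) :
    ∃ C, 0 ≤ C ∧ ∀ s, 0 ≤ s → ∫⁻ x, ‖K s x‖ₑ ≤
      ENNReal.ofReal (C * (1 + s) ^ (((d : ℝ) - 1) / 2)) := by
  obtain ⟨C, hC, H⟩ := h.exists_lintegral_tail_le hd h.boundK 0
  refine ⟨C, hC, fun s hs => ?_⟩
  simpa using H s hs 0 le_rfl

lemma exists_lintegral_gram_le (h : IsKernelPair ρ K G) (hd : 1 ≤ d) :
    ∃ C, 0 ≤ C ∧ ∫⁻ x, ‖G 0 x‖ₑ ≤ ENNReal.ofReal C := by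
  obtain ⟨C, hC, H⟩ := h.exists_lintegral_tail_le hd h.boundG 0
  refine ⟨C, hC, ?_⟩
  simpa using H 0 le_rfl 0 le_rfl

end IsKernelPair

end

section

open Filter Topology

/-- Minkowski's integral inequality for the inner product of two superpositions. -/
lemma enorm_integral_mul_conj_le {X Q : Type*} [MeasurableSpace X] [MeasurableSpace Q]
    {μ : Measure X} {ν : Measure Q} [SFinite μ] [SFinite ν] {P P' : X → Q → ℂ}
    (hP : StronglyMeasurable fun z : X × Q => P z.1 z.2)
    (hP' : StronglyMeasurable fun z : X × Q => P' z.1 z.2) {c : ℝ≥0∞} (hc : c ≠ ∞)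
    (h1 : ∀ x, ∫⁻ q, ‖P x q‖ₑ ∂ν ≤ c) (h2 : ∫⁻ x, ∫⁻ q, ‖P' x q‖ₑ ∂ν ∂μ ≠ ∞) :
    Integrable (fun x => (∫ q, P x q ∂ν) * (starRingEnd ℂ) (∫ q, P' x q ∂ν)) μ ∧
    ‖∫ x, (∫ q, P x q ∂ν) * (starRingEnd ℂ) (∫ q, P' x q ∂ν) ∂μ‖ₑ ≤
      ∫⁻ q, ∫⁻ q', ‖∫ x, P x q * (starRingEnd ℂ) (P' x q') ∂μ‖ₑ ∂ν ∂ν := by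
  set H : X × (Q × Q) → ℂ := fun z => P z.1 z.2.1 * (starRingEnd ℂ) (P' z.1 z.2.2) with hH
  have hHm : StronglyMeasurable H := by
    have e1 : StronglyMeasurable fun z : X × (Q × Q) => P z.1 z.2.1 :=
      hP.comp_measurable (g := fun z : X × (Q × Q) => (z.1, z.2.1)) (by fun_prop)
    have e2 : StronglyMeasurable fun z : X × (Q × Q) => P' z.1 z.2.2 :=
      hP'.comp_measurable (g := fun z : X × (Q × Q) => (z.1, z.2.2)) (by fun_prop)
    exact e1.mul (RCLike.continuous_conj.comp_stronglyMeasurable e2)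
  have hHi : Integrable H (μ.prod (ν.prod ν)) := by
    refine ⟨hHm.aestronglyMeasurable, ?_⟩
    rw [HasFiniteIntegral, lintegral_prod _ hHm.enorm.aemeasurable]
    have : ∀ x, ∫⁻ q, ‖H (x, q)‖ₑ ∂(ν.prod ν) ≤ c * ∫⁻ q, ‖P' x q‖ₑ ∂ν := by
      intro x
      have e1 : Measurable fun q => ‖P x q‖ₑ :=
        (hP.comp_measurable (g := fun q => (x, q)) (by fun_prop)).enorm
      have e2 : Measurable fun q => ‖P' x q‖ₑ :=
        (hP'.comp_measurable (g := fun q => (x, q)) (by fun_prop)).enorm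
      simp only [hH, enorm_mul, RCLike.enorm_conj]
      rw [lintegral_prod_mul e1.aemeasurable e2.aemeasurable]
      gcongr
      exact h1 x
    refine (lintegral_mono this).trans_lt ?_
    rw [lintegral_const_mul _ hP'.enorm.lintegral_prod_right']
    exact ENNReal.mul_lt_top hc.lt_top h2.lt_top
  have hx : ∀ x, ∫ q, H (x, q) ∂(ν.prod ν) =
      (∫ q, P x q ∂ν) * (starRingEnd ℂ) (∫ q, P' x q ∂ν) := fun x => by
    simp only [hH]
    rw [integral_prod_mul (P x) (fun q => (starRingEnd ℂ) (P' x q)), integral_conj]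
  simp only [← hx]
  refine ⟨hHi.integral_prod_left, ?_⟩
  rw [integral_integral_swap (f := fun x q => H (x, q)) hHi]
  refine (enorm_integral_le_lintegral_enorm _).trans ?_
  rw [lintegral_prod _ hHi.integral_prod_right.aestronglyMeasurable.enorm]

lemma lintegral_enorm_sq_eq {X : Type*} [MeasurableSpace X] {μ : Measure X} {u : X → ℂ}
    (hi : Integrable (fun x => u x * (starRingEnd ℂ) (u x)) μ) :
    ∫⁻ x, ‖u x‖ₑ ^ 2 ∂μ = ‖∫ x, u x * (starRingEnd ℂ) (u x) ∂μ‖ₑ := by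
  have e1 : ∀ x, u x * (starRingEnd ℂ) (u x) = ((‖u x‖ ^ 2 : ℝ) : ℂ) := fun x => by
    rw [Complex.mul_conj, Complex.normSq_eq_norm_sq]
  simp only [e1] at hi ⊢
  have hi' : Integrable (fun x => ‖u x‖ ^ 2) μ := hi.re
  rw [integral_complex_ofReal, ← ofReal_norm (_ : ℂ), Complex.norm_real,
    Real.norm_of_nonneg (integral_nonneg fun x => by positivity),
    ofReal_integral_eq_lintegral_ofReal hi' (Eventually.of_forall fun x => by positivity)]
  refine lintegral_congr fun x => ?_
  rw [ENNReal.ofReal_pow (norm_nonneg _), ofReal_norm]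

/-- Bounded measurable functions with bounded support in the half space `r ≥ 0`. -/
structure IsNice {d : ℕ} (F : ℝ × Rd d → ℂ) : Prop where
  meas : Measurable F
  bdd : ∃ M : ℝ, ∀ e, ‖F e‖ ≤ M
  supp : ∃ B : ℝ, ∀ e, F e ≠ 0 → 0 ≤ e.1 ∧ e.1 ≤ B ∧ ‖e.2‖ ≤ B

namespace IsNice

variable {d : ℕ} {F F' : ℝ × Rd d → ℂ}

lemma indicator (hF : IsNice F) {S : Set (ℝ × Rd d)} (hS : MeasurableSet S) :
    IsNice (S.indicator F) where
  meas := hF.meas.indicator hS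
  bdd := by
    obtain ⟨M, hM⟩ := hF.bdd
    exact ⟨M, fun e => (norm_indicator_le_norm_self F e).trans (hM e)⟩
  supp := by
    obtain ⟨B, hB⟩ := hF.supp
    refine ⟨B, fun e he => hB e fun h => he ?_⟩
    rw [Set.indicator_apply, h, ite_self]

lemma const_mul (hF : IsNice F) (c : ℂ) : IsNice fun e => c * F e where
  meas := hF.meas.const_mul c
  bdd := by
    obtain ⟨M, hM⟩ := hF.bdd
    exact ⟨‖c‖ * M, fun e => by rw [norm_mul]; gcongr; exact hM e⟩
  supp := by
    obtain ⟨B, hB⟩ := hF.supp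
    exact ⟨B, fun e he => hB e fun h => he (by simp [h])⟩

/-- A nice function is dominated by a multiple of the indicator of a bounded set. -/
lemma exists_enorm_le (hF : IsNice F) : ∃ M B : ℝ, 0 ≤ M ∧ 0 ≤ B ∧ ∀ e, ‖F e‖ₑ ≤
    (Icc 0 B ×ˢ Metric.closedBall 0 B).indicator (fun _ => ENNReal.ofReal M) e := by
  obtain ⟨M, hM⟩ := hF.bdd
  obtain ⟨B, hB⟩ := hF.supp
  refine ⟨max M 0, max B 0, le_max_right _ _, le_max_right _ _, fun e => ?_⟩
  by_cases he : F e = 0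
  · simp [he]
  · obtain ⟨h1, h2, h3⟩ := hB e he
    rw [indicator_of_mem, ← ofReal_norm]
    · exact ENNReal.ofReal_le_ofReal ((hM e).trans (le_max_left _ _))
    · exact ⟨⟨h1, h2.trans (le_max_left _ _)⟩, mem_closedBall_zero_iff.2 (h3.trans (le_max_left _ _))⟩

lemma lintegral_lt_top (hF : IsNice F) : ∫⁻ e, ‖F e‖ₑ < ∞ := by
  obtain ⟨M, B, hM, hB, h⟩ := hF.exists_enorm_le
  refine (lintegral_mono h).trans_lt ?_
  rw [lintegral_indicator_const (measurableSet_Icc.prod measurableSet_closedBall),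
    Measure.volume_eq_prod, Measure.prod_prod]
  exact ENNReal.mul_lt_top ENNReal.ofReal_lt_top
    (ENNReal.mul_lt_top (by simp) measure_closedBall_lt_top)

lemma lintegral_slice_lt_top (hF : IsNice F) (r : ℝ) : ∫⁻ y, ‖F (r, y)‖ₑ < ∞ := by
  obtain ⟨M, B, hM, hB, h⟩ := hF.exists_enorm_le
  have : ∀ y, ‖F (r, y)‖ₑ ≤ (Metric.closedBall 0 B).indicator (fun _ => ENNReal.ofReal M) y := by
    intro y
    refine (h (r, y)).trans ?_
    by_cases hy : y ∈ Metric.closedBall (0 : Rd d) B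
    · rw [indicator_of_mem hy]
      exact indicator_le_self _ _ _
    · rw [indicator_of_notMem fun h => hy h.2]
      exact zero_le
  refine (lintegral_mono this).trans_lt ?_
  rw [lintegral_indicator_const measurableSet_closedBall]
  exact ENNReal.mul_lt_top ENNReal.ofReal_lt_top measure_closedBall_lt_top

end IsNice

/-- The superposition `∫ K_r * F(r, ·) dr`. -/
def superpose {d : ℕ} (K : ℝ → Rd d → ℂ) (F : ℝ × Rd d → ℂ) (x : Rd d) : ℂ :=
  ∫ r, conv (K r) (fun y => F (r, y)) x

namespace IsKernelPair

variable {d : ℕ} {ρ : Rd d → ℝ} {K G : ℝ → Rd d → ℂ} {F F' : ℝ × Rd d → ℂ}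

lemma exists_norm_le (h : IsKernelPair ρ K G) (hd : 1 ≤ d) :
    ∃ C, 0 ≤ C ∧ ∀ s, 0 ≤ s → ∀ x, ‖K s x‖ ≤ C := by
  obtain ⟨C, hC, H⟩ := h.boundK 0
  have hα : 0 ≤ ((d : ℝ) - 1) / 2 := by
    have : (1 : ℝ) ≤ d := by exact_mod_cast hd
    linarith
  refine ⟨C, hC, fun s hs x => (H s hs x).trans ?_⟩
  have h0 := h.nonneg x
  have : (1 + s + ρ x) ^ (-(((d : ℝ) - 1) / 2)) ≤ 1 :=
    Real.rpow_le_one_of_one_le_of_nonpos (by linarith) (by linarith)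
  rw [pow_zero, mul_one]
  exact mul_le_of_le_one_right hC this

lemma stronglyMeasurable_mul (h : IsKernelPair ρ K G) (hF : IsNice F) :
    StronglyMeasurable fun z : Rd d × (ℝ × Rd d) => K z.2.1 (z.1 - z.2.2) * F z.2 := by
  have e1 : StronglyMeasurable fun z : Rd d × (ℝ × Rd d) => K z.2.1 (z.1 - z.2.2) :=
    (h.contK.comp (f := fun z : Rd d × (ℝ × Rd d) => (z.2.1, z.1 - z.2.2))
      (by fun_prop)).stronglyMeasurable
  exact e1.mul (hF.meas.comp measurable_snd).stronglyMeasurable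

lemma stronglyMeasurable_slice (h : IsKernelPair ρ K G) (hF : IsNice F) (r : ℝ) :
    StronglyMeasurable fun z : Rd d × Rd d => K r (z.1 - z.2) * F (r, z.2) :=
  (h.stronglyMeasurable_mul hF).comp_measurable
    (g := fun z : Rd d × Rd d => (z.1, (r, z.2))) (by fun_prop)

lemma exists_enorm_mul_le (h : IsKernelPair ρ K G) (hd : 1 ≤ d) (hF : IsNice F) :
    ∃ c : ℝ≥0∞, c ≠ ∞ ∧ ∀ (x : Rd d) e, ‖K e.1 (x - e.2) * F e‖ₑ ≤ c * ‖F e‖ₑ := by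
  obtain ⟨C, hC, H⟩ := h.exists_norm_le hd
  obtain ⟨B, hB⟩ := hF.supp
  refine ⟨ENNReal.ofReal C, ENNReal.ofReal_ne_top, fun x e => ?_⟩
  by_cases he : F e = 0
  · simp [he]
  · rw [enorm_mul, ← ofReal_norm (K _ _)]
    gcongr
    exact H _ (hB e he).1 _

lemma exists_lintegral_mul_le (h : IsKernelPair ρ K G) (hd : 1 ≤ d) (hF : IsNice F) :
    ∃ c : ℝ≥0∞, c ≠ ∞ ∧ ∀ x : Rd d, ∫⁻ e, ‖K e.1 (x - e.2) * F e‖ₑ ≤ c := by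
  obtain ⟨c, hc, H⟩ := h.exists_enorm_mul_le hd hF
  refine ⟨c * ∫⁻ e, ‖F e‖ₑ, ENNReal.mul_ne_top hc hF.lintegral_lt_top.ne, fun x => ?_⟩
  rw [← lintegral_const_mul _ hF.meas.enorm]
  exact lintegral_mono (H x)

lemma exists_lintegral_slice_le (h : IsKernelPair ρ K G) (hd : 1 ≤ d) (hF : IsNice F) (r : ℝ) :
    ∃ c : ℝ≥0∞, c ≠ ∞ ∧ ∀ x : Rd d, ∫⁻ y, ‖K r (x - y) * F (r, y)‖ₑ ≤ c := by
  obtain ⟨c, hc, H⟩ := h.exists_enorm_mul_le hd hF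
  refine ⟨c * ∫⁻ y, ‖F (r, y)‖ₑ, ENNReal.mul_ne_top hc (hF.lintegral_slice_lt_top r).ne,
    fun x => ?_⟩
  rw [← lintegral_const_mul' _ _ hc]
  exact lintegral_mono fun y => H x (r, y)

lemma exists_lintegral_translate_le (h : IsKernelPair ρ K G) (hd : 1 ≤ d) (hF : IsNice F) :
    ∃ c : ℝ≥0∞, c ≠ ∞ ∧ ∀ e, ∫⁻ x, ‖K e.1 (x - e.2) * F e‖ₑ ≤ c * ‖F e‖ₑ := by
  obtain ⟨C, hC, H⟩ := h.exists_lintegral_enorm_le hd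
  obtain ⟨B, hB⟩ := hF.supp
  have hα : 0 ≤ ((d : ℝ) - 1) / 2 := by
    have : (1 : ℝ) ≤ d := by exact_mod_cast hd
    linarith
  refine ⟨ENNReal.ofReal (C * (1 + B) ^ (((d : ℝ) - 1) / 2)), ENNReal.ofReal_ne_top, fun e => ?_⟩
  by_cases he : F e = 0
  · simp [he]
  · obtain ⟨h1, h2, -⟩ := hB e he
    simp only [enorm_mul]
    rw [lintegral_mul_const' _ _ enorm_ne_top,
      lintegral_sub_right_eq_self (fun x => ‖K e.1 x‖ₑ) e.2]
    gcongr
    refine (H _ h1).trans (ENNReal.ofReal_le_ofReal ?_)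
    gcongr

lemma lintegral_lintegral_mul_ne_top (h : IsKernelPair ρ K G) (hd : 1 ≤ d) (hF : IsNice F) :
    ∫⁻ x : Rd d, ∫⁻ e, ‖K e.1 (x - e.2) * F e‖ₑ ≠ ∞ := by
  obtain ⟨c, hc, H⟩ := h.exists_lintegral_translate_le hd hF
  rw [lintegral_lintegral_swap (h.stronglyMeasurable_mul hF).enorm.aemeasurable]
  refine ((lintegral_mono H).trans_lt ?_).ne
  rw [lintegral_const_mul _ hF.meas.enorm]
  exact ENNReal.mul_lt_top hc.lt_top hF.lintegral_lt_top

lemma lintegral_lintegral_slice_ne_top (h : IsKernelPair ρ K G) (hd : 1 ≤ d) (hF : IsNice F)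
    (r : ℝ) : ∫⁻ x : Rd d, ∫⁻ y, ‖K r (x - y) * F (r, y)‖ₑ ≠ ∞ := by
  obtain ⟨c, hc, H⟩ := h.exists_lintegral_translate_le hd hF
  rw [lintegral_lintegral_swap (h.stronglyMeasurable_slice hF r).enorm.aemeasurable]
  refine ((lintegral_mono fun y => H (r, y)).trans_lt ?_).ne
  rw [lintegral_const_mul' _ _ hc]
  exact ENNReal.mul_lt_top hc.lt_top (hF.lintegral_slice_lt_top r)

lemma integrable_mul (h : IsKernelPair ρ K G) (hd : 1 ≤ d) (hF : IsNice F) (x : Rd d) :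
    Integrable fun e : ℝ × Rd d => K e.1 (x - e.2) * F e := by
  obtain ⟨c, hc, H⟩ := h.exists_lintegral_mul_le hd hF
  exact ⟨((h.stronglyMeasurable_mul hF).comp_measurable
    (g := fun e => (x, e)) (by fun_prop)).aestronglyMeasurable, (H x).trans_lt hc.lt_top⟩

lemma superpose_eq (h : IsKernelPair ρ K G) (hd : 1 ≤ d) (hF : IsNice F) (x : Rd d) :
    superpose K F x = ∫ e : ℝ × Rd d, K e.1 (x - e.2) * F e := by
  rw [Measure.volume_eq_prod, integral_prod _ (h.integrable_mul hd hF x)]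
  rfl

lemma measurable_superpose (h : IsKernelPair ρ K G) (hd : 1 ≤ d) (hF : IsNice F) :
    Measurable (superpose K F) := by
  rw [show superpose K F = fun x => ∫ e : ℝ × Rd d, K e.1 (x - e.2) * F e from
    funext (h.superpose_eq hd hF)]
  exact (h.stronglyMeasurable_mul hF).integral_prod_right.measurable

lemma superpose_add (h : IsKernelPair ρ K G) (hd : 1 ≤ d) (hF : IsNice F) (hF' : IsNice F')
    (hFF : IsNice fun e => F e + F' e) (x : Rd d) :
    superpose K (fun e => F e + F' e) x = superpose K F x + superpose K F' x := by
  rw [h.superpose_eq hd hF, h.superpose_eq hd hF', h.superpose_eq hd hFF,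
    ← integral_add (h.integrable_mul hd hF x) (h.integrable_mul hd hF' x)]
  simp only [mul_add]

lemma enorm_superpose_le (h : IsKernelPair ρ K G) (hd : 1 ≤ d) (hF : IsNice F) (x : Rd d) :
    ‖superpose K F x‖ₑ ≤ ∫⁻ e : ℝ × Rd d, ‖F e‖ₑ * ‖K e.1 (x - e.2)‖ₑ := by
  rw [h.superpose_eq hd hF]
  refine (enorm_integral_le_lintegral_enorm _).trans (lintegral_mono fun e => ?_)
  rw [enorm_mul, mul_comm]

lemma setLIntegral_superpose_le (h : IsKernelPair ρ K G) (hd : 1 ≤ d) (hF : IsNice F)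
    (S : Set (Rd d)) : ∫⁻ x in S, ‖superpose K F x‖ₑ ≤
      ∫⁻ e : ℝ × Rd d, ‖F e‖ₑ * ∫⁻ x in S, ‖K e.1 (x - e.2)‖ₑ := by
  have hm : Measurable fun z : Rd d × (ℝ × Rd d) => ‖F z.2‖ₑ * ‖K z.2.1 (z.1 - z.2.2)‖ₑ := by
    have e1 : Measurable fun z : Rd d × (ℝ × Rd d) => K z.2.1 (z.1 - z.2.2) :=
      (h.contK.comp (f := fun z : Rd d × (ℝ × Rd d) => (z.2.1, z.1 - z.2.2))
        (by fun_prop)).measurable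
    exact (hF.meas.comp measurable_snd).enorm.mul e1.enorm
  refine (lintegral_mono fun x => h.enorm_superpose_le hd hF x).trans ?_
  rw [lintegral_lintegral_swap hm.aemeasurable]
  refine lintegral_mono fun e => ?_
  rw [lintegral_const_mul' _ _ enorm_ne_top]

/-- `L²` norms of superpositions in terms of interactions of slices. -/
lemma lintegral_superpose_sq_le (h : IsKernelPair ρ K G) (hd : 1 ≤ d) (hF : IsNice F) :
    ∫⁻ x, ‖superpose K F x‖ₑ ^ 2 ≤ ∫⁻ r, ∫⁻ r',
      ‖∫ x, conv (K r) (fun y => F (r, y)) x *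
        (starRingEnd ℂ) (conv (K r') (fun y => F (r', y)) x)‖ₑ := by
  obtain ⟨c, hc, H⟩ := h.exists_lintegral_mul_le hd hF
  set P : Rd d → ℝ → ℂ := fun x r => conv (K r) (fun y => F (r, y)) x with hP
  have hPm : StronglyMeasurable fun z : Rd d × ℝ => P z.1 z.2 := by
    have : StronglyMeasurable fun z : (Rd d × ℝ) × Rd d => K z.1.2 (z.1.1 - z.2) * F (z.1.2, z.2) :=
      (h.stronglyMeasurable_mul hF).comp_measurable
        (g := fun z : (Rd d × ℝ) × Rd d => (z.1.1, (z.1.2, z.2))) (by fun_prop)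
    exact this.integral_prod_right
  have hPle : ∀ x, ∫⁻ r, ‖P x r‖ₑ ≤ ∫⁻ e : ℝ × Rd d, ‖K e.1 (x - e.2) * F e‖ₑ := by
    intro x
    have hm : Measurable fun e : ℝ × Rd d => ‖K e.1 (x - e.2) * F e‖ₑ :=
      ((h.stronglyMeasurable_mul hF).comp_measurable (g := fun e => (x, e)) (by fun_prop)).enorm
    rw [Measure.volume_eq_prod, lintegral_prod _ hm.aemeasurable]
    exact lintegral_mono fun r => enorm_integral_le_lintegral_enorm _
  obtain ⟨hi, hle⟩ := enorm_integral_mul_conj_le (μ := volume) (ν := volume) hPm hPm hc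
    (fun x => (hPle x).trans (H x)) (ne_top_of_le_ne_top
      (h.lintegral_lintegral_mul_ne_top hd hF) (lintegral_mono hPle))
  exact (lintegral_enorm_sq_eq hi).le.trans hle

/-- Interaction of two slices in terms of the Gram kernel. -/
lemma enorm_integral_conv_mul_conj_le (h : IsKernelPair ρ K G) (hd : 1 ≤ d) (hF : IsNice F)
    (r r' : ℝ) :
    ‖∫ x, conv (K r) (fun y => F (r, y)) x *
        (starRingEnd ℂ) (conv (K r') (fun y => F (r', y)) x)‖ₑ ≤
      ∫⁻ y, ∫⁻ y', ‖F (r, y)‖ₑ * ‖F (r', y')‖ₑ * ‖G (r - r') (y' - y)‖ₑ := by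
  obtain ⟨c, hc, H⟩ := h.exists_lintegral_slice_le hd hF r
  refine (enorm_integral_mul_conj_le (μ := volume) (ν := volume) (h.stronglyMeasurable_slice hF r)
    (h.stronglyMeasurable_slice hF r') hc H (h.lintegral_lintegral_slice_ne_top hd hF r')).2.trans ?_
  refine (lintegral_mono fun y => lintegral_mono fun y' => le_of_eq ?_)
  simp only [map_mul, mul_mul_mul_comm (K r _)]
  rw [integral_mul_const, h.gram, enorm_mul, enorm_mul, RCLike.enorm_conj, mul_comm]

/-- `L²` boundedness of a single slice. -/
lemma exists_lintegral_conv_sq_le (h : IsKernelPair ρ K G) (hd : 1 ≤ d) :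
    ∃ C, 0 ≤ C ∧ ∀ F : ℝ × Rd d → ℂ, IsNice F → ∀ r,
      ∫⁻ x, ‖conv (K r) (fun y => F (r, y)) x‖ₑ ^ 2 ≤
        ENNReal.ofReal C * ∫⁻ y, ‖F (r, y)‖ₑ ^ 2 := by
  obtain ⟨C, hC, HC⟩ := h.exists_lintegral_gram_le hd
  refine ⟨2 * C, by positivity, fun F hF r => ?_⟩
  have hFm : Measurable fun y => ‖F (r, y)‖ₑ := hF.meas.enorm.comp measurable_prodMk_left
  have hGm : Measurable fun z : Rd d × Rd d => ‖G 0 (z.2 - z.1)‖ₑ :=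
    (h.contG.comp (f := fun z : Rd d × Rd d => (0, z.2 - z.1)) (by fun_prop)).measurable.enorm
  obtain ⟨c, hc, H⟩ := h.exists_lintegral_slice_le hd hF r
  have hi := (enorm_integral_mul_conj_le (μ := volume) (ν := volume)
    (h.stronglyMeasurable_slice hF r) (h.stronglyMeasurable_slice hF r) hc H
    (h.lintegral_lintegral_slice_ne_top hd hF r)).1
  refine (lintegral_enorm_sq_eq hi).le.trans ((h.enorm_integral_conv_mul_conj_le hd hF r r).trans ?_)
  have hpt : ∀ y y', ‖F (r, y)‖ₑ * ‖F (r, y')‖ₑ * ‖G (r - r) (y' - y)‖ₑ ≤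
      ‖F (r, y)‖ₑ ^ 2 * ‖G 0 (y' - y)‖ₑ + ‖F (r, y')‖ₑ ^ 2 * ‖G 0 (y' - y)‖ₑ := by
    intro y y'
    rw [sub_self, ← add_mul]
    gcongr
    rcases le_total ‖F (r, y)‖ₑ ‖F (r, y')‖ₑ with h | h
    · exact (mul_le_mul_left h _).trans ((sq _).ge.trans le_add_self)
    · exact (mul_le_mul_right h _).trans ((sq _).ge.trans le_self_add)
  have hm1 : Measurable fun z : Rd d × Rd d => ‖F (r, z.1)‖ₑ ^ 2 * ‖G 0 (z.2 - z.1)‖ₑ :=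
    ((hFm.comp measurable_fst).pow_const 2).mul hGm
  have hm2 : Measurable fun z : Rd d × Rd d => ‖F (r, z.2)‖ₑ ^ 2 * ‖G 0 (z.2 - z.1)‖ₑ :=
    ((hFm.comp measurable_snd).pow_const 2).mul hGm
  calc _ ≤ ∫⁻ y, ∫⁻ y', (‖F (r, y)‖ₑ ^ 2 * ‖G 0 (y' - y)‖ₑ + ‖F (r, y')‖ₑ ^ 2 * ‖G 0 (y' - y)‖ₑ) :=
        lintegral_mono fun y => lintegral_mono fun y' => hpt y y'
    _ = (∫⁻ y, ∫⁻ y', ‖F (r, y)‖ₑ ^ 2 * ‖G 0 (y' - y)‖ₑ) +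
        ∫⁻ y, ∫⁻ y', ‖F (r, y')‖ₑ ^ 2 * ‖G 0 (y' - y)‖ₑ := by
        rw [← lintegral_add_left hm1.lintegral_prod_right']
        refine lintegral_congr fun y => ?_
        exact lintegral_add_left (hm1.comp measurable_prodMk_left) _
    _ ≤ ENNReal.ofReal C * (∫⁻ y, ‖F (r, y)‖ₑ ^ 2) + ENNReal.ofReal C * ∫⁻ y, ‖F (r, y)‖ₑ ^ 2 := by
        gcongr
        · rw [← lintegral_const_mul' _ _ ENNReal.ofReal_ne_top]
          refine lintegral_mono fun y => ?_
          rw [lintegral_const_mul' _ _ (by simp), mul_comm,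
            lintegral_sub_right_eq_self (fun x => ‖G 0 x‖ₑ) y]
          gcongr
        · rw [lintegral_lintegral_swap hm2.aemeasurable,
            ← lintegral_const_mul' _ _ ENNReal.ofReal_ne_top]
          refine lintegral_mono fun y => ?_
          rw [lintegral_const_mul' _ _ (by simp), mul_comm,
            lintegral_sub_left_eq_self (fun x => ‖G 0 x‖ₑ) y]
          gcongr
    _ = _ := by rw [← two_mul, ← mul_assoc, ENNReal.ofReal_mul (by norm_num)]; simp

end IsKernelPair

end

section

open Filter Topology

/-- The density threshold at scale `h`. -/
def threshold (d : ℕ) (A β h : ℝ) : ℝ := A ^ β * h ^ (1 + ((d : ℝ) - 1) / 2 - β)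

lemma threshold_pos (d : ℕ) {A h : ℝ} (hA : 0 < A) (β : ℝ) (hh : 0 < h) :
    0 < threshold d A β h := by
  unfold threshold
  positivity

/-- The weighted measure `(1 + r)^(d-1) dr dy`. -/
def weightedVolume {d : ℕ} (E : Set (ℝ × Rd d)) : ℝ≥0∞ :=
  ∫⁻ e in E, ENNReal.ofReal ((1 + e.1) ^ (d - 1))

/-- The points of `E` near which `E` is too dense at some scale. -/
def densePart {d : ℕ} (A β : ℝ) (E : Set (ℝ × Rd d)) : Set (ℝ × Rd d) :=
  {e | e ∈ E ∧ ∃ l : ℕ, 4 * (2 ^ l * A) ≤ 1 + e.1 ∧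
    ENNReal.ofReal (threshold d A β (2 ^ l * A)) <
      volume (E ∩ Metric.closedBall e (2 ^ l * A))}

/-- The set is not too dense at any admissible scale. -/
def IsSparse {d : ℕ} (A β : ℝ) (E : Set (ℝ × Rd d)) : Prop :=
  ∀ e ∈ E, ∀ l : ℕ, 4 * (2 ^ l * A) ≤ 1 + e.1 →
    volume (E ∩ Metric.closedBall e (2 ^ l * A)) ≤ ENNReal.ofReal (threshold d A β (2 ^ l * A))

lemma IsSparse.mono {d : ℕ} {A β : ℝ} {E E' : Set (ℝ × Rd d)} (h : IsSparse A β E)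
    (hE : E' ⊆ E) : IsSparse A β E' := fun e he l hl =>
  (measure_mono (inter_subset_inter_left _ hE)).trans (h e (hE he) l hl)

lemma isSparse_diff_densePart {d : ℕ} (A β : ℝ) (E : Set (ℝ × Rd d)) :
    IsSparse A β (E \ densePart A β E) := by
  intro e he l hl
  refine (measure_mono (inter_subset_inter_left _ sdiff_subset)).trans ?_
  by_contra hlt
  exact he.2 ⟨he.1, l, hl, not_le.1 hlt⟩

lemma measurable_volume_inter_closedBall {d : ℕ} {E : Set (ℝ × Rd d)} (hE : MeasurableSet E)
    (s : ℝ) : Measurable fun e => volume (E ∩ Metric.closedBall e s) := by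
  have hS : MeasurableSet {q : (ℝ × Rd d) × (ℝ × Rd d) | q.2 ∈ E ∧ dist q.2 q.1 ≤ s} :=
    (measurable_snd hE).inter (s₂ := {q : (ℝ × Rd d) × (ℝ × Rd d) | dist q.2 q.1 ≤ s})
      (measurableSet_le (by fun_prop) measurable_const)
  exact measurable_measure_prodMk_left hS

lemma measurableSet_densePart {d : ℕ} {A β : ℝ} {E : Set (ℝ × Rd d)} (hE : MeasurableSet E) :
    MeasurableSet (densePart A β E) := by
  have : densePart A β E = E ∩ ⋃ l : ℕ, ({e | 4 * (2 ^ l * A) ≤ 1 + e.1} ∩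
      {e | ENNReal.ofReal (threshold d A β (2 ^ l * A)) <
        volume (E ∩ Metric.closedBall e (2 ^ l * A))}) := by
    ext e
    simp [densePart]
  rw [this]
  refine hE.inter (MeasurableSet.iUnion fun l => ?_)
  exact (measurableSet_le measurable_const (by fun_prop)).inter
    (measurableSet_lt measurable_const (measurable_volume_inter_closedBall hE _))

lemma volume_shell_translate {d : ℕ} (ρ : Rd d → ℝ) (y : Rd d) (r W : ℝ) :
    volume {x | |ρ (x - y) - r| ≤ W} = volume {x | |ρ x - r| ≤ W} := by
  have := measure_preimage_add_right (volume : Measure (Rd d)) (-y) {x | |ρ x - r| ≤ W}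
  simpa [sub_eq_add_neg] using this

namespace IsKernelPair

variable {d : ℕ} {ρ : Rd d → ℝ} {K G : ℝ → Rd d → ℂ}

/-- The set of points through which too many spheres centred in `E` pass. -/
lemma exists_exceptional_scale (h : IsKernelPair ρ K G) {L : ℝ} (hL : 0 < L) :
    ∃ C, 0 ≤ C ∧ ∀ E : Set (ℝ × Rd d), MeasurableSet E → (∀ e ∈ E, 0 ≤ e.1) →
      ∀ s t : ℝ, 0 < s → 0 < t →
      volume {x | ENNReal.ofReal t <
        volume {e : ℝ × Rd d | e ∈ E ∧ s ≤ 1 + e.1 ∧ |ρ (x - e.2) - e.1| ≤ L * s}} ≤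
        ENNReal.ofReal (C * s * t⁻¹) * weightedVolume E := by
  obtain ⟨C, hC, hs⟩ := h.shell
  refine ⟨C * (L * (1 + L) ^ (d - 1)), by positivity, fun E hE hE0 s t hs0 ht => ?_⟩
  have hm := h.cont.measurable
  set S : Set (Rd d × (ℝ × Rd d)) := {q | q.2 ∈ E ∧ s ≤ 1 + q.2.1 ∧
    |ρ (q.1 - q.2.2) - q.2.1| ≤ L * s} with hS
  have hSm : MeasurableSet S :=
    (measurable_snd hE).inter (MeasurableSet.inter
      (s₁ := {q : Rd d × (ℝ × Rd d) | s ≤ 1 + q.2.1})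
      (s₂ := {q : Rd d × (ℝ × Rd d) | |ρ (q.1 - q.2.2) - q.2.1| ≤ L * s})
      (measurableSet_le measurable_const (by fun_prop))
      (measurableSet_le (by fun_prop) measurable_const))
  have e1 : ∀ e, volume ((fun x : Rd d => (x, e)) ⁻¹' S) ≤ E.indicator (fun e =>
      ENNReal.ofReal (C * (L * (1 + L) ^ (d - 1)) * s) * ENNReal.ofReal ((1 + e.1) ^ (d - 1))) e := by
    intro e
    by_cases he : e ∈ E ∧ s ≤ 1 + e.1
    · have h0 := hE0 e he.1
      rw [indicator_of_mem he.1, ← ENNReal.ofReal_mul (by positivity)]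
      refine (measure_mono (t := {x | |ρ (x - e.2) - e.1| ≤ L * s}) fun x hx => hx.2.2).trans ?_
      rw [volume_shell_translate]
      refine (hs e.1 (L * s) (by positivity)).trans (ENNReal.ofReal_le_ofReal ?_)
      rw [abs_of_nonneg h0]
      have : e.1 + L * s ≤ (1 + L) * (1 + e.1) := by nlinarith [he.2]
      calc _ ≤ C * (L * s * ((1 + L) * (1 + e.1)) ^ (d - 1)) := by gcongr
        _ = _ := by rw [mul_pow]; ring
    · have : (fun x : Rd d => (x, e)) ⁻¹' S = ∅ :=
        eq_empty_of_forall_notMem fun x hx => he ⟨hx.1, hx.2.1⟩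
      rw [this, measure_empty]
      exact zero_le
  have e2 : ENNReal.ofReal t * volume {x | ENNReal.ofReal t <
        volume {e : ℝ × Rd d | e ∈ E ∧ s ≤ 1 + e.1 ∧ |ρ (x - e.2) - e.1| ≤ L * s}} ≤
      ENNReal.ofReal (C * (L * (1 + L) ^ (d - 1)) * s) * weightedVolume E := by
    calc _ ≤ ENNReal.ofReal t * volume {x | ENNReal.ofReal t ≤ volume (Prod.mk x ⁻¹' S)} := by
          gcongr
          intro hx
          exact le_of_lt hx
      _ ≤ ∫⁻ x, volume (Prod.mk x ⁻¹' S) :=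
          mul_meas_ge_le_lintegral (measurable_measure_prodMk_left hSm) _
      _ = ∫⁻ e, volume ((fun x : Rd d => (x, e)) ⁻¹' S) := by
          rw [← Measure.prod_apply hSm, Measure.prod_apply_symm hSm]
      _ ≤ ∫⁻ e, E.indicator (fun e => ENNReal.ofReal (C * (L * (1 + L) ^ (d - 1)) * s) *
            ENNReal.ofReal ((1 + e.1) ^ (d - 1))) e := lintegral_mono e1
      _ = _ := by
          rw [lintegral_indicator hE, lintegral_const_mul' _ _ ENNReal.ofReal_ne_top]
          rfl
  calc _ = ENNReal.ofReal t⁻¹ * (ENNReal.ofReal t * volume {x | ENNReal.ofReal t <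
        volume {e : ℝ × Rd d | e ∈ E ∧ s ≤ 1 + e.1 ∧ |ρ (x - e.2) - e.1| ≤ L * s}}) := by
        rw [← mul_assoc, ← ENNReal.ofReal_mul (by positivity), inv_mul_cancel₀ ht.ne',
          ENNReal.ofReal_one, one_mul]
    _ ≤ ENNReal.ofReal t⁻¹ * (ENNReal.ofReal (C * (L * (1 + L) ^ (d - 1)) * s) *
        weightedVolume E) := by gcongr
    _ = _ := by
        rw [← mul_assoc, ← ENNReal.ofReal_mul (by positivity)]
        congr 2
        ring

/-- The exceptional set outside which dense points are far from being singular. -/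
lemma exists_exceptional_set (h : IsKernelPair ρ K G) {β : ℝ}
    (hβ : β < ((d : ℝ) - 1) / 2) :
    ∃ C, 0 ≤ C ∧ ∀ A : ℝ, 1 ≤ A → ∀ E : Set (ℝ × Rd d), MeasurableSet E → (∀ e ∈ E, 0 ≤ e.1) →
      ∃ Ω : Set (Rd d), volume Ω ≤ ENNReal.ofReal (C * A ^ (-β)) * weightedVolume E ∧
        ∀ x ∉ Ω, ∀ e ∈ densePart A β E, A ≤ |ρ (x - e.2) - e.1| := by
  obtain ⟨L, hL, hLip⟩ := h.lip
  obtain ⟨C, hC, hΩ⟩ := h.exists_exceptional_scale (L := L + 2) (by positivity)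
  set α := ((d : ℝ) - 1) / 2 with hα
  set q : ℝ := 2 ^ (β - α)
  have hq0 : 0 ≤ q := by positivity
  have hq1 : q < 1 := Real.rpow_lt_one_of_one_lt_of_neg (by norm_num) (by linarith)
  refine ⟨C * (1 - q)⁻¹, mul_nonneg hC (inv_nonneg.2 (by linarith)), fun A hA E hE hE0 => ?_⟩
  set S : ℕ → Rd d → Set (ℝ × Rd d) := fun l x =>
    {e | e ∈ E ∧ 2 ^ l * A ≤ 1 + e.1 ∧ |ρ (x - e.2) - e.1| ≤ (L + 2) * (2 ^ l * A)}
  refine ⟨⋃ l : ℕ, {x | ENNReal.ofReal (threshold d A β (2 ^ l * A)) < volume (S l x)}, ?_, ?_⟩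
  · calc _ ≤ ∑' l : ℕ, volume {x | ENNReal.ofReal (threshold d A β (2 ^ l * A)) < volume (S l x)} :=
          measure_iUnion_le _
      _ ≤ ∑' l : ℕ, ENNReal.ofReal (C * A ^ (-β) * q ^ l) * weightedVolume E := by
          refine ENNReal.tsum_le_tsum fun l => ?_
          have hs : 0 < 2 ^ l * A := by positivity
          refine (hΩ E hE hE0 (2 ^ l * A) _ hs (threshold_pos d (by positivity) β hs)).trans ?_
          refine mul_le_mul_left (ENNReal.ofReal_le_ofReal ?_) _
          rw [mul_assoc C, mul_assoc C]
          refine mul_le_mul_of_nonneg_left ?_ hC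
          calc (2 ^ l * A) * (threshold d A β (2 ^ l * A))⁻¹ = A ^ (-β) * (2 ^ l * A) ^ (β - α) := by
                rw [threshold, mul_inv, ← Real.rpow_neg (by positivity),
                  ← Real.rpow_neg (by positivity), mul_left_comm]
                nth_rw 1 [← Real.rpow_one (2 ^ l * A)]
                rw [← Real.rpow_add hs]
                congr 2
                ring
            _ ≤ A ^ (-β) * (2 ^ l) ^ (β - α) := by
                refine mul_le_mul_of_nonneg_left (Real.rpow_le_rpow_of_nonpos (by positivity)
                  (le_mul_of_one_le_right (by positivity) hA) (sub_nonpos.2 hβ.le)) (by positivity)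
            _ = _ := by
                rw [← Real.rpow_natCast 2 l, ← Real.rpow_natCast q l, ← Real.rpow_mul (by norm_num),
                  ← Real.rpow_mul (by norm_num), mul_comm (l : ℝ)]
      _ = _ := by
          rw [ENNReal.tsum_mul_right, ← ENNReal.ofReal_tsum_of_nonneg (fun l => by positivity)
            ((summable_geometric_of_lt_one hq0 hq1).mul_left _), tsum_mul_left,
            tsum_geometric_of_lt_one hq0 hq1]
          congr 2
          ring
  · intro x hx e he
    obtain ⟨heE, l, hl1, hl2⟩ := he
    by_contra! hlt
    refine hx (mem_iUnion.2 ⟨l, hl2.trans_le (measure_mono fun e' he' => ?_)⟩)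
    have hAs : A ≤ 2 ^ l * A := le_mul_of_one_le_left (zero_le_one.trans hA)
      (one_le_pow₀ (by norm_num))
    have hb : dist e' e ≤ 2 ^ l * A := he'.2
    rw [Prod.dist_eq, max_le_iff, Real.dist_eq, dist_eq_norm, abs_le] at hb
    refine ⟨he'.1, by linarith, ?_⟩
    have h1 := hLip (x - e'.2) (x - e.2)
    rw [show x - e'.2 - (x - e.2) = -(e'.2 - e.2) by abel, norm_neg] at h1
    have h2 : L * ‖e'.2 - e.2‖ ≤ L * (2 ^ l * A) := by gcongr; exact hb.2
    rw [abs_lt] at hlt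
    have h3 := abs_le.1 (h1.trans h2)
    rw [abs_le]
    constructor <;> nlinarith

end IsKernelPair

end

section

open Filter Topology

lemma measurableSet_and {X : Type*} [MeasurableSpace X] {p q : X → Prop}
    (hp : MeasurableSet {x | p x}) (hq : MeasurableSet {x | q x}) :
    MeasurableSet {x | p x ∧ q x} := hp.inter hq

lemma volume_mul_volume_closedBall_le {V : Type*} [NormedAddCommGroup V] [NormedSpace ℝ V]
    [FiniteDimensional ℝ V] [MeasureSpace V] [BorelSpace V] [(volume : Measure V).IsAddHaarMeasure]
    {B S : Set V} (hB : MeasurableSet B) (hS : MeasurableSet S) {s : ℝ} {τ : ℝ≥0∞}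
    (hτ : ∀ x, volume (B ∩ Metric.closedBall x s) ≤ τ)
    (hBS : ∀ x ∈ B, Metric.closedBall x s ⊆ S) :
    volume B * volume (Metric.closedBall (0 : V) s) ≤ τ * volume S := by
  have : ProperSpace V := FiniteDimensional.proper ℝ V
  set P : Set (V × V) := {q | q.1 ∈ B ∧ dist q.1 q.2 ≤ s} with hPdef
  have hP : MeasurableSet P := (measurable_fst hB).inter (s₂ := {q : V × V | dist q.1 q.2 ≤ s})
    (measurableSet_le (by fun_prop) measurable_const)
  have h1 : volume B * volume (Metric.closedBall (0 : V) s) ≤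
      ((volume : Measure V).prod volume) P := by
    rw [Measure.prod_apply hP, mul_comm, ← setLIntegral_const, ← lintegral_indicator hB]
    refine lintegral_mono fun x => ?_
    by_cases hx : x ∈ B
    · rw [indicator_of_mem hx, ← Measure.addHaar_closedBall_center volume x s]
      refine measure_mono fun y hy => ?_
      exact ⟨hx, by rw [dist_comm]; exact hy⟩
    · simp [hx]
  have h2 : ((volume : Measure V).prod volume) P ≤ τ * volume S := by
    rw [Measure.prod_apply_symm hP, ← setLIntegral_const, ← lintegral_indicator hS]
    refine lintegral_mono fun y => ?_
    by_cases hy : y ∈ S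
    · rw [indicator_of_mem hy]
      exact (measure_mono fun x hx => (⟨hx.1, hx.2⟩ : x ∈ B ∩ Metric.closedBall y s)).trans (hτ y)
    · have : (fun x => (x, y)) ⁻¹' P = ∅ := by
        refine eq_empty_of_forall_notMem fun x hx => hy (hBS x hx.1 ?_)
        rw [Metric.mem_closedBall, dist_comm]
        exact hx.2
      simp [this]
  exact h1.trans h2

lemma exists_tsum_scale_le {β : ℝ} (hβ : 1 < β) :
    ∃ C, 0 ≤ C ∧ ∀ A X : ℝ, 0 < A → 0 ≤ X →
      ∑' l : ℕ, ENNReal.ofReal (X * (A ^ β * (2 ^ l * A) ^ (1 - β))) ≤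
        ENNReal.ofReal (C * (A * X)) := by
  set q : ℝ := 2 ^ (1 - β) with hq
  have hq0 : 0 ≤ q := by positivity
  have hq1 : q < 1 := Real.rpow_lt_one_of_one_lt_of_neg (by norm_num) (by linarith)
  refine ⟨(1 - q)⁻¹, inv_nonneg.2 (by linarith), fun A X hA hX => ?_⟩
  have key : ∀ l : ℕ, X * (A ^ β * (2 ^ l * A) ^ (1 - β)) = (A * X) * q ^ l := by
    intro l
    rw [Real.mul_rpow (by positivity) hA.le, mul_left_comm (A ^ β), ← Real.rpow_add hA,
      ← Real.rpow_natCast 2 l, ← Real.rpow_natCast q l, hq, ← Real.rpow_mul (by norm_num),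
      ← Real.rpow_mul (by norm_num), mul_comm (l : ℝ)]
    simp
    ring
  simp_rw [key]
  rw [← ENNReal.ofReal_tsum_of_nonneg (fun l => by positivity)
    ((summable_geometric_of_lt_one hq0 hq1).mul_left _), tsum_mul_left,
    tsum_geometric_of_lt_one hq0 hq1, mul_comm]

namespace IsKernelPair

variable {d : ℕ} {ρ : Rd d → ℝ} {K G : ℝ → Rd d → ℂ}

lemma exists_norm_gram_le (h : IsKernelPair ρ K G) (hd : 1 ≤ d) (N : ℕ) :
    ∃ C, 0 ≤ C ∧ ∀ e e' : ℝ × Rd d, ∀ H : ℝ, 0 < H → H ≤ dist e' e → e'.1 ≤ e.1 →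
      ‖G (e.1 - e'.1) (e'.2 - e.2)‖ ≤ C * H ^ (-(((d : ℝ) - 1) / 2)) *
        (1 + |ρ (e'.2 - e.2) - (e.1 - e'.1)|)⁻¹ ^ N := by
  obtain ⟨C, hC, hb⟩ := h.boundG N
  obtain ⟨c, hc, hco⟩ := h.coercive
  set b := min c 1 with hbdef
  have hb0 : 0 < b := lt_min hc one_pos
  have hd' : (1 : ℝ) ≤ d := by exact_mod_cast hd
  refine ⟨C * b ^ (-(((d : ℝ) - 1) / 2)), by positivity, fun e e' H hH hHd he => ?_⟩
  refine (hb _ (sub_nonneg.2 he) _).trans ?_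
  rw [mul_assoc C (b ^ _), ← Real.mul_rpow hb0.le hH.le]
  refine mul_le_mul_of_nonneg_right (mul_le_mul_of_nonneg_left
    (Real.rpow_le_rpow_of_nonpos (by positivity) ?_ (by linarith)) hC) (by positivity)
  have h1 := hco (e'.2 - e.2)
  have h2 : b * ‖e'.2 - e.2‖ ≤ c * ‖e'.2 - e.2‖ :=
    mul_le_mul_of_nonneg_right (min_le_left _ _) (norm_nonneg _)
  have h3 : b * (e.1 - e'.1) ≤ 1 * (e.1 - e'.1) :=
    mul_le_mul_of_nonneg_right (min_le_right _ _) (sub_nonneg.2 he)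
  have h4 : b * H ≤ b * dist e' e := mul_le_mul_of_nonneg_left hHd hb0.le
  have h5 : 0 ≤ b * ‖e'.2 - e.2‖ := by positivity
  have h6 : 0 ≤ b * (e.1 - e'.1) := mul_nonneg hb0.le (sub_nonneg.2 he)
  rw [Prod.dist_eq, mul_max_of_nonneg _ _ hb0.le, Real.dist_eq, dist_eq_norm, abs_sub_comm,
    abs_of_nonneg (sub_nonneg.2 he)] at h4
  rcases le_max_iff.1 h4 with h | h <;> linarith

/-- The part of the off-diagonal Gram sum where the two points are close compared with the
radius. -/
lemma exists_lintegral_gram_close_le (h : IsKernelPair ρ K G) (hd : 1 ≤ d) {β : ℝ} (hβ : 1 < β) :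
    ∃ C, 0 ≤ C ∧ ∀ A, 1 ≤ A → ∀ E : Set (ℝ × Rd d), MeasurableSet E → (∀ e ∈ E, 0 ≤ e.1) →
      IsSparse A β E → ∀ e ∈ E,
      ∫⁻ e' in {e' | e' ∈ E ∧ e'.1 < e.1 - 8 * A ∧ dist e' e ≤ (1 + e.1) / 8},
        ENNReal.ofReal ((1 + e'.1) ^ (((d : ℝ) - 1) / 2)) * ‖G (e.1 - e'.1) (e'.2 - e.2)‖ₑ ≤
        ENNReal.ofReal (C * (A * (1 + e.1) ^ (((d : ℝ) - 1) / 2))) := by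
  obtain ⟨C, hC, hb⟩ := h.exists_norm_gram_le hd 0
  obtain ⟨C', hC', hs⟩ := exists_tsum_scale_le hβ
  set α := ((d : ℝ) - 1) / 2 with hα
  have hd' : (1 : ℝ) ≤ d := by exact_mod_cast hd
  have hα0 : 0 ≤ α := by rw [hα]; linarith
  refine ⟨C' * (C * 2 ^ (1 + α - β)), by positivity, fun A hA E hE hE0 hsp e he => ?_⟩
  have hA0 : 0 < A := by linarith
  have hR : 0 ≤ e.1 := hE0 e he
  set S : ℕ → Set (ℝ × Rd d) := fun l => {e' | e' ∈ E ∧ e'.1 < e.1 ∧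
    4 * (2 ^ (l + 1) * A) ≤ 1 + e.1 ∧ 2 ^ l * A ≤ dist e' e ∧ dist e' e ≤ 2 ^ (l + 1) * A} with hS
  have hSm : ∀ l, MeasurableSet (S l) := fun l =>
    measurableSet_and hE (measurableSet_and (measurableSet_lt (by fun_prop) measurable_const)
      (measurableSet_and (MeasurableSet.const _) (measurableSet_and
        (measurableSet_le measurable_const (by fun_prop))
        (measurableSet_le (by fun_prop) measurable_const))))
  have hcov : {e' | e' ∈ E ∧ e'.1 < e.1 - 8 * A ∧ dist e' e ≤ (1 + e.1) / 8} ⊆ ⋃ l, S l := by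
    rintro e' ⟨h1, h2, h3⟩
    have h4 : 8 * A < dist e' e := by
      refine lt_of_lt_of_le ?_ (le_max_left _ _)
      rw [Real.dist_eq, abs_sub_comm]
      exact lt_of_lt_of_le (by linarith) (le_abs_self _)
    obtain ⟨l, hl1, hl2⟩ := exists_nat_pow_near (x := dist e' e / A) (y := (2 : ℝ))
      ((one_le_div hA0).2 (by linarith)) (by norm_num)
    rw [le_div_iff₀ hA0] at hl1
    rw [div_lt_iff₀ hA0] at hl2
    refine mem_iUnion.2 ⟨l, h1, by linarith, ?_, hl1, hl2.le⟩
    rw [pow_succ]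
    linarith
  calc _ ≤ ∫⁻ e' in ⋃ l, S l, ENNReal.ofReal ((1 + e'.1) ^ α) *
          ‖G (e.1 - e'.1) (e'.2 - e.2)‖ₑ := lintegral_mono_set hcov
    _ ≤ ∑' l, ∫⁻ e' in S l, ENNReal.ofReal ((1 + e'.1) ^ α) *
          ‖G (e.1 - e'.1) (e'.2 - e.2)‖ₑ := lintegral_iUnion_le _ _
    _ ≤ ∑' l : ℕ, ENNReal.ofReal ((C * 2 ^ (1 + α - β) * (1 + e.1) ^ α) *
          (A ^ β * (2 ^ l * A) ^ (1 - β))) := by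
        refine ENNReal.tsum_le_tsum fun l => ?_
        have hl0 : 0 < 2 ^ l * A := by positivity
        by_cases hl : 4 * (2 ^ (l + 1) * A) ≤ 1 + e.1
        · calc _ ≤ ∫⁻ e' in S l, ENNReal.ofReal ((1 + e.1) ^ α * (C * (2 ^ l * A) ^ (-α))) := by
                refine setLIntegral_mono' (hSm l) fun e' he' => ?_
                rw [ENNReal.ofReal_mul (by positivity)]
                have h0 := hE0 e' he'.1
                refine mul_le_mul' (ENNReal.ofReal_le_ofReal
                  (Real.rpow_le_rpow (by linarith) (by linarith [he'.2.1]) hα0)) ?_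
                rw [← ofReal_norm]
                refine ENNReal.ofReal_le_ofReal ?_
                simpa using hb e e' _ hl0 he'.2.2.2.1 he'.2.1.le
            _ ≤ ENNReal.ofReal ((1 + e.1) ^ α * (C * (2 ^ l * A) ^ (-α))) *
                  ENNReal.ofReal (threshold d A β (2 ^ (l + 1) * A)) := by
                rw [setLIntegral_const]
                have hsub : S l ⊆ E ∩ Metric.closedBall e (2 ^ (l + 1) * A) :=
                  fun e' he' => ⟨he'.1, he'.2.2.2.2⟩
                gcongr
                exact (measure_mono hsub).trans (hsp e he (l + 1) hl)
            _ = _ := by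
                rw [← ENNReal.ofReal_mul (by positivity)]
                congr 1
                have : (2 : ℝ) ^ (l + 1) * A = 2 * (2 ^ l * A) := by ring
                rw [threshold, this, Real.mul_rpow (by norm_num) hl0.le,
                  show 1 - β = -α + (1 + α - β) by ring, Real.rpow_add hl0]
                ring
        · have : S l = ∅ := eq_empty_of_forall_notMem fun e' he' => hl he'.2.2.1
          simp [this]
    _ ≤ _ := (hs A _ hA0 (by positivity)).trans_eq (by congr 1; ring)

end IsKernelPair

end

section

open Filter Topology

namespace IsKernelPair

variable {d : ℕ} {ρ : Rd d → ℝ} {K G : ℝ → Rd d → ℂ}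

lemma exists_volume_cone_le (h : IsKernelPair ρ K G) {W : ℝ} (hW : 0 < W) :
    ∃ C, 0 ≤ C ∧ ∀ e : ℝ × Rd d, 0 ≤ e.1 → ∀ s : ℝ, 0 < s → s ≤ 1 + e.1 →
      volume {e' : ℝ × Rd d | (7 * s ≤ 1 + e'.1 ∧ 1 + e'.1 ≤ 17 * s) ∧
        |ρ (e'.2 - e.2) - (e.1 - e'.1)| ≤ W * s} ≤
        ENNReal.ofReal (C * (s ^ 2 * (1 + e.1) ^ (d - 1))) := by
  obtain ⟨C, hC, hs⟩ := h.shell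
  have hm := h.cont.measurable
  refine ⟨10 * (C * (W * (18 + W) ^ (d - 1))), by positivity, fun e he s hs0 hsR => ?_⟩
  set S : Set (ℝ × Rd d) := {e' | (7 * s ≤ 1 + e'.1 ∧ 1 + e'.1 ≤ 17 * s) ∧
    |ρ (e'.2 - e.2) - (e.1 - e'.1)| ≤ W * s} with hSdef
  have hS : MeasurableSet S := measurableSet_and (measurableSet_and
    (measurableSet_le measurable_const (by fun_prop))
    (measurableSet_le (by fun_prop) measurable_const))
    (measurableSet_le (by fun_prop) measurable_const)
  rw [Measure.volume_eq_prod, Measure.prod_apply hS]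
  set M : ℝ := C * (W * s * ((18 + W) * (1 + e.1)) ^ (d - 1)) with hM
  have hM0 : 0 ≤ M := by positivity
  calc ∫⁻ r, volume (Prod.mk r ⁻¹' S) ≤
        ∫⁻ r, (Icc (7 * s - 1) (17 * s - 1)).indicator (fun _ => ENNReal.ofReal M) r := by
        refine lintegral_mono fun r => ?_
        by_cases hr : r ∈ Icc (7 * s - 1) (17 * s - 1)
        · rw [indicator_of_mem hr]
          have hsub : Prod.mk r ⁻¹' S ⊆ {y | |ρ (y - e.2) - (e.1 - r)| ≤ W * s} := fun y hy => hy.2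
          refine (measure_mono hsub).trans ?_
          rw [volume_shell_translate]
          refine (hs _ _ (by positivity)).trans (ENNReal.ofReal_le_ofReal ?_)
          have h1 : |e.1 - r| ≤ 18 * (1 + e.1) := by
            rw [abs_le]
            constructor <;> linarith [hr.1, hr.2]
          have h2 : |e.1 - r| + W * s ≤ (18 + W) * (1 + e.1) := by
            nlinarith
          rw [hM]
          gcongr
        · have : Prod.mk r ⁻¹' S = ∅ := eq_empty_of_forall_notMem fun y hy =>
            hr ⟨by linarith [hy.1.1], by linarith [hy.1.2]⟩
          simp [this]
    _ = ENNReal.ofReal (M * (10 * s)) := by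
        rw [lintegral_indicator measurableSet_Icc, setLIntegral_const, Real.volume_Icc,
          ← ENNReal.ofReal_mul hM0]
        congr 2
        ring
    _ ≤ _ := by
        refine ENNReal.ofReal_le_ofReal (le_of_eq ?_)
        rw [hM, mul_pow]
        ring

/-- A sparse set has few points near a given cone. -/
lemma exists_volume_sparse_cone_le (h : IsKernelPair ρ K G) (β : ℝ) :
    ∃ C, 0 ≤ C ∧ ∀ A s : ℝ, 0 < A → 0 < s → ∀ E : Set (ℝ × Rd d), MeasurableSet E →
      (∀ e ∈ E, 4 * s ≤ 1 + e.1 →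
        volume (E ∩ Metric.closedBall e s) ≤ ENNReal.ofReal (threshold d A β s)) →
      ∀ e : ℝ × Rd d, 0 ≤ e.1 → s ≤ 1 + e.1 →
      volume {e' | e' ∈ E ∧ (8 * s ≤ 1 + e'.1 ∧ 1 + e'.1 ≤ 16 * s) ∧
        |ρ (e'.2 - e.2) - (e.1 - e'.1)| ≤ s} ≤
        ENNReal.ofReal (C * ((1 + e.1) ^ (d - 1) *
          (A ^ β * s ^ (1 - ((d : ℝ) - 1) / 2 - β)))) := by
  obtain ⟨L, hL, hLip⟩ := h.lip
  obtain ⟨C, hC, hcone⟩ := h.exists_volume_cone_le (W := L + 2) (by linarith)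
  have hm := h.cont.measurable
  set c : ℝ := (volume (Metric.ball (0 : ℝ × Rd d) 1)).toReal with hc
  have hcfin : volume (Metric.ball (0 : ℝ × Rd d) 1) ≠ ⊤ := measure_ball_lt_top.ne
  have hc0 : 0 < c := ENNReal.toReal_pos (Metric.measure_ball_pos _ _ one_pos).ne' hcfin
  refine ⟨C * 2 ^ (d + 1) / c, by positivity, fun A s hA hs E hE hsp e he hse => ?_⟩
  set B : Set (ℝ × Rd d) := {e' | e' ∈ E ∧ (8 * s ≤ 1 + e'.1 ∧ 1 + e'.1 ≤ 16 * s) ∧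
        |ρ (e'.2 - e.2) - (e.1 - e'.1)| ≤ s} with hBdef
  have hB : MeasurableSet B := measurableSet_and hE (measurableSet_and (measurableSet_and
    (measurableSet_le measurable_const (by fun_prop))
    (measurableSet_le (by fun_prop) measurable_const))
    (measurableSet_le (by fun_prop) measurable_const))
  set S : Set (ℝ × Rd d) := {e' | (7 * s ≤ 1 + e'.1 ∧ 1 + e'.1 ≤ 17 * s) ∧
        |ρ (e'.2 - e.2) - (e.1 - e'.1)| ≤ (L + 2) * s} with hSdef
  have hS : MeasurableSet S := measurableSet_and (measurableSet_and
    (measurableSet_le measurable_const (by fun_prop))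
    (measurableSet_le (by fun_prop) measurable_const))
    (measurableSet_le (by fun_prop) measurable_const)
  have hτ : ∀ x, volume (B ∩ Metric.closedBall x (s / 2)) ≤
      ENNReal.ofReal (threshold d A β s) := by
    intro x
    rcases (B ∩ Metric.closedBall x (s / 2)).eq_empty_or_nonempty with h0 | ⟨w, hw⟩
    · simp [h0]
    · refine (measure_mono fun v hv => ?_).trans (hsp w hw.1.1 (by linarith [hw.1.2.1.1]))
      refine ⟨hv.1.1, ?_⟩
      have h1 : dist v x ≤ s / 2 := hv.2
      have h2 : dist w x ≤ s / 2 := hw.2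
      rw [Metric.mem_closedBall]
      linarith [dist_triangle_right v w x]
  have hBS : ∀ x ∈ B, Metric.closedBall x (s / 2) ⊆ S := by
    intro x hx v hv
    rw [Metric.mem_closedBall, Prod.dist_eq, max_le_iff, Real.dist_eq, dist_eq_norm, abs_le] at hv
    obtain ⟨-, ⟨h1, h2⟩, h3⟩ := hx
    have h4 := hLip (v.2 - e.2) (x.2 - e.2)
    rw [sub_sub_sub_cancel_right] at h4
    have h5 : L * ‖v.2 - x.2‖ ≤ L * (s / 2) := mul_le_mul_of_nonneg_left hv.2 hL.le
    have h6 : 0 ≤ L * s := by positivity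
    rw [abs_le] at h3 h4
    refine ⟨⟨by linarith [hv.1.1], by linarith [hv.1.2]⟩, abs_le.2 ⟨?_, ?_⟩⟩ <;>
      linarith [hv.1.1, hv.1.2, h3.1, h3.2, h4.1, h4.2]
  have : (volume : Measure (ℝ × Rd d)).IsAddHaarMeasure := by
    rw [Measure.volume_eq_prod]
    infer_instance
  have key := volume_mul_volume_closedBall_le hB hS hτ hBS
  have hfr : Module.finrank ℝ (ℝ × Rd d) = d + 1 := by
    simp [Rd, add_comm]
  rw [Measure.addHaar_closedBall _ _ (by positivity), hfr, ← ENNReal.ofReal_toReal hcfin, ← hc,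
    ← ENNReal.ofReal_mul (by positivity)] at key
  have hpos : 0 < (s / 2) ^ (d + 1) * c := by positivity
  have hth := threshold_pos d hA β hs
  have key2 : volume B * ENNReal.ofReal ((s / 2) ^ (d + 1) * c) ≤
      ENNReal.ofReal (threshold d A β s * (C * (s ^ 2 * (1 + e.1) ^ (d - 1)))) := by
    rw [ENNReal.ofReal_mul hth.le]
    exact key.trans (by gcongr; exact hcone e he s hs hse)
  rw [← ENNReal.le_div_iff_mul_le (Or.inl (ENNReal.ofReal_pos.2 hpos).ne')
    (Or.inl ENNReal.ofReal_ne_top), ← ENNReal.ofReal_div_of_pos hpos] at key2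
  refine key2.trans_eq (congrArg _ ?_)
  rw [div_eq_iff hpos.ne', threshold, div_pow]
  have : s ^ (1 + ((d : ℝ) - 1) / 2 - β) * s ^ 2 =
      s ^ (1 - ((d : ℝ) - 1) / 2 - β) * s ^ (d + 1) := by
    rw [← Real.rpow_natCast s 2, ← Real.rpow_natCast s (d + 1), ← Real.rpow_add hs,
      ← Real.rpow_add hs]
    congr 1
    push_cast
    ring
  generalize s ^ (1 + ((d : ℝ) - 1) / 2 - β) = u at this ⊢
  generalize s ^ (1 - ((d : ℝ) - 1) / 2 - β) = v at this ⊢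
  field_simp
  linear_combination C * this

end IsKernelPair

end

section

open Filter Topology

namespace IsKernelPair

variable {d : ℕ} {ρ : Rd d → ℝ} {K G : ℝ → Rd d → ℂ}

lemma exists_lintegral_cone_decay_le (h : IsKernelPair ρ K G) (hd : 1 ≤ d) :
    ∃ C, 0 ≤ C ∧ ∀ (e : ℝ × Rd d) (I : Set ℝ), MeasurableSet I → (∀ r ∈ I, 0 ≤ r ∧ r ≤ e.1) →
      ∫⁻ e' in I ×ˢ univ, ENNReal.ofReal ((1 + |ρ (e'.2 - e.2) - (e.1 - e'.1)|)⁻¹ ^ (d + 1)) ≤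
        ENNReal.ofReal (C * (1 + e.1) ^ (d - 1)) * volume I := by
  obtain ⟨C, hC, hdec⟩ := h.exists_lintegral_decay_le hd
  have hm := h.cont.measurable
  refine ⟨C, hC, fun e I hI hIe => ?_⟩
  rw [Measure.volume_eq_prod, setLIntegral_prod _ (by fun_prop), ← setLIntegral_const]
  refine setLIntegral_mono' hI fun r hr => ?_
  obtain ⟨h0, h1⟩ := hIe r hr
  rw [Measure.restrict_univ]
  refine (lintegral_sub_right_eq_self
    (fun y => ENNReal.ofReal ((1 + |ρ y - (e.1 - r)|)⁻¹ ^ (d + 1))) e.2).trans_le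
    ((hdec _).trans (ENNReal.ofReal_le_ofReal ?_))
  rw [abs_of_nonneg (by linarith)]
  gcongr
  linarith

/-- The part of the off-diagonal Gram sum where the two points are far apart compared with the
radius, at a single scale. -/
lemma exists_lintegral_gram_distant_scale_le (h : IsKernelPair ρ K G) (hd : 1 ≤ d) {β : ℝ}
    (hβ0 : 0 ≤ β) (hβ : β ≤ ((d : ℝ) + 3) / 2) :
    ∃ C, 0 ≤ C ∧ ∀ A s : ℝ, 1 ≤ A → 1 ≤ s → ∀ E : Set (ℝ × Rd d), MeasurableSet E →
      (∀ e ∈ E, 0 ≤ e.1) →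
      (∀ e ∈ E, 4 * s ≤ 1 + e.1 →
        volume (E ∩ Metric.closedBall e s) ≤ ENNReal.ofReal (threshold d A β s)) →
      ∀ e : ℝ × Rd d, 0 ≤ e.1 →
      ∫⁻ e' in {e' | e' ∈ E ∧ e'.1 < e.1 ∧ (1 + e.1) / 8 ≤ dist e' e ∧
          (8 * s ≤ 1 + e'.1 ∧ 1 + e'.1 ≤ 16 * s)},
        ENNReal.ofReal ((1 + e'.1) ^ (((d : ℝ) - 1) / 2)) * ‖G (e.1 - e'.1) (e'.2 - e.2)‖ₑ ≤
        ENNReal.ofReal (C * (1 + e.1) ^ (((d : ℝ) - 1) / 2) * (A ^ β * s ^ (1 - β))) := by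
  obtain ⟨C, hC, hb⟩ := h.exists_norm_gram_le hd (2 * (d + 1))
  obtain ⟨C₁, hC₁, h1⟩ := h.exists_volume_sparse_cone_le β
  obtain ⟨C₂, hC₂, h2⟩ := h.exists_lintegral_cone_decay_le hd
  have hm := h.cont.measurable
  set α := ((d : ℝ) - 1) / 2 with hα
  have hd' : (1 : ℝ) ≤ d := by exact_mod_cast hd
  have hα0 : 0 ≤ α := by rw [hα]; linarith
  refine ⟨16 ^ α * C * 8 ^ α * (C₁ + 8 * C₂), by positivity,
    fun A s hA hs E hE hE0 hsp e he => ?_⟩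
  have hs0 : 0 < s := by linarith
  have hA0 : 0 < A := by linarith
  set R := 1 + e.1 with hR
  have hR0 : 0 < R := by linarith
  have hRα : R ^ (d - 1) = R ^ α * R ^ α := by
    rw [← Real.rpow_natCast, ← Real.rpow_add hR0, Nat.cast_sub hd, hα]
    congr 1
    push_cast
    ring
  have hR8 : (R / 8) ^ (-α) = 8 ^ α * (R ^ α)⁻¹ := by
    rw [Real.rpow_neg (by positivity), Real.div_rpow hR0.le (by norm_num), inv_div, div_eq_mul_inv]
  set S : Set (ℝ × Rd d) := {e' | e' ∈ E ∧ e'.1 < e.1 ∧ R / 8 ≤ dist e' e ∧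
          (8 * s ≤ 1 + e'.1 ∧ 1 + e'.1 ≤ 16 * s)} with hS
  have hSm : MeasurableSet S := measurableSet_and hE (measurableSet_and
    (measurableSet_lt (by fun_prop) measurable_const) (measurableSet_and
      (measurableSet_le measurable_const (by fun_prop)) (measurableSet_and
      (measurableSet_le measurable_const (by fun_prop))
      (measurableSet_le (by fun_prop) measurable_const))))
  set T : Set (ℝ × Rd d) := {e' | |ρ (e'.2 - e.2) - (e.1 - e'.1)| ≤ s} with hT
  have hTm : MeasurableSet T := measurableSet_le (by fun_prop) measurable_const
  have hbase : ∀ e' ∈ S, ENNReal.ofReal ((1 + e'.1) ^ α) * ‖G (e.1 - e'.1) (e'.2 - e.2)‖ₑ ≤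
      ENNReal.ofReal ((16 * s) ^ α * (C * (R / 8) ^ (-α))) *
        ENNReal.ofReal ((1 + |ρ (e'.2 - e.2) - (e.1 - e'.1)|)⁻¹ ^ (2 * (d + 1))) := by
    intro e' he'
    have h0 := hE0 e' he'.1
    rw [← ofReal_norm, ← ENNReal.ofReal_mul (by positivity), ← ENNReal.ofReal_mul (by positivity),
      mul_assoc]
    refine ENNReal.ofReal_le_ofReal (mul_le_mul (Real.rpow_le_rpow (by linarith)
      he'.2.2.2.2 hα0) (hb e e' _ (by positivity) he'.2.2.1 he'.2.1.le) (norm_nonneg _)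
      (by positivity))
  by_cases hsR : s ≤ R
  swap
  · have : S = ∅ := eq_empty_of_forall_notMem fun e' he' =>
      hsR (by linarith [he'.2.1, he'.2.2.2.1])
    simp [this]
  have hnear : ∫⁻ e' in S ∩ T,
      ENNReal.ofReal ((1 + e'.1) ^ α) * ‖G (e.1 - e'.1) (e'.2 - e.2)‖ₑ ≤
      ENNReal.ofReal ((16 * s) ^ α * (C * (R / 8) ^ (-α)) *
        (C₁ * (R ^ (d - 1) * (A ^ β * s ^ (1 - α - β))))) := by
    calc _ ≤ ∫⁻ e' in S ∩ T, ENNReal.ofReal ((16 * s) ^ α * (C * (R / 8) ^ (-α))) := by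
          refine setLIntegral_mono' (hSm.inter hTm) fun e' he' => (hbase e' he'.1).trans ?_
          refine (mul_le_mul_right (ENNReal.ofReal_le_one.2 (pow_le_one₀ (by positivity)
            (inv_le_one_of_one_le₀ (by simp)))) _).trans_eq (mul_one _)
      _ ≤ _ := by
          rw [setLIntegral_const, ENNReal.ofReal_mul (p := (16 * s) ^ α * (C * (R / 8) ^ (-α)))
            (by positivity)]
          refine mul_le_mul_right ((measure_mono fun e' he' => ?_).trans
            (h1 A s hA0 hs0 E hE hsp e he hsR)) _
          exact ⟨he'.1.1, he'.1.2.2.2, he'.2⟩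
  have hfar : ∫⁻ e' in S \ T,
      ENNReal.ofReal ((1 + e'.1) ^ α) * ‖G (e.1 - e'.1) (e'.2 - e.2)‖ₑ ≤
      ENNReal.ofReal ((16 * s) ^ α * (C * (R / 8) ^ (-α)) * s⁻¹ ^ (d + 1) *
        (C₂ * R ^ (d - 1) * (8 * s))) := by
    set I : Set ℝ := Icc (8 * s - 1) (16 * s - 1) ∩ Icc 0 e.1 with hI
    have hIm : MeasurableSet I := measurableSet_Icc.inter measurableSet_Icc
    calc _ ≤ ∫⁻ e' in S \ T, ENNReal.ofReal ((16 * s) ^ α * (C * (R / 8) ^ (-α)) *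
            s⁻¹ ^ (d + 1)) *
            ENNReal.ofReal ((1 + |ρ (e'.2 - e.2) - (e.1 - e'.1)|)⁻¹ ^ (d + 1)) := by
          refine setLIntegral_mono' (hSm.diff hTm) fun e' he' => (hbase e' he'.1).trans ?_
          rw [ENNReal.ofReal_mul (p := (16 * s) ^ α * (C * (R / 8) ^ (-α))) (by positivity),
            mul_assoc]
          refine mul_le_mul_right ?_ _
          rw [← ENNReal.ofReal_mul (by positivity), two_mul (d + 1), pow_add]
          refine ENNReal.ofReal_le_ofReal ?_
          have : s < |ρ (e'.2 - e.2) - (e.1 - e'.1)| := not_le.1 he'.2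
          gcongr
          linarith
      _ ≤ ∫⁻ e' in I ×ˢ univ, ENNReal.ofReal ((16 * s) ^ α * (C * (R / 8) ^ (-α)) *
            s⁻¹ ^ (d + 1)) *
            ENNReal.ofReal ((1 + |ρ (e'.2 - e.2) - (e.1 - e'.1)|)⁻¹ ^ (d + 1)) := by
          refine lintegral_mono_set fun e' he' => ⟨⟨⟨?_, ?_⟩, hE0 _ he'.1.1, he'.1.2.1.le⟩,
            mem_univ _⟩
          · linarith [he'.1.2.2.2.1]
          · linarith [he'.1.2.2.2.2]
      _ ≤ _ := by
          rw [lintegral_const_mul' _ _ ENNReal.ofReal_ne_top,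
            ENNReal.ofReal_mul (p := (16 * s) ^ α * (C * (R / 8) ^ (-α)) * s⁻¹ ^ (d + 1))
              (by positivity)]
          refine mul_le_mul_right ((h2 e I hIm fun r hr => hr.2).trans ?_) _
          rw [ENNReal.ofReal_mul (p := C₂ * R ^ (d - 1)) (by positivity)]
          refine mul_le_mul_right
            ((measure_mono (μ := volume) (inter_subset_left (s := Icc (8 * s - 1) (16 * s - 1)))).trans_eq ?_) _
          rw [Real.volume_Icc]
          congr 1
          ring
  rw [← lintegral_inter_add_sdiff _ S hTm]
  refine (add_le_add hnear hfar).trans ?_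
  rw [← ENNReal.ofReal_add (by positivity) (by positivity)]
  refine ENNReal.ofReal_le_ofReal ?_
  have hx : (16 * s) ^ α = 16 ^ α * s ^ α := Real.mul_rpow (by norm_num) hs0.le
  have hy : s ^ α * s ^ (1 - α - β) = s ^ (1 - β) := by
    rw [← Real.rpow_add hs0]
    congr 1
    ring
  have hz : s ^ α * s⁻¹ ^ (d + 1) * s ≤ A ^ β * s ^ (1 - β) := by
    have h3 : s ^ α * s⁻¹ ^ (d + 1) * s = s ^ (α - d) := by
      rw [inv_pow, ← Real.rpow_natCast, ← Real.rpow_neg hs0.le, ← Real.rpow_add hs0]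
      nth_rw 2 [← Real.rpow_one s]
      rw [← Real.rpow_add hs0]
      congr 1
      push_cast
      ring
    rw [h3]
    have h4 : s ^ (α - d) ≤ s ^ (1 - β) :=
      Real.rpow_le_rpow_of_exponent_le hs (by rw [hα]; linarith)
    exact h4.trans (le_mul_of_one_le_left (by positivity) (Real.one_le_rpow hA hβ0))
  have hw : R ^ α * (R ^ α)⁻¹ = 1 := mul_inv_cancel₀ (by positivity)
  rw [hx, hR8, hRα]
  have e1 : 16 ^ α * s ^ α * (C * (8 ^ α * (R ^ α)⁻¹)) *
      (C₁ * (R ^ α * R ^ α * (A ^ β * s ^ (1 - α - β)))) =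
      16 ^ α * C * 8 ^ α * C₁ * R ^ α * (A ^ β * s ^ (1 - β)) := by
    rw [← hy]
    linear_combination (16 ^ α * s ^ α * C * 8 ^ α * C₁ * R ^ α * A ^ β * s ^ (1 - α - β)) * hw
  have e2 : 16 ^ α * s ^ α * (C * (8 ^ α * (R ^ α)⁻¹)) * s⁻¹ ^ (d + 1) *
      (C₂ * (R ^ α * R ^ α) * (8 * s)) =
      16 ^ α * C * 8 ^ α * (8 * C₂) * R ^ α * (s ^ α * s⁻¹ ^ (d + 1) * s) := by
    linear_combination (16 ^ α * s ^ α * C * 8 ^ α * C₂ * R ^ α * s⁻¹ ^ (d + 1) * 8 * s) * hw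
  rw [e1, e2]
  have := mul_le_mul_of_nonneg_left hz
    (show 0 ≤ 16 ^ α * C * 8 ^ α * (8 * C₂) * R ^ α by positivity)
  linarith

lemma exists_lintegral_gram_distant_le (h : IsKernelPair ρ K G) (hd : 1 ≤ d) {β : ℝ}
    (hβ1 : 1 < β) (hβ : β ≤ ((d : ℝ) + 3) / 2) :
    ∃ C, 0 ≤ C ∧ ∀ A, 1 ≤ A → ∀ E : Set (ℝ × Rd d), MeasurableSet E → (∀ e ∈ E, 0 ≤ e.1) →
      (∀ e ∈ E, 8 * A ≤ 1 + e.1) → IsSparse A β E → ∀ e ∈ E,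
      ∫⁻ e' in {e' | e' ∈ E ∧ e'.1 < e.1 - 8 * A ∧ (1 + e.1) / 8 ≤ dist e' e},
        ENNReal.ofReal ((1 + e'.1) ^ (((d : ℝ) - 1) / 2)) * ‖G (e.1 - e'.1) (e'.2 - e.2)‖ₑ ≤
        ENNReal.ofReal (C * (A * (1 + e.1) ^ (((d : ℝ) - 1) / 2))) := by
  obtain ⟨C, hC, hb⟩ := h.exists_lintegral_gram_distant_scale_le hd (by linarith) hβ
  obtain ⟨C', hC', hs⟩ := exists_tsum_scale_le hβ1
  refine ⟨C' * C, by positivity, fun A hA E hE hE0 hEA hsp e he => ?_⟩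
  set α := ((d : ℝ) - 1) / 2 with hα
  have hA0 : 0 < A := by linarith
  have hR : 0 ≤ e.1 := hE0 e he
  set S : ℕ → Set (ℝ × Rd d) := fun l => {e' | e' ∈ E ∧ e'.1 < e.1 ∧ (1 + e.1) / 8 ≤ dist e' e ∧
    (8 * (2 ^ l * A) ≤ 1 + e'.1 ∧ 1 + e'.1 ≤ 16 * (2 ^ l * A))} with hS
  have hcov : {e' | e' ∈ E ∧ e'.1 < e.1 - 8 * A ∧ (1 + e.1) / 8 ≤ dist e' e} ⊆ ⋃ l, S l := by
    rintro e' ⟨h1, h2, h3⟩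
    obtain ⟨l, hl1, hl2⟩ := exists_nat_pow_near (x := (1 + e'.1) / (8 * A)) (y := (2 : ℝ))
      ((one_le_div (by positivity)).2 (hEA e' h1)) (by norm_num)
    rw [le_div_iff₀ (by positivity)] at hl1
    rw [div_lt_iff₀ (by positivity), pow_succ] at hl2
    exact mem_iUnion.2 ⟨l, h1, by linarith, h3, by linarith, by linarith⟩
  calc _ ≤ ∫⁻ e' in ⋃ l, S l, ENNReal.ofReal ((1 + e'.1) ^ α) *
          ‖G (e.1 - e'.1) (e'.2 - e.2)‖ₑ := lintegral_mono_set hcov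
    _ ≤ ∑' l, ∫⁻ e' in S l, ENNReal.ofReal ((1 + e'.1) ^ α) *
          ‖G (e.1 - e'.1) (e'.2 - e.2)‖ₑ := lintegral_iUnion_le _ _
    _ ≤ ∑' l : ℕ, ENNReal.ofReal (C * (1 + e.1) ^ α * (A ^ β * (2 ^ l * A) ^ (1 - β))) :=
        ENNReal.tsum_le_tsum fun l => hb A _ hA
          (one_le_mul_of_one_le_of_one_le (one_le_pow₀ (by norm_num)) hA) E hE hE0
          (fun e he hl => hsp e he l hl) e hR
    _ ≤ _ := (hs A _ hA0 (by positivity)).trans_eq (by congr 1; ring)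

/-- The off-diagonal Gram sum over a sparse set. -/
lemma exists_lintegral_gram_far_le (h : IsKernelPair ρ K G) (hd : 1 ≤ d) {β : ℝ}
    (hβ1 : 1 < β) (hβ : β ≤ ((d : ℝ) + 3) / 2) :
    ∃ C, 0 ≤ C ∧ ∀ A, 1 ≤ A → ∀ E : Set (ℝ × Rd d), MeasurableSet E → (∀ e ∈ E, 0 ≤ e.1) →
      (∀ e ∈ E, 8 * A ≤ 1 + e.1) → IsSparse A β E → ∀ e ∈ E,
      ∫⁻ e' in {e' | e' ∈ E ∧ e'.1 < e.1 - 8 * A},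
        ENNReal.ofReal ((1 + e'.1) ^ (((d : ℝ) - 1) / 2)) * ‖G (e.1 - e'.1) (e'.2 - e.2)‖ₑ ≤
        ENNReal.ofReal (C * (A * (1 + e.1) ^ (((d : ℝ) - 1) / 2))) := by
  obtain ⟨C₁, hC₁, h1⟩ := h.exists_lintegral_gram_close_le hd hβ1
  obtain ⟨C₂, hC₂, h2⟩ := h.exists_lintegral_gram_distant_le hd hβ1 hβ
  refine ⟨C₁ + C₂, by positivity, fun A hA E hE hE0 hEA hsp e he => ?_⟩
  have hR := hE0 e he
  have hcov : {e' | e' ∈ E ∧ e'.1 < e.1 - 8 * A} ⊆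
      {e' | e' ∈ E ∧ e'.1 < e.1 - 8 * A ∧ dist e' e ≤ (1 + e.1) / 8} ∪
      {e' | e' ∈ E ∧ e'.1 < e.1 - 8 * A ∧ (1 + e.1) / 8 ≤ dist e' e} := fun e' he' =>
    (le_total (dist e' e) ((1 + e.1) / 8)).imp (fun hl => ⟨he'.1, he'.2, hl⟩)
      (fun hl => ⟨he'.1, he'.2, hl⟩)
  refine (lintegral_mono_set hcov).trans ((lintegral_union_le _ _ _).trans
    ((add_le_add (h1 A hA E hE hE0 hsp e he) (h2 A hA E hE hE0 hEA hsp e he)).trans ?_))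
  rw [← ENNReal.ofReal_add (by positivity) (by positivity), add_mul]

end IsKernelPair

end

section

open Filter Topology

lemma rpow_half_mul_self {d : ℕ} (hd : 1 ≤ d) {R : ℝ} (hR : 0 < R) :
    R ^ (((d : ℝ) - 1) / 2) * R ^ (((d : ℝ) - 1) / 2) = R ^ (d - 1) := by
  rw [← Real.rpow_natCast, ← Real.rpow_add hR, Nat.cast_sub hd]
  congr 1
  push_cast
  ring

lemma enorm_integral_mul_conj_le_add {X : Type*} [MeasurableSpace X] {μ : Measure X}
    {u v : X → ℂ} (hu : AEMeasurable (fun x => ‖u x‖ₑ) μ) :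
    ‖∫ x, u x * (starRingEnd ℂ) (v x) ∂μ‖ₑ ≤ ∫⁻ x, ‖u x‖ₑ ^ 2 ∂μ + ∫⁻ x, ‖v x‖ₑ ^ 2 ∂μ := by
  refine (enorm_integral_le_lintegral_enorm _).trans ?_
  rw [← lintegral_add_left' (hu.pow_const 2)]
  refine lintegral_mono fun x => ?_
  rw [enorm_mul, RCLike.enorm_conj]
  rcases le_total ‖u x‖ₑ ‖v x‖ₑ with h | h
  · refine (mul_le_mul_left h _).trans ?_
    rw [← sq]
    exact le_add_self
  · refine (mul_le_mul_right h _).trans ?_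
    rw [← sq]
    exact le_self_add

lemma enorm_integral_mul_conj_comm {X : Type*} [MeasurableSpace X] {μ : Measure X}
    {u v : X → ℂ} : ‖∫ x, u x * (starRingEnd ℂ) (v x) ∂μ‖ₑ =
      ‖∫ x, v x * (starRingEnd ℂ) (u x) ∂μ‖ₑ := by
  rw [← RCLike.enorm_conj, ← integral_conj]
  simp only [map_mul, Complex.conj_conj, mul_comm]

lemma lintegral_lintegral_add {X Y : Type*} [MeasurableSpace X] [MeasurableSpace Y]
    {μ : Measure X} {ν : Measure Y} [SFinite ν] {f g : X → Y → ℝ≥0∞}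
    (hf : Measurable fun z : X × Y => f z.1 z.2) :
    ∫⁻ x, ∫⁻ y, (f x y + g x y) ∂ν ∂μ = ∫⁻ x, ∫⁻ y, f x y ∂ν ∂μ + ∫⁻ x, ∫⁻ y, g x y ∂ν ∂μ := by
  rw [← lintegral_add_left hf.lintegral_prod_right']
  exact lintegral_congr fun x => lintegral_add_left (hf.comp measurable_prodMk_left) _

lemma lintegral_ite_abs_sub_le (D a : ℝ) (c : ℝ≥0∞) :
    ∫⁻ r : ℝ, (if |a - r| ≤ D then c else 0) = c * ENNReal.ofReal (2 * D) := by
  have : (fun r : ℝ => if |a - r| ≤ D then c else 0) =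
      (Metric.closedBall a D).indicator fun _ => c := by
    ext r
    simp only [indicator, Metric.mem_closedBall, Real.dist_eq, abs_sub_comm]
  rw [this, lintegral_indicator_const measurableSet_closedBall, Real.volume_closedBall]

namespace IsKernelPair

variable {d : ℕ} {ρ : Rd d → ℝ} {K G : ℝ → Rd d → ℂ}

/-- The basic `L²` bound. -/
lemma exists_lintegral_sq_le (h : IsKernelPair ρ K G) (hd : 1 ≤ d) :
    ∃ C, 0 ≤ C ∧ ∀ D M : ℝ, 0 ≤ D → 0 ≤ M → ∀ E : Set (ℝ × Rd d), MeasurableSet E →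
      (∀ e ∈ E, 0 ≤ e.1) →
      (∀ e ∈ E, ∫⁻ e' in {e' | e' ∈ E ∧ e'.1 < e.1 - D},
        ENNReal.ofReal ((1 + e'.1) ^ (((d : ℝ) - 1) / 2)) * ‖G (e.1 - e'.1) (e'.2 - e.2)‖ₑ ≤
        ENNReal.ofReal (M * (1 + e.1) ^ (((d : ℝ) - 1) / 2))) →
      ∀ F, IsNice F → (∀ e, ‖F e‖ₑ ≤
        E.indicator (fun e => ENNReal.ofReal ((1 + e.1) ^ (((d : ℝ) - 1) / 2))) e) →
      ∫⁻ x, ‖superpose K F x‖ₑ ^ 2 ≤ ENNReal.ofReal (C * D + 2 * M) * weightedVolume E := by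
  obtain ⟨C, hC, hconv⟩ := h.exists_lintegral_conv_sq_le hd
  refine ⟨4 * C, by positivity, fun D M hD hM E hE hE0 hfar F hF hFE => ?_⟩
  set α := ((d : ℝ) - 1) / 2 with hα
  have hEsq : ∀ e ∈ E, ENNReal.ofReal ((1 + e.1) ^ α) * ENNReal.ofReal ((1 + e.1) ^ α) =
      ENNReal.ofReal ((1 + e.1) ^ (d - 1)) := fun e he => by
    have := hE0 e he
    rw [← ENNReal.ofReal_mul (by positivity), hα, rpow_half_mul_self hd (by linarith)]
  set m : ℝ → ℝ≥0∞ := fun r => ENNReal.ofReal C * ∫⁻ y, ‖F (r, y)‖ₑ ^ 2 with hm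
  have hFm : Measurable fun e => ‖F e‖ₑ := hF.meas.enorm
  have hmm : Measurable m := ((hFm.pow_const 2).lintegral_prod_right').const_mul _
  have hmint : ∫⁻ r, m r ≤ ENNReal.ofReal C * weightedVolume E := by
    rw [hm, lintegral_const_mul' _ _ ENNReal.ofReal_ne_top, weightedVolume,
      ← lintegral_prod (fun e => ‖F e‖ₑ ^ 2) (hFm.pow_const 2).aemeasurable,
      ← Measure.volume_eq_prod, ← lintegral_indicator hE]
    refine mul_le_mul_right (lintegral_mono fun e => ?_) _
    by_cases he : e ∈ E
    · have := hFE e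
      rw [indicator_of_mem he] at this ⊢
      rw [sq, ← hEsq e he]
      exact mul_le_mul' this this
    · have := hFE e
      rw [indicator_of_notMem he] at this
      simp [le_zero_iff.1 this]
  set Φ : ℝ × Rd d → ℝ × Rd d → ℝ≥0∞ := fun e e' =>
    if e'.1 < e.1 - D then ‖F e‖ₑ * ‖F e'‖ₑ * ‖G (e.1 - e'.1) (e'.2 - e.2)‖ₑ else 0 with hΦ
  have hΦm : Measurable fun q : (ℝ × Rd d) × (ℝ × Rd d) => Φ q.1 q.2 := by
    refine Measurable.ite (measurableSet_lt (by fun_prop) (by fun_prop)) ?_ measurable_const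
    have e1 : Measurable fun z : (ℝ × Rd d) × (ℝ × Rd d) => G (z.1.1 - z.2.1) (z.2.2 - z.1.2) :=
      (h.contG.comp (f := fun z : (ℝ × Rd d) × (ℝ × Rd d) => (z.1.1 - z.2.1, z.2.2 - z.1.2))
        (by fun_prop)).measurable
    exact ((hFm.comp measurable_fst).mul (hFm.comp measurable_snd)).mul e1.enorm
  set Q : ℝ → ℝ → ℝ≥0∞ := fun r r' => ∫⁻ y, ∫⁻ y', Φ (r, y) (r', y') with hQ
  have hQm3 : Measurable fun z : (ℝ × ℝ) × Rd d => ∫⁻ y', Φ (z.1.1, z.2) (z.1.2, y') :=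
    Measurable.lintegral_prod_right'
      (f := fun w : ((ℝ × ℝ) × Rd d) × Rd d => Φ (w.1.1.1, w.1.2) (w.1.1.2, w.2))
      (hΦm.comp (g := fun q : (ℝ × Rd d) × (ℝ × Rd d) => Φ q.1 q.2)
        (f := fun w : ((ℝ × ℝ) × Rd d) × Rd d => ((w.1.1.1, w.1.2), (w.1.1.2, w.2)))
        (by fun_prop))
  have hQm : Measurable fun z : ℝ × ℝ => Q z.1 z.2 := hQm3.lintegral_prod_right'
  have hQint : ∫⁻ r, ∫⁻ r', Q r r' ≤ ENNReal.ofReal M * weightedVolume E := by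
    have e1 : ∫⁻ r, ∫⁻ r', Q r r' = ∫⁻ e, ∫⁻ e', Φ e e' := by
      rw [Measure.volume_eq_prod, lintegral_prod _ hΦm.lintegral_prod_right'.aemeasurable]
      refine lintegral_congr fun r => ?_
      rw [lintegral_lintegral_swap (f := fun r' y => ∫⁻ y', Φ (r, y) (r', y')) (hQm3.comp (g := fun z : (ℝ × ℝ) × Rd d =>
        ∫⁻ y', Φ (z.1.1, z.2) (z.1.2, y')) (f := fun w : ℝ × Rd d => ((r, w.1), w.2))
        (by fun_prop)).aemeasurable]
      refine lintegral_congr fun y => ?_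
      rw [lintegral_prod (fun e' => Φ (r, y) e') (hΦm.comp (f := fun e' : ℝ × Rd d => ((r, y), e'))
        (by fun_prop)).aemeasurable]
    rw [e1, weightedVolume, ← lintegral_const_mul' _ _ ENNReal.ofReal_ne_top,
      ← lintegral_indicator hE]
    refine lintegral_mono fun e => ?_
    by_cases he : e ∈ E
    · rw [indicator_of_mem he, ← hEsq e he]
      have h0 := hE0 e he
      have hS : MeasurableSet {e' : ℝ × Rd d | e' ∈ E ∧ e'.1 < e.1 - D} :=
        measurableSet_and hE (measurableSet_lt (by fun_prop) measurable_const)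
      have hFe : ‖F e‖ₑ ≤ ENNReal.ofReal ((1 + e.1) ^ α) := by
        simpa [indicator_of_mem he] using hFE e
      calc ∫⁻ e', Φ e e' ≤ ∫⁻ e', ENNReal.ofReal ((1 + e.1) ^ α) *
            {e' | e' ∈ E ∧ e'.1 < e.1 - D}.indicator (fun e' =>
              ENNReal.ofReal ((1 + e'.1) ^ α) * ‖G (e.1 - e'.1) (e'.2 - e.2)‖ₑ) e' := by
            refine lintegral_mono fun e' => ?_
            simp only [hΦ]
            split_ifs with hlt
            · by_cases he' : e' ∈ E
              · rw [indicator_of_mem (show e' ∈ {e' | e' ∈ E ∧ e'.1 < e.1 - D} from ⟨he', hlt⟩),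
                  mul_assoc]
                have := hFE e'
                rw [indicator_of_mem he'] at this
                exact mul_le_mul' hFe (mul_le_mul_left this _)
              · have := hFE e'
                rw [indicator_of_notMem he'] at this
                simp [le_zero_iff.1 this]
            · exact zero_le
        _ ≤ ENNReal.ofReal ((1 + e.1) ^ α) * ENNReal.ofReal (M * (1 + e.1) ^ α) := by
            rw [lintegral_const_mul' _ _ ENNReal.ofReal_ne_top, lintegral_indicator hS]
            exact mul_le_mul_right (hfar e he) _
        _ = _ := by rw [ENNReal.ofReal_mul hM, mul_left_comm]
    · have := hFE e
      rw [indicator_of_notMem he] at this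
      simp [hΦ, le_zero_iff.1 this]
  have hJ : ∀ r r', ‖∫ x, conv (K r) (fun y => F (r, y)) x *
        (starRingEnd ℂ) (conv (K r') (fun y => F (r', y)) x)‖ₑ ≤
      ((if |r - r'| ≤ D then m r else 0) + (if |r' - r| ≤ D then m r' else 0)) +
        (Q r r' + Q r' r) := by
    intro r r'
    have hlow : ∀ r r' : ℝ, r' < r - D → ‖∫ x, conv (K r) (fun y => F (r, y)) x *
        (starRingEnd ℂ) (conv (K r') (fun y => F (r', y)) x)‖ₑ ≤ Q r r' := by
      intro r r' hr
      refine (h.enorm_integral_conv_mul_conj_le hd hF r r').trans_eq ?_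
      simp only [hQ, hΦ, if_pos hr]
    rcases lt_or_ge r' (r - D) with hr | hr
    · exact (hlow r r' hr).trans (le_self_add.trans le_add_self)
    rcases lt_or_ge r (r' - D) with hr' | hr'
    · rw [enorm_integral_mul_conj_comm]
      exact (hlow r' r hr').trans (le_add_self.trans le_add_self)
    have hab : |r - r'| ≤ D := abs_le.2 ⟨by linarith, by linarith⟩
    rw [if_pos hab, if_pos (by rwa [abs_sub_comm])]
    refine (enorm_integral_mul_conj_le_add ?_).trans
      ((add_le_add (hconv F hF r) (hconv F hF r')).trans le_self_add)
    exact ((h.stronglyMeasurable_slice hF r).integral_prod_right).aestronglyMeasurable.enorm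
  have hn1 : Measurable fun z : ℝ × ℝ => if |z.1 - z.2| ≤ D then m z.1 else 0 :=
    Measurable.ite (measurableSet_le (by fun_prop) measurable_const) (hmm.comp measurable_fst)
      measurable_const
  have hn2 : Measurable fun z : ℝ × ℝ => if |z.2 - z.1| ≤ D then m z.2 else 0 :=
    Measurable.ite (measurableSet_le (by fun_prop) measurable_const) (hmm.comp measurable_snd)
      measurable_const
  have hnear : ∫⁻ r, ∫⁻ r', (if |r - r'| ≤ D then m r else 0) ≤
      ENNReal.ofReal (2 * D) * (ENNReal.ofReal C * weightedVolume E) := by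
    simp only [lintegral_ite_abs_sub_le]
    rw [lintegral_mul_const' _ _ ENNReal.ofReal_ne_top, mul_comm]
    exact mul_le_mul_right hmint _
  refine (h.lintegral_superpose_sq_le hd hF).trans
    ((lintegral_mono fun r => lintegral_mono fun r' => hJ r r').trans ?_)
  have hsplit : ∫⁻ r, ∫⁻ r', (((if |r - r'| ≤ D then m r else 0) +
      (if |r' - r| ≤ D then m r' else 0)) + (Q r r' + Q r' r)) =
      ((∫⁻ r, ∫⁻ r', if |r - r'| ≤ D then m r else 0) +
        (∫⁻ r, ∫⁻ r', if |r' - r| ≤ D then m r' else 0)) +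
        ((∫⁻ r, ∫⁻ r', Q r r') + ∫⁻ r, ∫⁻ r', Q r' r) := by
    rw [lintegral_lintegral_add (hn1.add hn2), lintegral_lintegral_add hn1,
      lintegral_lintegral_add hQm]
  rw [hsplit, lintegral_lintegral_swap
    (f := fun r r' => if |r' - r| ≤ D then m r' else 0) hn2.aemeasurable,
    lintegral_lintegral_swap (f := fun r r' => Q r' r) (hQm.comp measurable_swap).aemeasurable]
  refine (add_le_add (add_le_add hnear hnear) (add_le_add hQint hQint)).trans_eq ?_
  rw [← mul_assoc, ← ENNReal.ofReal_mul (by positivity), ← add_mul, ← add_mul, ← add_mul,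
    ← ENNReal.ofReal_add (by positivity) (by positivity), ← ENNReal.ofReal_add hM hM,
    ← ENNReal.ofReal_add (by positivity) (by positivity)]
  congr 2
  ring

end IsKernelPair

end

section

open Filter Topology

lemma weightedVolume_mono {d : ℕ} {E E' : Set (ℝ × Rd d)} (h : E ⊆ E') :
    weightedVolume E ≤ weightedVolume E' := lintegral_mono_set h

lemma volume_lt_enorm_le_of_lintegral_sq_le {d : ℕ} {u : Rd d → ℂ} (hu : Measurable u) {A β C : ℝ}
    (hA : 1 ≤ A) {m : ℝ≥0∞} (h : ∫⁻ x, ‖u x‖ₑ ^ 2 ≤ ENNReal.ofReal (C * A) * m) :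
    volume {x | ENNReal.ofReal (A ^ ((β + 1) / 2)) < ‖u x‖ₑ} ≤
      ENNReal.ofReal (C * A ^ (-β)) * m := by
  have hA0 : 0 < A := by linarith
  have hl : 0 < A ^ (β + 1) := by positivity
  have hsq : ENNReal.ofReal (A ^ ((β + 1) / 2)) ^ 2 = ENNReal.ofReal (A ^ (β + 1)) := by
    rw [← ENNReal.ofReal_pow (by positivity), ← Real.rpow_natCast, ← Real.rpow_mul hA0.le]
    congr 2
    push_cast
    ring
  calc _ ≤ volume {x | ENNReal.ofReal (A ^ (β + 1)) ≤ ‖u x‖ₑ ^ 2} := by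
        refine measure_mono fun x hx => ?_
        have : ENNReal.ofReal (A ^ ((β + 1) / 2)) < ‖u x‖ₑ := hx
        show ENNReal.ofReal (A ^ (β + 1)) ≤ ‖u x‖ₑ ^ 2
        rw [← hsq]
        exact pow_le_pow_left₀ (by exact zero_le) this.le 2
    _ ≤ (∫⁻ x, ‖u x‖ₑ ^ 2) / ENNReal.ofReal (A ^ (β + 1)) :=
        meas_ge_le_lintegral_div (hu.enorm.pow_const 2).aemeasurable
          (ENNReal.ofReal_pos.2 hl).ne' ENNReal.ofReal_ne_top
    _ ≤ (ENNReal.ofReal (C * A) * m) / ENNReal.ofReal (A ^ (β + 1)) := by gcongr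
    _ = _ := by
        rw [ENNReal.mul_div_right_comm, ← ENNReal.ofReal_div_of_pos hl]
        congr 2
        rw [Real.rpow_neg hA0.le, Real.rpow_add hA0, Real.rpow_one]
        field_simp

namespace IsKernelPair

variable {d : ℕ} {ρ : Rd d → ℝ} {K G : ℝ → Rd d → ℂ}

lemma exists_weak_type_sparse (h : IsKernelPair ρ K G) (hd : 1 ≤ d) {β : ℝ}
    (hβ1 : 1 < β) (hβ : β ≤ ((d : ℝ) + 3) / 2) :
    ∃ C, 0 ≤ C ∧ ∀ A, 1 ≤ A → ∀ E : Set (ℝ × Rd d), MeasurableSet E → (∀ e ∈ E, 0 ≤ e.1) →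
      ((∀ e ∈ E, 1 + e.1 < 8 * A) ∨ ((∀ e ∈ E, 8 * A ≤ 1 + e.1) ∧ IsSparse A β E)) →
      ∀ F, IsNice F → (∀ e, ‖F e‖ₑ ≤
        E.indicator (fun e => ENNReal.ofReal ((1 + e.1) ^ (((d : ℝ) - 1) / 2))) e) →
      volume {x | ENNReal.ofReal (A ^ ((β + 1) / 2)) < ‖superpose K F x‖ₑ} ≤
        ENNReal.ofReal (C * A ^ (-β)) * weightedVolume E := by
  obtain ⟨C₁, hC₁, h1⟩ := h.exists_lintegral_sq_le hd
  obtain ⟨C₂, hC₂, h2⟩ := h.exists_lintegral_gram_far_le hd hβ1 hβ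
  refine ⟨8 * C₁ + 2 * C₂, by positivity, fun A hA E hE hE0 hcase F hF hFE => ?_⟩
  refine volume_lt_enorm_le_of_lintegral_sq_le (h.measurable_superpose hd hF) hA ?_
  refine (h1 (8 * A) (C₂ * A) (by positivity) (by positivity) E hE hE0 (fun e he => ?_)
    F hF hFE).trans_eq ?_
  · rcases hcase with hc | ⟨hc, hsp⟩
    · have : {e' | e' ∈ E ∧ e'.1 < e.1 - 8 * A} = ∅ := eq_empty_of_forall_notMem fun e' he' => by
        linarith [hc e he, hE0 e' he'.1, he'.2]
      simp [this]
    · rw [mul_assoc]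
      exact h2 A hA E hE hE0 hc hsp e he
  · congr 2
    ring

lemma exists_weak_type_dense (h : IsKernelPair ρ K G) (hd : 1 ≤ d) {β : ℝ}
    (hβ1 : 1 < β) (hβ : β < ((d : ℝ) - 1) / 2) :
    ∃ C, 0 ≤ C ∧ ∀ A, 1 ≤ A → ∀ E : Set (ℝ × Rd d), MeasurableSet E → (∀ e ∈ E, 0 ≤ e.1) →
      ∀ F, IsNice F → (∀ e, ‖F e‖ₑ ≤ (densePart A β E).indicator
        (fun e => ENNReal.ofReal ((1 + e.1) ^ (((d : ℝ) - 1) / 2))) e) →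
      volume {x | ENNReal.ofReal (A ^ ((β + 1) / 2)) < ‖superpose K F x‖ₑ} ≤
        ENNReal.ofReal (C * A ^ (-β)) * weightedVolume E := by
  obtain ⟨C₁, hC₁, h1⟩ := h.exists_exceptional_set hβ
  obtain ⟨C₂, hC₂, h2⟩ := h.exists_lintegral_tail_le hd h.boundK ⌈β⌉₊
  refine ⟨C₁ + C₂, by positivity, fun A hA E hE hE0 F hF hFE => ?_⟩
  have hA0 : 0 < A := by linarith
  have hm := h.cont.measurable
  set α := ((d : ℝ) - 1) / 2 with hα
  obtain ⟨Ω₀, hΩ₀, hsep⟩ := h1 A hA E hE hE0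
  set Ω := toMeasurable volume Ω₀ with hΩ
  have hΩm : MeasurableSet Ω := measurableSet_toMeasurable _ _
  have hl : 1 ≤ A ^ ((β + 1) / 2) := Real.one_le_rpow hA (by linarith)
  have hApow : (1 + A)⁻¹ ^ ⌈β⌉₊ ≤ A ^ (-β) := by
    rw [inv_pow, ← Real.rpow_natCast, Real.rpow_neg hA0.le]
    refine inv_anti₀ (by positivity) ?_
    exact (Real.rpow_le_rpow hA0.le (by linarith) (by linarith)).trans
      (Real.rpow_le_rpow_of_exponent_le (by linarith) (Nat.le_ceil β))
  have hintegral : ∫⁻ x in Ωᶜ, ‖superpose K F x‖ₑ ≤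
      ENNReal.ofReal (C₂ * A ^ (-β)) * weightedVolume E := by
    refine (h.setLIntegral_superpose_le hd hF _).trans ?_
    rw [weightedVolume, ← lintegral_const_mul' _ _ ENNReal.ofReal_ne_top,
      ← lintegral_indicator hE]
    refine lintegral_mono fun e => ?_
    have hFe := hFE e
    by_cases he : e ∈ densePart A β E
    · have h0 := hE0 e he.1
      rw [indicator_of_mem he] at hFe
      rw [indicator_of_mem he.1]
      have hx : ∫⁻ x in Ωᶜ, ‖K e.1 (x - e.2)‖ₑ ≤
          ENNReal.ofReal (C₂ * (1 + e.1) ^ α * A ^ (-β)) := by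
        have hS : MeasurableSet {x : Rd d | A ≤ |ρ x - e.1|} :=
          measurableSet_le measurable_const (by fun_prop)
        calc ∫⁻ x in Ωᶜ, ‖K e.1 (x - e.2)‖ₑ ≤
              ∫⁻ x, {x : Rd d | A ≤ |ρ x - e.1|}.indicator (fun x => ‖K e.1 x‖ₑ) (x - e.2) := by
              rw [← lintegral_indicator hΩm.compl]
              refine lintegral_mono fun x => ?_
              by_cases hx : x ∈ Ωᶜ
              · have : x - e.2 ∈ {x : Rd d | A ≤ |ρ x - e.1|} :=
                  hsep x (fun hx' => hx (subset_toMeasurable _ _ hx')) e he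
                rw [indicator_of_mem hx, indicator_of_mem this]
              · rw [indicator_of_notMem hx]
                exact zero_le
          _ = ∫⁻ x in {x : Rd d | A ≤ |ρ x - e.1|}, ‖K e.1 x‖ₑ := by
              rw [lintegral_sub_right_eq_self
                ({x : Rd d | A ≤ |ρ x - e.1|}.indicator fun x => ‖K e.1 x‖ₑ), lintegral_indicator hS]
          _ ≤ _ := (h2 e.1 h0 A hA0.le).trans (ENNReal.ofReal_le_ofReal (by gcongr))
      refine (mul_le_mul' hFe hx).trans_eq ?_
      rw [← ENNReal.ofReal_mul (by positivity), ← ENNReal.ofReal_mul (by positivity),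
        ← rpow_half_mul_self hd (by linarith)]
      congr 1
      ring
    · rw [indicator_of_notMem he] at hFe
      simp [le_zero_iff.1 hFe]
  calc _ ≤ volume (Ω ∪ {x | 1 ≤ Ωᶜ.indicator (fun x => ‖superpose K F x‖ₑ) x}) := by
        refine measure_mono fun x hx => ?_
        by_cases hxΩ : x ∈ Ω
        · exact Or.inl hxΩ
        · refine Or.inr ?_
          show 1 ≤ Ωᶜ.indicator (fun x => ‖superpose K F x‖ₑ) x
          rw [indicator_of_mem hxΩ, ← ENNReal.ofReal_one]
          exact (ENNReal.ofReal_le_ofReal hl).trans (le_of_lt hx)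
    _ ≤ volume Ω₀ + (∫⁻ x, Ωᶜ.indicator (fun x => ‖superpose K F x‖ₑ) x) / 1 := by
        refine (measure_union_le _ _).trans (add_le_add (measure_toMeasurable _).le ?_)
        exact meas_ge_le_lintegral_div
          ((h.measurable_superpose hd hF).enorm.indicator hΩm.compl).aemeasurable
          one_ne_zero ENNReal.one_ne_top
    _ ≤ _ := by
        rw [div_one, lintegral_indicator hΩm.compl, add_mul,
          ENNReal.ofReal_add (by positivity) (by positivity), add_mul]
        exact add_le_add hΩ₀ hintegral

/-- The restricted weak type estimate. -/
lemma exists_weak_type (h : IsKernelPair ρ K G) (hd : 1 ≤ d) {β : ℝ}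
    (hβ1 : 1 < β) (hβ : β < ((d : ℝ) - 1) / 2) :
    ∃ C, 0 ≤ C ∧ ∀ A, 1 ≤ A → ∀ E : Set (ℝ × Rd d), MeasurableSet E → (∀ e ∈ E, 0 ≤ e.1) →
      ∀ F, IsNice F → (∀ e, ‖F e‖ₑ ≤
        E.indicator (fun e => ENNReal.ofReal ((1 + e.1) ^ (((d : ℝ) - 1) / 2))) e) →
      volume {x | ENNReal.ofReal (3 * A ^ ((β + 1) / 2)) < ‖superpose K F x‖ₑ} ≤
        ENNReal.ofReal (C * A ^ (-β)) * weightedVolume E := by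
  obtain ⟨C₁, hC₁, h1⟩ := h.exists_weak_type_sparse hd hβ1 (by linarith)
  obtain ⟨C₂, hC₂, h2⟩ := h.exists_weak_type_dense hd hβ1 hβ
  refine ⟨C₁ + C₁ + C₂, by positivity, fun A hA E hE hE0 F hF hFE => ?_⟩
  have hD := measurableSet_densePart (A := A) (β := β) hE
  have hL : MeasurableSet {e : ℝ × Rd d | 1 + e.1 < 8 * A} :=
    measurableSet_lt (by fun_prop) measurable_const
  set D := densePart A β E with hDdef
  set E₁ := (E \ D) ∩ {e | 1 + e.1 < 8 * A} with hE₁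
  set E₂ := (E \ D) \ {e | 1 + e.1 < 8 * A} with hE₂
  have hm₁ : MeasurableSet E₁ := (hE.diff hD).inter hL
  have hm₂ : MeasurableSet E₂ := (hE.diff hD).diff hL
  have hs₁ : E₁ ⊆ E := fun e he => he.1.1
  have hs₂ : E₂ ⊆ E := fun e he => he.1.1
  have hbound : ∀ S : Set (ℝ × Rd d), S ⊆ E → ∀ e, ‖S.indicator F e‖ₑ ≤
      S.indicator (fun e => ENNReal.ofReal ((1 + e.1) ^ (((d : ℝ) - 1) / 2))) e := by
    intro S hS e
    by_cases he : e ∈ S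
    · rw [indicator_of_mem he, indicator_of_mem he]
      simpa [indicator_of_mem (hS he)] using hFE e
    · simp [he]
  have hF0 : ∀ e, e ∉ E → F e = 0 := fun e he => by
    have := hFE e
    rw [indicator_of_notMem he] at this
    exact enorm_eq_zero.1 (le_zero_iff.1 this)
  have e1 : (fun e => E₁.indicator F e + E₂.indicator F e) = (E \ D).indicator F := by
    ext e
    by_cases he : e ∈ E \ D <;> by_cases hl : e ∈ {e : ℝ × Rd d | 1 + e.1 < 8 * A} <;>
      simp only [hE₁, hE₂, indicator, mem_inter_iff, Set.mem_sdiff, he, hl] <;> simp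
  have e2 : (fun e => (E \ D).indicator F e + D.indicator F e) = F := by
    ext e
    by_cases he : e ∈ D
    · simp [he]
    · by_cases he' : e ∈ E
      · simp [he, he']
      · simp [he, hF0 e he']
  have n1 := hF.indicator hm₁
  have n2 := hF.indicator hm₂
  have n12 := hF.indicator (hE.diff hD)
  have n3 := hF.indicator hD
  have hsum : ∀ x, superpose K F x = superpose K (E₁.indicator F) x +
      superpose K (E₂.indicator F) x + superpose K (D.indicator F) x := by
    intro x
    have k1 := h.superpose_add hd n12 n3 (by rw [e2]; exact hF) x
    have k2 := h.superpose_add hd n1 n2 (by rw [e1]; exact n12) x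
    rw [e2] at k1
    rw [e1] at k2
    rw [k1, k2]
  set lam := ENNReal.ofReal (A ^ ((β + 1) / 2)) with hlam
  have hcov : {x | ENNReal.ofReal (3 * A ^ ((β + 1) / 2)) < ‖superpose K F x‖ₑ} ⊆
      ({x | lam < ‖superpose K (E₁.indicator F) x‖ₑ} ∪
        {x | lam < ‖superpose K (E₂.indicator F) x‖ₑ}) ∪
        {x | lam < ‖superpose K (D.indicator F) x‖ₑ} := by
    intro x hx
    by_contra hcon
    simp only [mem_union, mem_ofPred_eq, not_or, not_lt] at hcon
    refine absurd (show ENNReal.ofReal (3 * A ^ ((β + 1) / 2)) < ‖superpose K F x‖ₑ from hx)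
      (not_lt.2 ?_)
    rw [hsum, show 3 * A ^ ((β + 1) / 2) = A ^ ((β + 1) / 2) + A ^ ((β + 1) / 2) +
      A ^ ((β + 1) / 2) by ring, ENNReal.ofReal_add (by positivity) (by positivity),
      ENNReal.ofReal_add (by positivity) (by positivity)]
    exact (enorm_add_le _ _).trans (add_le_add ((enorm_add_le _ _).trans
      (add_le_add hcon.1.1 hcon.1.2)) hcon.2)
  refine (measure_mono hcov).trans ((measure_union_le _ _).trans ((add_le_add
    (measure_union_le _ _) le_rfl).trans ?_))
  rw [add_mul, add_mul, ENNReal.ofReal_add (by positivity) (by positivity),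
    ENNReal.ofReal_add (by positivity) (by positivity), add_mul, add_mul]
  refine add_le_add (add_le_add ?_ ?_) ?_
  · refine (h1 A hA E₁ hm₁ (fun e he => hE0 e (hs₁ he)) (Or.inl fun e he => he.2) _ n1
      (hbound _ hs₁)).trans (mul_le_mul_right (weightedVolume_mono hs₁) _)
  · refine (h1 A hA E₂ hm₂ (fun e he => hE0 e (hs₂ he)) (Or.inr ⟨fun e he => not_lt.1 he.2,
      (isSparse_diff_densePart A β E).mono sdiff_subset⟩) _ n2
      (hbound _ hs₂)).trans (mul_le_mul_right (weightedVolume_mono hs₂) _)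
  · exact h2 A hA E hE hE0 _ n3 (hbound D fun e he => he.1)

end IsKernelPair

end

section

open Filter Topology

/-- The measure `(1 + r)^(d-1) dr dy`. -/
def growthMeasure (d : ℕ) : Measure (ℝ × Rd d) :=
  volume.withDensity fun e => ENNReal.ofReal ((1 + e.1) ^ (d - 1))

/-- The size of `F` relative to `(1 + r)^((d-1)/2)`. -/
def profile {d : ℕ} (F : ℝ × Rd d → ℂ) (e : ℝ × Rd d) : ℝ :=
  ‖F e‖ / (1 + e.1) ^ (((d : ℝ) - 1) / 2)

lemma lintegral_growthMeasure {d : ℕ} {u : ℝ × Rd d → ℝ≥0∞} (hu : Measurable u) :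
    ∫⁻ e, u e ∂growthMeasure d = ∫⁻ e, ENNReal.ofReal ((1 + e.1) ^ (d - 1)) * u e :=
  lintegral_withDensity_eq_lintegral_mul _ (by fun_prop) hu

lemma growthMeasure_apply {d : ℕ} {E : Set (ℝ × Rd d)} (hE : MeasurableSet E) :
    growthMeasure d E = weightedVolume E := withDensity_apply _ hE

namespace IsNice

variable {d : ℕ} {F : ℝ × Rd d → ℂ}

lemma nonneg_of_ne (hF : IsNice F) {e : ℝ × Rd d} (he : F e ≠ 0) : 0 ≤ e.1 := by
  obtain ⟨B, hB⟩ := hF.supp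
  exact (hB e he).1

lemma measurable_profile (hF : IsNice F) : Measurable (profile F) :=
  hF.meas.norm.div (by fun_prop)

lemma profile_nonneg (hF : IsNice F) (e : ℝ × Rd d) : 0 ≤ profile F e := by
  by_cases he : F e = 0
  · simp [profile, he]
  · have := hF.nonneg_of_ne he
    unfold profile
    positivity

lemma norm_eq (hF : IsNice F) (e : ℝ × Rd d) :
    ‖F e‖ = profile F e * (1 + e.1) ^ (((d : ℝ) - 1) / 2) := by
  by_cases he : F e = 0
  · simp [profile, he]
  · have := hF.nonneg_of_ne he
    unfold profile
    rw [div_mul_cancel₀ _ (by positivity)]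

end IsNice

lemma profile_const_mul {d : ℕ} (F : ℝ × Rd d → ℂ) (c : ℂ) (e : ℝ × Rd d) :
    profile (fun e => c * F e) e = ‖c‖ * profile F e := by
  simp [profile, mul_div_assoc]

namespace IsKernelPair

variable {d : ℕ} {ρ : Rd d → ℝ} {K G : ℝ → Rd d → ℂ} {F F' : ℝ × Rd d → ℂ}

lemma superpose_const_mul (h : IsKernelPair ρ K G) (hd : 1 ≤ d) (hF : IsNice F) (c : ℂ) (x : Rd d) :
    superpose K (fun e => c * F e) x = c * superpose K F x := by
  rw [h.superpose_eq hd hF, h.superpose_eq hd (hF.const_mul c), ← integral_const_mul]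
  simp only [mul_left_comm]

lemma exists_lintegral_superpose_le (h : IsKernelPair ρ K G) (hd : 1 ≤ d) :
    ∃ C, 0 ≤ C ∧ ∀ F, IsNice F → ∫⁻ x, ‖superpose K F x‖ₑ ≤
      ENNReal.ofReal C * ∫⁻ e, ENNReal.ofReal (profile F e) ∂growthMeasure d := by
  obtain ⟨C, hC, H⟩ := h.exists_lintegral_enorm_le hd
  refine ⟨C, hC, fun F hF => ?_⟩
  have := h.setLIntegral_superpose_le hd hF univ
  simp only [Measure.restrict_univ] at this
  refine this.trans ?_
  rw [lintegral_growthMeasure hF.measurable_profile.ennreal_ofReal,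
    ← lintegral_const_mul' _ _ ENNReal.ofReal_ne_top]
  refine lintegral_mono fun e => ?_
  by_cases he : F e = 0
  · simp [he]
  have he1 := hF.nonneg_of_ne he
  have hp := hF.profile_nonneg e
  rw [lintegral_sub_right_eq_self (fun x => ‖K e.1 x‖ₑ)]
  refine (mul_le_mul_right (H e.1 he1) _).trans (le_of_eq ?_)
  rw [← ofReal_norm, hF.norm_eq, ← ENNReal.ofReal_mul (by positivity),
    ← ENNReal.ofReal_mul (by positivity), ← ENNReal.ofReal_mul (by positivity),
    ← rpow_half_mul_self hd (by positivity)]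
  congr 1
  ring

lemma exists_volume_piece_le (h : IsKernelPair ρ K G) (hd : 1 ≤ d) {β q : ℝ} (hβ1 : 1 < β)
    (hβ : β < ((d : ℝ) - 1) / 2) (hq : 0 < q) :
    ∃ C, 0 ≤ C ∧ ∀ t, 0 < t → t ≤ 1 → ∀ F, IsNice F →
      (∀ e, F e ≠ 0 → t ≤ profile F e ∧ profile F e ≤ 2 * t) →
      volume {x | ENNReal.ofReal (6 * t ^ (1 - q / β * ((β + 1) / 2))) < ‖superpose K F x‖ₑ} ≤
        ENNReal.ofReal C * ∫⁻ e, ENNReal.ofReal (profile F e ^ q) ∂growthMeasure d := by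
  obtain ⟨C, hC, H⟩ := h.exists_weak_type hd hβ1 hβ
  refine ⟨C, hC, fun t ht ht1 F hF hFt => ?_⟩
  have hE : MeasurableSet {e | F e ≠ 0} := hF.meas (measurableSet_singleton 0).compl
  have hβ0 : 0 < β := by linarith
  have hA : 1 ≤ t ^ (-(q / β)) :=
    one_le_rpow_of_pos_of_le_one_of_nonpos ht ht1 (neg_nonpos.mpr (by positivity))
  have key := H _ hA {e | F e ≠ 0} hE (fun e he => hF.nonneg_of_ne he)
    (fun e => ((t⁻¹ / 2 : ℝ) : ℂ) * F e) (hF.const_mul _) ?_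
  · have e1 : (t ^ (-(q / β))) ^ (-β) = t ^ q := by
      rw [← rpow_mul ht.le]
      congr 1
      field_simp
    have e2 : 3 * (t ^ (-(q / β))) ^ ((β + 1) / 2) =
        (t⁻¹ / 2) * (6 * t ^ (1 - q / β * ((β + 1) / 2))) := by
      rw [← rpow_mul ht.le, sub_eq_add_neg, rpow_add ht, rpow_one]
      field_simp
      ring
    rw [e1, ENNReal.ofReal_mul hC, mul_assoc, e2] at key
    refine le_trans (measure_mono fun x hx => ?_) (key.trans ?_)
    · simp only [mem_ofPred_eq] at hx ⊢
      rw [h.superpose_const_mul hd hF, enorm_mul, ← ofReal_norm, Complex.norm_real,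
        ENNReal.ofReal_mul (by positivity), norm_of_nonneg (by positivity)]
      exact ENNReal.mul_lt_mul_right (by simpa using ht) ENNReal.ofReal_ne_top hx
    · refine mul_le_mul_right ?_ _
      rw [← growthMeasure_apply hE, ← setLIntegral_const, ← lintegral_indicator hE]
      refine lintegral_mono fun e => ?_
      by_cases he : F e = 0
      · simp [he]
      · rw [indicator_of_mem (show e ∈ {e | F e ≠ 0} from he)]
        exact ENNReal.ofReal_le_ofReal (rpow_le_rpow ht.le (hFt e he).1 hq.le)
  · intro e
    by_cases he : F e = 0
    · simp [he]
    have := hF.nonneg_of_ne he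
    rw [indicator_of_mem (show e ∈ {e | F e ≠ 0} from he), ← ofReal_norm, norm_mul,
      Complex.norm_real, norm_of_nonneg (by positivity), hF.norm_eq]
    refine ENNReal.ofReal_le_ofReal ?_
    rw [← mul_assoc]
    refine mul_le_of_le_one_left (by positivity) ?_
    have := (hFt e he).2
    calc t⁻¹ / 2 * profile F e ≤ t⁻¹ / 2 * (2 * t) := by gcongr
      _ = 1 := by field_simp

end IsKernelPair

end

section

open Filter Topology

/-- `u` for `u ≥ 1` and `u ^ q` for `u < 1`. -/
def mixedPow (q u : ℝ) : ℝ≥0∞ :=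
  if 1 ≤ u then ENNReal.ofReal u else ENNReal.ofReal (u ^ q)

lemma measurable_mixedPow (q : ℝ) : Measurable (mixedPow q) :=
  Measurable.ite measurableSet_Ici ENNReal.measurable_ofReal
    (measurable_id.pow_const q).ennreal_ofReal

/-- The number `j` with `2 ^ (-j) ≤ u < 2 ^ (1 - j)` when `0 < u < 1`, and `0` otherwise. -/
def dyadicIndex (u : ℝ) : ℕ := ⌈-Real.logb 2 u⌉₊

lemma measurable_dyadicIndex : Measurable dyadicIndex :=
  Nat.measurable_ceil.comp (Real.measurable_log.div_const _).neg

lemma dyadicIndex_eq_zero {u : ℝ} (hu : 0 < u) (h : dyadicIndex u = 0) : 1 ≤ u := by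
  have h1 : -Real.logb 2 u ≤ 0 := Nat.ceil_eq_zero.1 h
  exact (Real.logb_nonneg_iff one_lt_two hu).1 (by linarith)

lemma dyadicIndex_bounds {u : ℝ} (hu : 0 < u) (h : dyadicIndex u ≠ 0) :
    u < 1 ∧ (2 : ℝ) ^ (-(dyadicIndex u : ℝ)) ≤ u ∧ u ≤ 2 * 2 ^ (-(dyadicIndex u : ℝ)) := by
  have h0 : 0 < -Real.logb 2 u := by
    by_contra hn
    exact h (Nat.ceil_eq_zero.2 (not_lt.1 hn))
  have h1 : -Real.logb 2 u ≤ dyadicIndex u := Nat.le_ceil _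
  have h2 : (dyadicIndex u : ℝ) < -Real.logb 2 u + 1 := Nat.ceil_lt_add_one h0.le
  refine ⟨?_, ?_, ?_⟩
  · exact (Real.logb_neg_iff one_lt_two hu).1 (by linarith)
  · exact (Real.le_logb_iff_rpow_le one_lt_two hu).1 (by linarith)
  · have : u ≤ 2 ^ (1 - (dyadicIndex u : ℝ)) :=
      (Real.logb_le_iff_le_rpow one_lt_two hu).1 (by linarith)
    rwa [sub_eq_add_neg, rpow_add two_pos, rpow_one] at this

namespace IsKernelPair

variable {d : ℕ} {ρ : Rd d → ℝ} {K G : ℝ → Rd d → ℂ} {F F' : ℝ × Rd d → ℂ}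

lemma enorm_superpose_le_tsum (h : IsKernelPair ρ K G) (hd : 1 ≤ d) (hF : IsNice F)
    {S : ℕ → Set (ℝ × Rd d)} (hS : ∀ j, MeasurableSet (S j))
    (hdis : Pairwise (Function.onFun Disjoint S)) (hU : ⋃ j, S j = univ) (x : Rd d) :
    ‖superpose K F x‖ₑ ≤ ∑' j, ‖superpose K ((S j).indicator F) x‖ₑ := by
  have hi := h.integrable_mul hd hF x
  have := (hasSum_integral_iUnion hS hdis (by rw [hU]; exact hi.integrableOn)).tsum_eq
  rw [hU, Measure.restrict_univ, ← h.superpose_eq hd hF] at this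
  rw [← this]
  refine enorm_tsum_le_tsum_enorm.trans (le_of_eq (tsum_congr fun j => ?_))
  rw [h.superpose_eq hd (hF.indicator (hS j)), ← integral_indicator (hS j)]
  congr 2
  funext e
  by_cases he : e ∈ S j <;> simp [he]

lemma exists_volume_superpose_le (h : IsKernelPair ρ K G) (hd : 1 ≤ d) {β q : ℝ} (hβ1 : 1 < β)
    (hβ : β < ((d : ℝ) - 1) / 2) (hq : 0 < q) (hqβ : q / β * ((β + 1) / 2) < 1) :
    ∃ L C, 0 < L ∧ 0 ≤ C ∧ ∀ F, IsNice F → volume {x | ENNReal.ofReal L < ‖superpose K F x‖ₑ} ≤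
      ENNReal.ofReal C * ∫⁻ e, mixedPow q (profile F e) ∂growthMeasure d := by
  obtain ⟨C₁, hC₁, H₁⟩ := h.exists_lintegral_superpose_le hd
  obtain ⟨C₂, hC₂, H₂⟩ := h.exists_volume_piece_le hd hβ1 hβ hq
  set κ : ℝ := 1 - q / β * ((β + 1) / 2) with hκ
  have hκ0 : 0 < κ := by linarith
  set ℓ : ℕ → ℝ := fun j => 6 * ((2 : ℝ) ^ (-(j : ℝ))) ^ κ with hℓ
  have hℓeq : ℓ = fun j : ℕ => 6 * ((2 : ℝ) ^ (-κ)) ^ j := by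
    funext j
    simp only [hℓ]
    rw [← rpow_mul two_pos.le, ← rpow_natCast, ← rpow_mul two_pos.le]
    congr 2
    ring
  have hsum : Summable ℓ := by
    rw [hℓeq]
    exact (summable_geometric_of_lt_one (by positivity)
      (rpow_lt_one_of_one_lt_of_neg one_lt_two (by linarith))).mul_left _
  have hℓ0 : ∀ j, 0 < ℓ j := fun j => by simp only [hℓ]; positivity
  refine ⟨∑' j, ℓ j, C₁ + C₂, hsum.tsum_pos (fun j => (hℓ0 j).le) 0 (hℓ0 0), by positivity,
    fun F hF => ?_⟩
  set S : ℕ → Set (ℝ × Rd d) := fun j => {e | dyadicIndex (profile F e) = j} with hS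
  have hSm : ∀ j, MeasurableSet (S j) := fun j =>
    (measurable_dyadicIndex.comp hF.measurable_profile) (measurableSet_singleton j)
  have hdis : Pairwise (Function.onFun Disjoint S) := fun i j hij =>
    Set.disjoint_left.2 fun e hi hj => hij (hi.symm.trans hj)
  have hU : ⋃ j, S j = univ := eq_univ_of_forall fun e => mem_iUnion.2 ⟨_, rfl⟩
  have hn : ∀ j, IsNice ((S j).indicator F) := fun j => hF.indicator (hSm j)
  have hcov : {x | ENNReal.ofReal (∑' j, ℓ j) < ‖superpose K F x‖ₑ} ⊆
      ⋃ j, {x | ENNReal.ofReal (ℓ j) < ‖superpose K ((S j).indicator F) x‖ₑ} := by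
    intro x hx
    by_contra hcon
    simp only [mem_iUnion, mem_ofPred_eq, not_exists, not_lt] at hcon
    refine absurd (show ENNReal.ofReal (∑' j, ℓ j) < ‖superpose K F x‖ₑ from hx) (not_lt.2 ?_)
    rw [ENNReal.ofReal_tsum_of_nonneg (fun j => (hℓ0 j).le) hsum]
    exact (h.enorm_superpose_le_tsum hd hF hSm hdis hU x).trans (ENNReal.tsum_le_tsum hcon)
  have hprof : ∀ j e, profile ((S j).indicator F) e = (S j).indicator (profile F) e := by
    intro j e
    by_cases he : e ∈ S j <;> simp [profile, he]
  have piece : ∀ j, volume {x | ENNReal.ofReal (ℓ j) < ‖superpose K ((S j).indicator F) x‖ₑ} ≤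
      ENNReal.ofReal (C₁ + C₂) * ∫⁻ e in S j, mixedPow q (profile F e) ∂growthMeasure d := by
    intro j
    rw [← lintegral_indicator (hSm j)]
    rcases Nat.eq_zero_or_pos j with rfl | hj
    · have hℓ1 : 1 ≤ ENNReal.ofReal (ℓ 0) := by
        simp [hℓ]
      refine (?_ : _ ≤ ∫⁻ x, ‖superpose K ((S 0).indicator F) x‖ₑ).trans ((H₁ _ (hn 0)).trans ?_)
      · refine le_trans ?_ (mul_meas_ge_le_lintegral₀
          (h.measurable_superpose hd (hn 0)).enorm.aemeasurable 1)
        rw [one_mul]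
        exact measure_mono fun x hx => hℓ1.trans (le_of_lt hx)
      · refine mul_le_mul' (ENNReal.ofReal_le_ofReal (by linarith)) (lintegral_mono fun e => ?_)
        rw [hprof]
        by_cases he : e ∈ S 0
        · rw [indicator_of_mem he, indicator_of_mem he]
          rcases (hF.profile_nonneg e).eq_or_lt with h0 | h0
          · simp [← h0]
          · rw [mixedPow, if_pos (dyadicIndex_eq_zero h0 he)]
        · simp [he]
    · have hbd : ∀ e, (S j).indicator F e ≠ 0 → profile F e < 1 ∧
          2 ^ (-(j : ℝ)) ≤ profile F e ∧ profile F e ≤ 2 * 2 ^ (-(j : ℝ)) := by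
        intro e he
        have hmem : e ∈ S j := mem_of_indicator_ne_zero he
        have hFe : F e ≠ 0 := by rwa [indicator_of_mem hmem] at he
        have hpos : 0 < profile F e := by
          refine (hF.profile_nonneg e).lt_of_ne fun h0 => hFe ?_
          rw [← norm_eq_zero, hF.norm_eq, ← h0, zero_mul]
        have := dyadicIndex_bounds hpos (by rw [show dyadicIndex (profile F e) = j from hmem]; omega)
        rwa [show dyadicIndex (profile F e) = j from hmem] at this
      refine (H₂ (2 ^ (-(j : ℝ))) (by positivity)
        (rpow_le_one_of_one_le_of_nonpos one_le_two (by simp)) _ (hn j) ?_).trans ?_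
      · intro e he
        rw [hprof, indicator_of_mem (mem_of_indicator_ne_zero he)]
        exact (hbd e he).2
      · refine mul_le_mul' (ENNReal.ofReal_le_ofReal (by linarith)) (lintegral_mono fun e => ?_)
        by_cases he : (S j).indicator F e = 0
        · simp [profile, he, zero_rpow hq.ne']
        · have hmem := mem_of_indicator_ne_zero he
          rw [hprof, indicator_of_mem hmem, indicator_of_mem hmem, mixedPow,
            if_neg (not_le.2 (hbd e he).1)]
  calc _ ≤ ∑' j, volume {x | ENNReal.ofReal (ℓ j) < ‖superpose K ((S j).indicator F) x‖ₑ} :=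
        (measure_mono hcov).trans (measure_iUnion_le _)
    _ ≤ _ := ENNReal.tsum_le_tsum piece
    _ = _ := by
      rw [ENNReal.tsum_mul_left, ← lintegral_iUnion hSm hdis, hU, Measure.restrict_univ]

end IsKernelPair

end

section

open Filter Topology

lemma lintegral_mixedPow_le {p q u : ℝ} (hp : 1 < p) (hq : p < q) (hu : 0 ≤ u) :
    ∫⁻ t in Ioi (0 : ℝ), mixedPow q (u / t) * ENNReal.ofReal (t ^ (p - 1)) ≤
      ENNReal.ofReal (1 / (p - 1) + 1 / (q - p)) * ENNReal.ofReal (u ^ p) := by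
  rcases hu.eq_or_lt with rfl | hu
  · refine le_of_eq_of_le ?_ zero_le
    simp [mixedPow, zero_rpow (by linarith : q ≠ 0)]
  have h1 : ∫⁻ t in Ioc 0 u, mixedPow q (u / t) * ENNReal.ofReal (t ^ (p - 1)) =
      ENNReal.ofReal (1 / (p - 1) * u ^ p) := by
    have hi : IntervalIntegrable (fun t : ℝ => u * t ^ (p - 2)) volume 0 u :=
      (intervalIntegral.intervalIntegrable_rpow' (by linarith)).const_mul _
    have e : ∫ t in Ioc 0 u, u * t ^ (p - 2) = 1 / (p - 1) * u ^ p := by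
      rw [← intervalIntegral.integral_of_le hu.le, intervalIntegral.integral_const_mul,
        integral_rpow (Or.inl (by linarith)), show p - 2 + 1 = p - 1 by ring,
        zero_rpow (by linarith), sub_zero, rpow_sub_one hu.ne']
      field_simp
    rw [← e, ofReal_integral_eq_lintegral_ofReal
      ((intervalIntegrable_iff_integrableOn_Ioc_of_le hu.le).1 hi)
      ((ae_restrict_mem measurableSet_Ioc).mono fun t ht => by
        have := ht.1
        simp only [Pi.zero_apply]
        positivity)]
    refine setLIntegral_congr_fun measurableSet_Ioc fun t ht => ?_
    have ht0 : 0 < t := ht.1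
    rw [mixedPow, if_pos ((one_le_div ht0).2 ht.2), ← ENNReal.ofReal_mul (by positivity),
      show p - 1 = p - 2 + 1 by ring, rpow_add_one ht0.ne']
    congr 1
    field_simp
  have h2 : ∫⁻ t in Ioi u, mixedPow q (u / t) * ENNReal.ofReal (t ^ (p - 1)) =
      ENNReal.ofReal (1 / (q - p) * u ^ p) := by
    have hi : IntegrableOn (fun t : ℝ => u ^ q * t ^ (p - 1 - q)) (Ioi u) :=
      (integrableOn_Ioi_rpow_of_lt (by linarith) hu).const_mul _
    have e : ∫ t in Ioi u, u ^ q * t ^ (p - 1 - q) = 1 / (q - p) * u ^ p := by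
      rw [integral_const_mul, integral_Ioi_rpow_of_lt (by linarith) hu,
        show p - 1 - q + 1 = p - q by ring, rpow_sub hu]
      have : q - p ≠ 0 := by linarith
      have : p - q ≠ 0 := by linarith
      have : 0 < u ^ q := by positivity
      field_simp
      ring
    rw [← e, ofReal_integral_eq_lintegral_ofReal hi
      ((ae_restrict_mem measurableSet_Ioi).mono fun t ht => by
        have : 0 < t := hu.trans ht
        simp only [Pi.zero_apply]
        positivity)]
    refine setLIntegral_congr_fun measurableSet_Ioi fun t ht => ?_
    have ht0 : 0 < t := hu.trans ht
    rw [mixedPow, if_neg (not_le.2 ((div_lt_one ht0).2 ht)), ← ENNReal.ofReal_mul (by positivity),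
      div_rpow hu.le ht0.le, rpow_sub ht0 (p - 1)]
    congr 1
    ring
  have hq' : 0 ≤ 1 / (q - p) := one_div_nonneg.2 (by linarith)
  have hp' : 0 ≤ 1 / (p - 1) := one_div_nonneg.2 (by linarith)
  rw [← Ioc_union_Ioi_eq_Ioi hu.le]
  refine (lintegral_union_le _ _ _).trans (le_of_eq ?_)
  rw [h1, h2, ← ENNReal.ofReal_add (by positivity) (by positivity),
    ← ENNReal.ofReal_mul (by positivity), add_mul]

instance sFinite_growthMeasure (d : ℕ) : SFinite (growthMeasure d) := by
  unfold growthMeasure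
  infer_instance

namespace IsKernelPair

variable {d : ℕ} {ρ : Rd d → ℝ} {K G : ℝ → Rd d → ℂ} {F F' : ℝ × Rd d → ℂ}

lemma exists_lintegral_rpow_superpose_le_of_one_lt (h : IsKernelPair ρ K G) (hd : 1 ≤ d)
    {β q p : ℝ} (hβ1 : 1 < β) (hβ : β < ((d : ℝ) - 1) / 2) (hp : 1 < p) (hpq : p < q)
    (hqβ : q / β * ((β + 1) / 2) < 1) :
    ∃ C, 0 ≤ C ∧ ∀ F, IsNice F → ∫⁻ x, ‖superpose K F x‖ₑ ^ p ≤
      ENNReal.ofReal C * ∫⁻ e, ENNReal.ofReal (profile F e) ^ p ∂growthMeasure d := by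
  obtain ⟨L, C, hL, hC, H⟩ := h.exists_volume_superpose_le hd hβ1 hβ (by linarith : 0 < q) hqβ
  have hp0 : 0 < p := by linarith
  have hq' : 0 ≤ 1 / (q - p) := one_div_nonneg.2 (by linarith)
  have hp' : 0 ≤ 1 / (p - 1) := one_div_nonneg.2 (by linarith)
  refine ⟨L ^ p * (p * (C * (1 / (p - 1) + 1 / (q - p)))), by positivity, fun F hF => ?_⟩
  have hTm := h.measurable_superpose hd hF
  have hlevel : ∀ t ∈ Ioi (0 : ℝ), volume {x | t < ‖superpose K F x‖ / L} *
      ENNReal.ofReal (t ^ (p - 1)) ≤ ENNReal.ofReal C *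
        ∫⁻ e, mixedPow q (profile F e / t) * ENNReal.ofReal (t ^ (p - 1)) ∂growthMeasure d := by
    intro t ht
    have ht0 : 0 < t := ht
    rw [lintegral_mul_const' _ _ ENNReal.ofReal_ne_top, ← mul_assoc]
    refine mul_le_mul_left ?_ _
    have := H _ (hF.const_mul ((t⁻¹ : ℝ) : ℂ))
    simp only [profile_const_mul, Complex.norm_real, norm_inv, norm_of_nonneg ht0.le] at this
    simp only [← div_eq_inv_mul] at this
    refine (measure_mono fun x hx => ?_).trans this
    simp only [mem_ofPred_eq] at hx ⊢
    rw [h.superpose_const_mul hd hF, ← ofReal_norm, norm_mul, Complex.norm_real, norm_inv,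
      norm_of_nonneg ht0.le, ENNReal.ofReal_lt_ofReal_iff_of_nonneg hL.le]
    rw [lt_div_iff₀ hL] at hx
    rw [inv_mul_eq_div, lt_div_iff₀ ht0]
    linarith
  have hmeas : Measurable fun z : ℝ × (ℝ × Rd d) =>
      mixedPow q (profile F z.2 / z.1) * ENNReal.ofReal (z.1 ^ (p - 1)) :=
    ((measurable_mixedPow q).comp ((hF.measurable_profile.comp measurable_snd).div
      measurable_fst)).mul (by fun_prop)
  calc ∫⁻ x, ‖superpose K F x‖ₑ ^ p
      = ENNReal.ofReal (L ^ p) * ∫⁻ x, ENNReal.ofReal ((‖superpose K F x‖ / L) ^ p) := by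
        rw [← lintegral_const_mul' _ _ ENNReal.ofReal_ne_top]
        refine lintegral_congr fun x => ?_
        rw [← ENNReal.ofReal_mul (by positivity), ← mul_rpow hL.le (by positivity),
          mul_div_cancel₀ _ hL.ne', ← ofReal_norm, ENNReal.ofReal_rpow_of_nonneg (norm_nonneg _) hp0.le]
    _ = ENNReal.ofReal (L ^ p) * (ENNReal.ofReal p * ∫⁻ t in Ioi (0 : ℝ),
          volume {x | t < ‖superpose K F x‖ / L} * ENNReal.ofReal (t ^ (p - 1))) := by
        rw [lintegral_rpow_eq_lintegral_meas_lt_mul volume (ae_of_all _ fun x => by positivity)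
          (hTm.norm.div_const L).aemeasurable hp0]
    _ ≤ ENNReal.ofReal (L ^ p) * (ENNReal.ofReal p * ∫⁻ t in Ioi (0 : ℝ), ENNReal.ofReal C *
        ∫⁻ e, mixedPow q (profile F e / t) * ENNReal.ofReal (t ^ (p - 1)) ∂growthMeasure d) := by
        exact mul_le_mul_right (mul_le_mul_right
          (setLIntegral_mono' measurableSet_Ioi hlevel) _) _
    _ = ENNReal.ofReal (L ^ p) * (ENNReal.ofReal p * (ENNReal.ofReal C *
        ∫⁻ e, (∫⁻ t in Ioi (0 : ℝ),
          mixedPow q (profile F e / t) * ENNReal.ofReal (t ^ (p - 1))) ∂growthMeasure d)) := by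
        rw [lintegral_const_mul' _ _ ENNReal.ofReal_ne_top, lintegral_lintegral_swap
          (f := fun t e => mixedPow q (profile F e / t) * ENNReal.ofReal (t ^ (p - 1)))
          hmeas.aemeasurable]
    _ ≤ ENNReal.ofReal (L ^ p) * (ENNReal.ofReal p * (ENNReal.ofReal C *
        ∫⁻ e, ENNReal.ofReal (1 / (p - 1) + 1 / (q - p)) * ENNReal.ofReal (profile F e ^ p)
          ∂growthMeasure d)) := by
        gcongr with e
        exact lintegral_mixedPow_le hp hpq (hF.profile_nonneg e)
    _ = _ := by
        rw [lintegral_const_mul' _ _ ENNReal.ofReal_ne_top,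
          ENNReal.ofReal_mul (p := L ^ p) (by positivity), ENNReal.ofReal_mul (p := p) (by positivity),
          ENNReal.ofReal_mul (p := C) (by positivity)]
        simp only [mul_assoc, ENNReal.ofReal_rpow_of_nonneg (hF.profile_nonneg _) hp0.le]

lemma exists_lintegral_rpow_superpose_le (h : IsKernelPair ρ K G) (hd : 4 ≤ d) {p : ℝ}
    (hp1 : 1 ≤ p) (hp2 : p < 2 * ((d : ℝ) - 1) / ((d : ℝ) + 1)) :
    ∃ C, 0 ≤ C ∧ ∀ F, IsNice F → ∫⁻ x, ‖superpose K F x‖ₑ ^ p ≤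
      ENNReal.ofReal C * ∫⁻ e, ENNReal.ofReal (profile F e) ^ p ∂growthMeasure d := by
  have hd1 : 1 ≤ d := by omega
  have hdR : (4 : ℝ) ≤ d := by exact_mod_cast hd
  rcases hp1.eq_or_lt with rfl | hp
  · simpa only [ENNReal.rpow_one] using h.exists_lintegral_superpose_le hd1
  rw [lt_div_iff₀ (by linarith)] at hp2
  have hp2' : p < 2 := by nlinarith
  -- `β` between the solution of `p = 2β/(β+1)` and `(d-1)/2`
  obtain ⟨β, hβl, hβ⟩ := exists_between (show p / (2 - p) < ((d : ℝ) - 1) / 2 by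
    rw [div_lt_div_iff₀ (by linarith) two_pos]
    nlinarith)
  have hβ1 : 1 < β := by
    refine lt_trans ?_ hβl
    rw [lt_div_iff₀ (by linarith)]
    linarith
  rw [div_lt_iff₀ (by linarith)] at hβl
  obtain ⟨q, hpq, hq⟩ := exists_between (show p < 2 * β / (β + 1) by
    rw [lt_div_iff₀ (by linarith)]
    nlinarith)
  refine h.exists_lintegral_rpow_superpose_le_of_one_lt hd1 hβ1 hβ hp hpq ?_
  rw [lt_div_iff₀ (by linarith)] at hq
  rw [div_mul_div_comm, div_lt_one (by linarith)]
  linarith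

end IsKernelPair

end

section

open Filter Topology

/-- The weighted norm `∫∫ |f / (1 + |r|)^((d-1)/2)|^p dν_d(r) dy`. -/
def energy {d : ℕ} (p : ℝ) (f : ℝ × Rd d → ℂ) : ℝ≥0∞ :=
  ∫⁻ e, ENNReal.ofReal (‖f e‖ / (1 + |e.1|) ^ (((d : ℝ) - 1) / 2)) ^ p *
    ENNReal.ofReal ((1 + |e.1|) ^ (d - 1))

section energy

variable {d : ℕ} {p : ℝ} {f : ℝ × Rd d → ℂ}

lemma energy_indicator_le (hp : 0 < p) (S : Set (ℝ × Rd d)) :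
    energy p (S.indicator f) ≤ energy p f := by
  refine lintegral_mono fun e => ?_
  by_cases he : e ∈ S <;> simp [he, hp]

lemma energy_conj_neg : energy p (fun e => (starRingEnd ℂ) (f (-e))) = energy p f := by
  have : (volume : Measure (ℝ × Rd d)).IsNegInvariant :=
    ⟨((Measure.measurePreserving_neg (volume : Measure ℝ)).prod
      (Measure.measurePreserving_neg (volume : Measure (Rd d)))).map_eq⟩
  unfold energy
  rw [← lintegral_neg_eq_self]
  simp

lemma IsNice.energy_eq (hf : IsNice f) (hp : 0 < p) :
    energy p f = ∫⁻ e, ENNReal.ofReal (profile f e) ^ p ∂growthMeasure d := by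
  rw [lintegral_growthMeasure (hf.measurable_profile.ennreal_ofReal.pow_const p)]
  refine lintegral_congr fun e => ?_
  by_cases he : f e = 0
  · simp [profile, he, hp]
  · rw [abs_of_nonneg (hf.nonneg_of_ne he), mul_comm]
    rfl

lemma energy_eq_lintegral_nuMeas (hf : Measurable f) : energy p f =
    ∫⁻ y, ∫⁻ r, ENNReal.ofReal (‖f (r, y)‖ / (1 + |r|) ^ (((d : ℝ) - 1) / 2)) ^ p ∂(nuMeas d) := by
  have hm : Measurable fun e : ℝ × Rd d =>
      ENNReal.ofReal (‖f e‖ / (1 + |e.1|) ^ (((d : ℝ) - 1) / 2)) ^ p :=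
    (hf.norm.div (by fun_prop)).ennreal_ofReal.pow_const p
  unfold energy
  rw [Measure.volume_eq_prod, lintegral_prod_symm
    (fun e : ℝ × Rd d => ENNReal.ofReal (‖f e‖ / (1 + |e.1|) ^ (((d : ℝ) - 1) / 2)) ^ p *
      ENNReal.ofReal ((1 + |e.1|) ^ (d - 1))) (hm.mul (by fun_prop)).aemeasurable]
  refine lintegral_congr fun y => ?_
  rw [nuMeas, lintegral_withDensity_eq_lintegral_mul _ (by fun_prop) (g := fun r =>
    ENNReal.ofReal (‖f (r, y)‖ / (1 + |r|) ^ (((d : ℝ) - 1) / 2)) ^ p)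
    (hm.comp (measurable_id.prodMk measurable_const))]
  refine lintegral_congr fun r => ?_
  rw [Pi.mul_apply, mul_comm]

lemma lintegral_enorm_rpow_le_energy (hp : 0 < p) (hd : 1 ≤ d) {B : ℝ}
    (hB : ∀ e, f e ≠ 0 → |e.1| ≤ B) :
    ∫⁻ e, ‖f e‖ₑ ^ p ≤ ENNReal.ofReal ((1 + B) ^ (((d : ℝ) - 1) / 2)) ^ p * energy p f := by
  have hα : 0 ≤ ((d : ℝ) - 1) / 2 := by
    have : (1 : ℝ) ≤ d := by exact_mod_cast hd
    linarith
  unfold energy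
  rw [← lintegral_const_mul' _ _ (ENNReal.rpow_ne_top_of_nonneg hp.le ENNReal.ofReal_ne_top)]
  refine lintegral_mono fun e => ?_
  by_cases he : f e = 0
  · simp [he, hp]
  have hw : 0 < (1 + |e.1|) ^ (((d : ℝ) - 1) / 2) := by positivity
  have h1 : (1 : ℝ≥0∞) ≤ ENNReal.ofReal ((1 + |e.1|) ^ (d - 1)) :=
    ENNReal.one_le_ofReal.2 (one_le_pow₀ (by simp))
  calc ‖f e‖ₑ ^ p = ENNReal.ofReal ((1 + |e.1|) ^ (((d : ℝ) - 1) / 2)) ^ p *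
        (ENNReal.ofReal (‖f e‖ / (1 + |e.1|) ^ (((d : ℝ) - 1) / 2)) ^ p * 1) := by
        rw [mul_one, ← ENNReal.mul_rpow_of_nonneg _ _ hp.le, ← ENNReal.ofReal_mul hw.le,
          mul_div_cancel₀ _ hw.ne', ofReal_norm]
    _ ≤ _ := by
        have := hB e he
        gcongr

end energy

lemma lintegral_enorm_rpow_le_of_tendsto {X : Type*} [MeasurableSpace X] {μ : Measure X} {p : ℝ}
    (hp : 0 < p) {u : X → ℂ} {v : ℕ → X → ℂ} (hv : ∀ n, Measurable (v n)) {M : ℝ≥0∞}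
    (huv : ∀ x, u x = 0 ∨ Tendsto (fun n => v n x) atTop (𝓝 (u x)))
    (hM : ∀ n, ∫⁻ x, ‖v n x‖ₑ ^ p ∂μ ≤ M) : ∫⁻ x, ‖u x‖ₑ ^ p ∂μ ≤ M := by
  calc ∫⁻ x, ‖u x‖ₑ ^ p ∂μ ≤ ∫⁻ x, liminf (fun n => ‖v n x‖ₑ ^ p) atTop ∂μ := by
        refine lintegral_mono fun x => ?_
        rcases huv x with hx | hx
        · simp [hx, hp]
        · have : Tendsto (fun n => ‖v n x‖ₑ ^ p) atTop (𝓝 (‖u x‖ₑ ^ p)) :=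
            ((ENNReal.continuous_rpow_const.comp continuous_enorm).tendsto _).comp hx
          exact this.liminf_eq.ge
    _ ≤ liminf (fun n => ∫⁻ x, ‖v n x‖ₑ ^ p ∂μ) atTop :=
        lintegral_liminf_le fun n => (hv n).enorm.pow_const p
    _ ≤ M := by
        refine (liminf_le_liminf (Eventually.of_forall hM)).trans ?_
        simp

lemma ENNReal.le_one_add_rpow {p : ℝ} (hp : 1 ≤ p) (u : ℝ≥0∞) : u ≤ 1 + u ^ p := by
  rcases le_total u 1 with hu | hu
  · exact hu.trans le_self_add
  · exact (ENNReal.le_rpow_self_of_one_le hu hp).trans le_add_self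

namespace IsKernelPair

variable {d : ℕ} {ρ : Rd d → ℝ} {K G : ℝ → Rd d → ℂ} {f : ℝ × Rd d → ℂ} {p : ℝ}

lemma measurable_superpose_of_measurable (h : IsKernelPair ρ K G) (hf : Measurable f) :
    Measurable (superpose K f) := by
  have h1 : StronglyMeasurable fun z : (Rd d × ℝ) × Rd d => K z.1.2 (z.1.1 - z.2) * f (z.1.2, z.2) := by
    have hK : Measurable fun z : (Rd d × ℝ) × Rd d => K z.1.2 (z.1.1 - z.2) :=
      (h.contK.comp (f := fun z : (Rd d × ℝ) × Rd d => (z.1.2, z.1.1 - z.2))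
        (by fun_prop)).measurable
    exact (hK.mul (hf.comp (by fun_prop))).stronglyMeasurable
  exact (StronglyMeasurable.integral_prod_right' h1).integral_prod_right'.measurable

lemma integrable_mul_of_energy (h : IsKernelPair ρ K G) (hd : 1 ≤ d) (hp : 1 ≤ p)
    (hf : Measurable f) {B : ℝ} (hB : ∀ e, f e ≠ 0 → 0 ≤ e.1 ∧ e.1 ≤ B) (hE : energy p f < ∞)
    (x : Rd d) : Integrable fun e : ℝ × Rd d => K e.1 (x - e.2) * f e := by
  obtain ⟨C₁, hC₁, H₁⟩ := h.exists_lintegral_enorm_le hd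
  obtain ⟨C₂, hC₂, H₂⟩ := h.exists_norm_le hd
  have hp0 : 0 < p := by linarith
  have hα : 0 ≤ ((d : ℝ) - 1) / 2 := by
    have : (1 : ℝ) ≤ d := by exact_mod_cast hd
    linarith
  have hK : Measurable fun e : ℝ × Rd d => K e.1 (x - e.2) :=
    (h.contK.comp (f := fun e : ℝ × Rd d => (e.1, x - e.2)) (by fun_prop)).measurable
  refine ⟨(hK.mul hf).aestronglyMeasurable, ?_⟩
  have hstrip : MeasurableSet (Icc 0 B ×ˢ (univ : Set (Rd d))) :=
    measurableSet_Icc.prod MeasurableSet.univ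
  have hle : ∀ e : ℝ × Rd d, ‖K e.1 (x - e.2) * f e‖ₑ ≤
      (Icc 0 B ×ˢ univ).indicator (fun e => ‖K e.1 (x - e.2)‖ₑ) e +
        ENNReal.ofReal C₂ * ‖f e‖ₑ ^ p := by
    intro e
    by_cases he : f e = 0
    · simp [he]
    rw [indicator_of_mem (show e ∈ Icc 0 B ×ˢ (univ : Set (Rd d)) from ⟨hB e he, trivial⟩),
      enorm_mul]
    have : ‖K e.1 (x - e.2)‖ₑ ≤ ENNReal.ofReal C₂ := by
      rw [← ofReal_norm]
      exact ENNReal.ofReal_le_ofReal (H₂ _ (hB e he).1 _)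
    calc _ ≤ ‖K e.1 (x - e.2)‖ₑ * (1 + ‖f e‖ₑ ^ p) := by
          gcongr
          exact ENNReal.le_one_add_rpow hp _
      _ ≤ _ := by
          rw [mul_add, mul_one]
          gcongr
  refine (lintegral_mono hle).trans_lt ?_
  rw [lintegral_add_left (hK.enorm.indicator hstrip), ENNReal.add_lt_top,
    lintegral_const_mul' _ _ ENNReal.ofReal_ne_top, lintegral_indicator hstrip]
  constructor
  · rw [Measure.volume_eq_prod, ← Measure.prod_restrict, Measure.restrict_univ,
      lintegral_prod (fun e : ℝ × Rd d => ‖K e.1 (x - e.2)‖ₑ) hK.enorm.aemeasurable]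
    refine (setLIntegral_mono' (g := fun _ =>
      ENNReal.ofReal (C₁ * (1 + B) ^ (((d : ℝ) - 1) / 2))) measurableSet_Icc fun r hr => ?_).trans_lt ?_
    · rw [lintegral_sub_left_eq_self (fun y => ‖K r y‖ₑ)]
      refine (H₁ r hr.1).trans (ENNReal.ofReal_le_ofReal ?_)
      have := hr.1
      have := hr.2
      gcongr
    · rw [setLIntegral_const]
      exact ENNReal.mul_lt_top ENNReal.ofReal_lt_top (by simp)
  · refine ENNReal.mul_lt_top ENNReal.ofReal_lt_top ((lintegral_enorm_rpow_le_energy (B := B) hp0 hd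
      (fun e he => ?_)).trans_lt (ENNReal.mul_lt_top ?_ hE))
    · rw [abs_of_nonneg (hB e he).1]
      exact (hB e he).2
    · exact (ENNReal.rpow_ne_top_of_nonneg hp0.le ENNReal.ofReal_ne_top).lt_top

end IsKernelPair

end

section

open Filter Topology

namespace IsKernelPair

variable {d : ℕ} {ρ : Rd d → ℝ} {K G : ℝ → Rd d → ℂ} {f : ℝ × Rd d → ℂ} {p : ℝ}

lemma lintegral_superpose_le_of_strip (h : IsKernelPair ρ K G) (hd : 1 ≤ d) (hp : 1 ≤ p) {C : ℝ≥0∞}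
    (hC : ∀ F, IsNice F → ∫⁻ x, ‖superpose K F x‖ₑ ^ p ≤ C * energy p F)
    (hf : Measurable f) {B : ℝ} (hB : ∀ e, f e ≠ 0 → 0 ≤ e.1 ∧ e.1 ≤ B) (hE : energy p f < ∞) :
    ∫⁻ x, ‖superpose K f x‖ₑ ^ p ≤ C * energy p f := by
  have hp0 : 0 < p := by linarith
  set S : ℕ → Set (ℝ × Rd d) := fun n => {e | ‖e.2‖ ≤ n ∧ ‖f e‖ ≤ n} with hS
  have hSm : ∀ n, MeasurableSet (S n) := fun n => measurableSet_and
    (measurableSet_le (by fun_prop) measurable_const) (measurableSet_le hf.norm measurable_const)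
  have hmono : Monotone S := fun m n hmn e he =>
    ⟨he.1.trans (Nat.cast_le.2 hmn), he.2.trans (Nat.cast_le.2 hmn)⟩
  have hU : ⋃ n, S n = univ := by
    refine eq_univ_of_forall fun e => mem_iUnion.2 ?_
    obtain ⟨n, hn⟩ := exists_nat_ge (max ‖e.2‖ ‖f e‖)
    exact ⟨n, (le_max_left _ _).trans hn, (le_max_right _ _).trans hn⟩
  have hnice : ∀ n, IsNice ((S n).indicator f) := fun n =>
    { meas := hf.indicator (hSm n)
      bdd := ⟨n, fun e => by
        by_cases he : e ∈ S n
        · rw [indicator_of_mem he]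
          exact he.2
        · simp [he]⟩
      supp := ⟨max B n, fun e he => by
        have hmem := mem_of_indicator_ne_zero he
        rw [indicator_of_mem hmem] at he
        exact ⟨(hB e he).1, (hB e he).2.trans (le_max_left _ _), hmem.1.trans (le_max_right _ _)⟩⟩ }
  refine lintegral_enorm_rpow_le_of_tendsto hp0 (fun n => h.measurable_superpose hd (hnice n))
    (fun x => Or.inr ?_) fun n => (hC _ (hnice n)).trans
      (mul_le_mul_right (energy_indicator_le hp0 _) _)
  have hi := h.integrable_mul_of_energy hd hp hf hB hE x
  have ht := tendsto_setIntegral_of_monotone hSm hmono (by rw [hU]; exact hi.integrableOn)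
  rw [hU, Measure.restrict_univ] at ht
  have e1 : superpose K f x = ∫ e : ℝ × Rd d, K e.1 (x - e.2) * f e := by
    rw [Measure.volume_eq_prod, integral_prod _ hi]
    rfl
  rw [e1]
  refine ht.congr fun n => ?_
  rw [h.superpose_eq hd (hnice n), ← integral_indicator (hSm n)]
  refine integral_congr_ae (ae_of_all _ fun e => ?_)
  by_cases he : e ∈ S n <;> simp [he]

end IsKernelPair

lemma superpose_indicator {d : ℕ} (K : ℝ → Rd d → ℂ) (f : ℝ × Rd d → ℂ) {S : Set ℝ}
    (hS : MeasurableSet S) (x : Rd d) :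
    superpose K ((Prod.fst ⁻¹' S).indicator f) x =
      ∫ r in S, conv (K r) (fun y => f (r, y)) x := by
  unfold superpose
  rw [← integral_indicator hS]
  refine integral_congr_ae (ae_of_all _ fun r => ?_)
  by_cases hr : r ∈ S <;> simp [hr, conv, indicator]

lemma enorm_superpose_le_add {d : ℕ} (K : ℝ → Rd d → ℂ) (f : ℝ × Rd d → ℂ) {S : Set ℝ}
    (hS : MeasurableSet S) (x : Rd d) :
    ‖superpose K f x‖ₑ ≤ ‖superpose K ((Prod.fst ⁻¹' S).indicator f) x‖ₑ +
      ‖superpose K ((Prod.fst ⁻¹' Sᶜ).indicator f) x‖ₑ := by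
  by_cases hi : Integrable fun r => conv (K r) (fun y => f (r, y)) x
  · rw [superpose_indicator K f hS, superpose_indicator K f hS.compl, superpose,
      ← integral_add_compl hS hi]
    exact enorm_add_le _ _
  · rw [superpose, integral_undef hi]
    simp

lemma superpose_conj_neg {d : ℕ} {K : ℝ → Rd d → ℂ}
    (hK : ∀ r x, K (-r) x = (starRingEnd ℂ) (K r (-x))) (f : ℝ × Rd d → ℂ) (x : Rd d) :
    superpose K (fun e => (starRingEnd ℂ) (f (-e))) x = (starRingEnd ℂ) (superpose K f (-x)) := by
  unfold superpose conv
  rw [← integral_neg_eq_self, ← integral_conj]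
  refine integral_congr_ae (ae_of_all _ fun r => ?_)
  simp only
  rw [← integral_neg_eq_self, ← integral_conj]
  refine integral_congr_ae (ae_of_all _ fun y => ?_)
  simp only [hK, map_mul, Prod.neg_mk, neg_neg]
  congr 3
  abel

namespace IsKernelPair

variable {d : ℕ} {ρ : Rd d → ℝ} {K G : ℝ → Rd d → ℂ} {f : ℝ × Rd d → ℂ} {p : ℝ}

lemma lintegral_superpose_le_of_nonneg (h : IsKernelPair ρ K G) (hd : 1 ≤ d) (hp : 1 ≤ p)
    {C : ℝ≥0∞} (hC : ∀ F, IsNice F → ∫⁻ x, ‖superpose K F x‖ₑ ^ p ≤ C * energy p F)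
    (hf : Measurable f) (hf0 : ∀ e, f e ≠ 0 → 0 ≤ e.1) (hE : energy p f < ∞) :
    ∫⁻ x, ‖superpose K f x‖ₑ ^ p ≤ C * energy p f := by
  have hp0 : 0 < p := by linarith
  have hm : ∀ n : ℕ, Measurable ((Prod.fst ⁻¹' Iic (n : ℝ)).indicator f) := fun n =>
    hf.indicator (measurable_fst measurableSet_Iic)
  refine lintegral_enorm_rpow_le_of_tendsto hp0
    (fun n => h.measurable_superpose_of_measurable (hm n)) (fun x => ?_) fun n =>
      (h.lintegral_superpose_le_of_strip hd hp hC (hm n) (B := n) (fun e he => ?_)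
        ((energy_indicator_le hp0 _).trans_lt hE)).trans
          (mul_le_mul_right (energy_indicator_le hp0 _) _)
  · by_cases hi : Integrable fun r => conv (K r) (fun y => f (r, y)) x
    · right
      have hU : ⋃ n : ℕ, Iic (n : ℝ) = univ := eq_univ_of_forall fun r => by
        obtain ⟨n, hn⟩ := exists_nat_ge r
        exact mem_iUnion.2 ⟨n, hn⟩
      have ht := tendsto_setIntegral_of_monotone (s := fun n : ℕ => Iic (n : ℝ))
        (fun n => measurableSet_Iic) (fun m n hmn => Iic_subset_Iic.2 (Nat.cast_le.2 hmn))
        (by rw [hU]; exact hi.integrableOn)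
      rw [hU, Measure.restrict_univ] at ht
      simp only [superpose_indicator K f measurableSet_Iic]
      exact ht
    · left
      rw [superpose, integral_undef hi]
  · have hmem := mem_of_indicator_ne_zero he
    rw [indicator_of_mem hmem] at he
    exact ⟨hf0 e he, hmem⟩

lemma lintegral_superpose_le (h : IsKernelPair ρ K G) (hd : 1 ≤ d) (hp : 1 ≤ p)
    (hK : ∀ r x, K (-r) x = (starRingEnd ℂ) (K r (-x)))
    {C : ℝ≥0∞} (hC : ∀ F, IsNice F → ∫⁻ x, ‖superpose K F x‖ₑ ^ p ≤ C * energy p F)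
    (hf : Measurable f) (hE : energy p f < ∞) :
    ∫⁻ x, ‖superpose K f x‖ₑ ^ p ≤ 2 ^ p * C * energy p f := by
  have hp0 : 0 < p := by linarith
  set f₁ := (Prod.fst ⁻¹' Ici (0 : ℝ)).indicator f with hf₁
  set f₂ := (Prod.fst ⁻¹' (Ici (0 : ℝ))ᶜ).indicator f with hf₂
  set g : ℝ × Rd d → ℂ := fun e => (starRingEnd ℂ) (f₂ (-e)) with hg
  have m₁ : Measurable f₁ := hf.indicator (measurable_fst measurableSet_Ici)
  have m₂ : Measurable f₂ := hf.indicator (measurable_fst measurableSet_Ici.compl)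
  have mg : Measurable g :=
    Complex.continuous_conj.measurable.comp (m₂.comp measurable_neg)
  have E₁ : energy p f₁ ≤ energy p f := energy_indicator_le hp0 _
  have Eg : energy p g ≤ energy p f := energy_conj_neg.trans_le (energy_indicator_le hp0 _)
  have b₁ : ∫⁻ x, ‖superpose K f₁ x‖ₑ ^ p ≤ C * energy p f :=
    (h.lintegral_superpose_le_of_nonneg hd hp hC m₁ (fun e he =>
      show e ∈ Prod.fst ⁻¹' Ici (0 : ℝ) from mem_of_indicator_ne_zero he)
      (E₁.trans_lt hE)).trans (mul_le_mul_right E₁ _)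
  have b₂ : ∫⁻ x, ‖superpose K f₂ x‖ₑ ^ p ≤ C * energy p f := by
    have hg0 : ∀ e, g e ≠ 0 → 0 ≤ e.1 := by
      intro e he
      have hmem : -e ∈ Prod.fst ⁻¹' (Ici (0 : ℝ))ᶜ :=
        mem_of_indicator_ne_zero (f := f) fun h0 => he (by simp only [hg, hf₂, h0, map_zero])
      have : ¬ 0 ≤ -e.1 := hmem
      linarith
    refine le_of_eq_of_le ?_ ((h.lintegral_superpose_le_of_nonneg hd hp hC mg hg0
      (Eg.trans_lt hE)).trans (mul_le_mul_right Eg _))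
    rw [← lintegral_neg_eq_self]
    refine lintegral_congr fun x => ?_
    rw [hg, superpose_conj_neg hK, ← ofReal_norm, ← ofReal_norm, RCLike.norm_conj]
  have hpow : (2 : ℝ≥0∞) ^ p = 2 ^ (p - 1) * 2 := by
    conv_rhs => rw [← ENNReal.rpow_one 2, ← ENNReal.rpow_mul, one_mul,
      ← ENNReal.rpow_add _ _ two_ne_zero ENNReal.ofNat_ne_top, sub_add_cancel]
  calc ∫⁻ x, ‖superpose K f x‖ₑ ^ p
      ≤ ∫⁻ x, 2 ^ (p - 1) * (‖superpose K f₁ x‖ₑ ^ p + ‖superpose K f₂ x‖ₑ ^ p) := by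
        refine lintegral_mono fun x => le_trans ?_ (ENNReal.rpow_add_le_mul_rpow_add_rpow _ _ hp)
        exact ENNReal.rpow_le_rpow (enorm_superpose_le_add K f measurableSet_Ici x) hp0.le
    _ = 2 ^ (p - 1) * ((∫⁻ x, ‖superpose K f₁ x‖ₑ ^ p) + ∫⁻ x, ‖superpose K f₂ x‖ₑ ^ p) := by
        rw [lintegral_const_mul' _ _ (ENNReal.rpow_ne_top_of_nonneg (by linarith)
          ENNReal.ofNat_ne_top), lintegral_add_left
            ((h.measurable_superpose_of_measurable m₁).enorm.pow_const p)]
    _ ≤ 2 ^ (p - 1) * (C * energy p f + C * energy p f) := by gcongr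
    _ = 2 ^ p * C * energy p f := by
        rw [hpow]
        ring

end IsKernelPair

end

/-- the model inequality (Proposition 2.1):
`‖∫ K_r ∗ f(r,·) dr‖_p^p ≲ ∫∫ |f(r,y)/(1+|r|)^{(d-1)/2}|^p dν_d(r) dy`. -/
theorem statement2 (d : ℕ) (hd : 4 ≤ d) (a : Rd d → ℝ) (ha : IsDistFn a)
    (hcurv : CurvNondeg a) (η : ℝ → ℝ) (hη : IsBump η)
    (p : ℝ) (hp1 : 1 ≤ p) (hp2 : p < 2 * ((d : ℝ) - 1) / ((d : ℝ) + 1)) :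
    ∃ C : ℝ, 0 < C ∧ ∀ f : ℝ × Rd d → ℂ, Measurable f →
      eLpNorm (fun x : Rd d => ∫ r : ℝ, conv (Kker a η r) (fun y => f (r, y)) x)
          (ENNReal.ofReal p) volume ^ p ≤
        ENNReal.ofReal C *
          ∫⁻ y : Rd d, ∫⁻ r : ℝ,
            ENNReal.ofReal (‖f (r, y)‖ / (1 + |r|) ^ (((d : ℝ) - 1) / 2)) ^ p
              ∂(nuMeas d) ∂volume := by
  have hp0 : 0 < p := by linarith
  have h := ha.isKernelPair hcurv (by omega) hη.isCutoff
  obtain ⟨C, hC, H⟩ := h.exists_lintegral_rpow_superpose_le hd hp1 hp2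
  refine ⟨2 ^ p * (C + 1), by positivity, fun f hf => ?_⟩
  rw [← energy_eq_lintegral_nuMeas hf, eLpNorm_eq_lintegral_rpow_enorm_toReal
    (ENNReal.ofReal_pos.2 hp0).ne' ENNReal.ofReal_ne_top, ENNReal.toReal_ofReal hp0.le,
    ← ENNReal.rpow_mul, one_div_mul_cancel hp0.ne', ENNReal.rpow_one]
  rcases eq_top_or_lt_top (energy p f) with hE | hE
  · rw [hE, ENNReal.mul_top (ENNReal.ofReal_pos.2 (by positivity)).ne']
    exact le_top
  rw [ENNReal.ofReal_mul (by positivity), ← ENNReal.ofReal_rpow_of_pos two_pos,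
    ENNReal.ofReal_ofNat]
  refine h.lintegral_superpose_le (by omega) hp1 IsDistFn.Kker_neg (fun F hF => ?_) hf hE
  rw [hF.energy_eq hp0]
  exact (H F hF).trans (mul_le_mul_left (ENNReal.ofReal_le_ofReal (by linarith)) _)
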